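/- Let G be a *-graph in which every vertex has degree 4 or 6. Then G admits a *-embedding into the plane if and only if G does not contain a Vassiliev obstruct. -/

import Mathlib

/-!
We model a finite multigraph combinatorially by its half-edges ("darts"):
`edgeInv` is a fixed-point-free involution pairing the two darts of each edge,
and the vertices are the cycles of the permutation `rot`; the cycle of `rot`
through a dart is a chosen orientation of the unoriented cyclic order
(the *-structure) at that vertex.  All notions defined below are invariant
under reversing the chosen orientation at a vertex, so such a structure
faithfully represents a *-graph.  An embedding of the graph into the sphere
(equivalently, the plane) is modelled, as usual in topological graph theory,
by a rotation system whose Euler characteristic is `2` on every connected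
component; it is a *-embedding when the rotation at each vertex agrees with
the *-structure or with its reversal.
-/

/-- A *-graph, encoded by half-edges (darts). -/
structure StarGraph where
  /-- the type of darts (half-edges) -/
  D : Type
  [fintypeD : Fintype D]
  [decEqD : DecidableEq D]
  /-- the fixed-point-free involution matching the two darts of each edge -/
  edgeInv : Equiv.Perm D
  /-- a permutation whose cycles are the vertices; its cycle through a dart is a
  chosen orientation of the unoriented cyclic order (*-structure) at that vertex -/
  rot : Equiv.Perm D
  edgeInv_invol : ∀ d, edgeInv (edgeInv d) = d
  edgeInv_ne : ∀ d, edgeInv d ≠ d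

attribute [instance] StarGraph.fintypeD StarGraph.decEqD

namespace StarGraph

variable (G : StarGraph)

/-- Two darts emanate from the same vertex iff they lie on the same cycle of `rot`. -/
def SameVertex (d e : G.D) : Prop := G.rot.SameCycle d e

/-- The degree of the vertex from which the dart `d` emanates. -/
noncomputable def degree (d : G.D) : ℕ := Nat.card {e : G.D // G.SameVertex d e}

/-- The number of cycles (orbits, including fixed points) of a permutation. -/
noncomputable def cycleCount {α : Type*} (f : Equiv.Perm α) : ℕ :=
  Nat.card (Quotient (Equiv.Perm.SameCycle.setoid f))

/-- The number of vertices. -/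
noncomputable def numVertices : ℕ := cycleCount G.rot

/-- The number of edges. -/
noncomputable def numEdges : ℕ := Fintype.card G.D / 2

/-- The number of connected components. -/
noncomputable def numComponents : ℕ :=
  Nat.card (Quotient (Relation.EqvGen.setoid (fun d e : G.D => e = G.rot d ∨ e = G.edgeInv d)))

/-- The number of faces of the embedding determined by the rotation system `ρ`:
the number of cycles of the face permutation `ρ * edgeInv`. -/
noncomputable def numFaces (ρ : Equiv.Perm G.D) : ℕ := cycleCount (ρ * G.edgeInv)

/-- `ρ` is a rotation system compatible with the *-structure:  at each vertex it
agrees with the chosen orientation of the cyclic order or with its reversal. -/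
def IsCompatibleRotation (ρ : Equiv.Perm G.D) : Prop :=
  ∀ d : G.D, (∀ e, G.SameVertex d e → ρ e = G.rot e) ∨
             (∀ e, G.SameVertex d e → ρ e = G.rot⁻¹ e)

/-- `ρ` is a rotation system describing a *-embedding of `G` into the sphere
(equivalently, the plane): it is compatible with the *-structure and has Euler
characteristic `2` on each connected component. -/
def IsPlanarStarEmbedding (ρ : Equiv.Perm G.D) : Prop :=
  G.IsCompatibleRotation ρ ∧
    (G.numVertices : ℤ) - G.numEdges + G.numFaces ρ = 2 * G.numComponents

/-- `G` admits a *-embedding into the plane. -/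
def StarPlanar : Prop := ∃ ρ : Equiv.Perm G.D, G.IsPlanarStarEmbedding ρ

end StarGraph

/-- A cycle in the sense of Vassiliev's planarity criterion: a closed walk,
recorded by the cyclically ordered sequence of darts it traverses, that repeats
no edge (repeated vertices are allowed). -/
structure ClosedTrail (G : StarGraph) where
  /-- the number of edges of the cycle -/
  len : ℕ
  len_pos : 0 < len
  /-- the dart along which the walk leaves its `i`-th vertex -/
  dart : ZMod len → G.D
  /-- the walk is closed: the head of each traversed edge is the tail of the next -/
  next_sameVertex : ∀ i, G.SameVertex (G.edgeInv (dart i)) (dart (i + 1))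
  /-- no edge is repeated -/
  edges_injective : ∀ i j, (dart i = dart j ∨ dart i = G.edgeInv (dart j)) → i = j

/-- Two closed trails have no common edge. -/
def ClosedTrail.EdgeDisjoint {G : StarGraph} (A B : ClosedTrail G) : Prop :=
  ∀ i j, A.dart i ≠ B.dart j ∧ A.dart i ≠ G.edgeInv (B.dart j)

/-- The least positive number of steps needed to get from `x` to `y` along the
permutation `σ` (junk value `0` if `y` is not on the cycle of `x`). -/
noncomputable def stepsTo {α : Type*} (σ : Equiv.Perm α) (x y : α) : ℕ :=
  sInf {m : ℕ | 0 < m ∧ (σ ^ m) x = y}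

/-- The four darts `a₁, a₂, b₁, b₂`, lying on one cycle of `σ`, appear in this
cycle in alternating order: starting at `a₁`, one of `b₁, b₂` is met strictly
before `a₂` and the other strictly after.  This is invariant under replacing
`σ` by `σ⁻¹`, i.e. it only depends on the unoriented cyclic order. -/
def Alternating {α : Type*} (σ : Equiv.Perm α) (a₁ a₂ b₁ b₂ : α) : Prop :=
  (stepsTo σ a₁ b₁ < stepsTo σ a₁ a₂ ∧ stepsTo σ a₁ a₂ < stepsTo σ a₁ b₂) ∨
  (stepsTo σ a₁ b₂ < stepsTo σ a₁ a₂ ∧ stepsTo σ a₁ a₂ < stepsTo σ a₁ b₁)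

/-- The pair of passes `(i, j)` is a crossing of the closed trails `A` and `B`:
at its `i`-th step `A` passes through a vertex `v` along the half-edges
`A₁ = edgeInv (A.dart (i-1))` (incoming) and `A₂ = A.dart i` (outgoing), `B`
passes through the same vertex `v` at its `j`-th step along `B₁, B₂`, and
`A₁, B₁, A₂, B₂` alternate in the cyclic order at `v`.  Counting crossings
means counting such pairs `(i, j)`, i.e. crossings are counted with
multiplicity. -/
def ClosedTrail.IsCrossing {G : StarGraph} (A B : ClosedTrail G)
    (p : ZMod A.len × ZMod B.len) : Prop :=
  G.SameVertex (A.dart p.1) (B.dart p.2) ∧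
  Alternating G.rot (G.edgeInv (A.dart (p.1 - 1))) (A.dart p.1)
    (G.edgeInv (B.dart (p.2 - 1))) (B.dart p.2)

/-- A Vassiliev obstruct: a pair of edge-disjoint cycles having exactly one
crossing (with multiplicity). -/
def HasVassilievObstruct (G : StarGraph) : Prop :=
  ∃ A B : ClosedTrail G, A.EdgeDisjoint B ∧
    Nat.card {p : ZMod A.len × ZMod B.len // A.IsCrossing B p} = 1


namespace VO

lemma z2 (a : ZMod 2) : a = 0 ∨ a = 1 := by
  revert a; decide

lemma z2_ne {a : ZMod 2} (h : a ≠ 0) : a = 1 := (z2 a).resolve_left h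

/-- a sum of values cancelling in pairs under a fixed-point-free involution -/
lemma sum_invol {D : Type*} [Fintype D] (i : D → D) (hi : ∀ d, i (i d) = d)
    (hn : ∀ d, i d ≠ d) (f : D → ZMod 2) (hf : ∀ d, f d + f (i d) = 0) :
    ∑ d, f d = 0 := by
  classical
  exact Finset.sum_involution (fun d _ => i d) (fun d _ => hf d) (fun d _ _ => hn d)
    (fun d _ => Finset.mem_univ _) (fun d _ => hi d)

lemma sum_invol_on {D : Type*} [Fintype D] [DecidableEq D] (s : Finset D) (i : D → D)
    (hi : ∀ d, i (i d) = d) (hn : ∀ d, i d ≠ d) (hs : ∀ d ∈ s, i d ∈ s)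
    (f : D → ZMod 2) (hf : ∀ d ∈ s, f d + f (i d) = 0) :
    ∑ d ∈ s, f d = 0 := by
  exact Finset.sum_involution (fun d _ => i d) (fun d h => hf d h) (fun d _ _ => hn d)
    (fun d h => hs d h) (fun d _ => hi d)

/-- separation of a vector from a subspace by a dot product -/
lemma mem_of_dual {D : Type*} [Fintype D] (W : Submodule (ZMod 2) (D → ZMod 2))
    (v : D → ZMod 2)
    (h : ∀ B : D → ZMod 2, (∀ w ∈ W, ∑ d, B d * w d = 0) → ∑ d, B d * v d = 0) : v ∈ W := by
  classical
  by_contra hv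
  obtain ⟨f, hf, hW⟩ := Submodule.exists_dual_map_eq_bot_of_notMem hv inferInstance
  have key : ∀ w, f w = ∑ d, f (Pi.single d 1) * w d := by
    intro w
    conv_lhs => rw [← Finset.univ_sum_single w]
    rw [map_sum]
    refine Finset.sum_congr rfl fun d _ => ?_
    have : (Pi.single d (w d) : D → ZMod 2) = w d • Pi.single d 1 := by
      rw [← Pi.single_smul]; simp
    rw [this, map_smul, smul_eq_mul, mul_comm]
  apply hf
  rw [key]
  apply h
  intro w hw
  rw [← key]
  have : f w ∈ W.map f := ⟨w, hw, rfl⟩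
  rw [hW] at this
  exact (Submodule.mem_bot _).1 this

end VO


namespace VO

section graphLemma

variable {V : Type*} (Adj : V → V → Prop) (w : V → V → ZMod 2)

/-- there is a walk from `u` to `v` of length `n` and weight `s` -/
inductive Wk : V → V → ℕ → ZMod 2 → Prop
  | nil (u : V) : Wk u u 0 0
  | snoc {u v z : V} {n : ℕ} {s : ZMod 2} : Wk u v n s → Adj v z → Wk u z (n + 1) (s + w v z)

variable {Adj w}

lemma Wk.append {u v z : V} {n m : ℕ} {s t : ZMod 2} (h : Wk Adj w u v n s)
    (h' : Wk Adj w v z m t) : Wk Adj w u z (n + m) (s + t) := by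
  induction h' with
  | nil => simpa using h
  | snoc h1 h2 ih =>
    have := ih.snoc h2
    rw [add_assoc] at this
    rwa [← add_assoc, ← add_assoc] at *

lemma Wk.single {u v : V} (h : Adj u v) : Wk Adj w u v 1 (w u v) := by
  simpa using (Wk.nil u).snoc (w := w) h

lemma Wk.symm (hA : ∀ u v, Adj u v → Adj v u) (hw : ∀ u v, w u v = w v u)
    {u v : V} {n : ℕ} {s : ZMod 2} (h : Wk Adj w u v n s) : Wk Adj w v u n s := by
  induction h with
  | nil => exact Wk.nil _
  | snoc h1 h2 ih =>
    have := (Wk.single (w := w) (hA _ _ h2)).append ih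
    rw [hw, add_comm 1, add_comm (w _ _)] at this
    exact this

lemma Wk.toFun {u v : V} {n : ℕ} {s : ZMod 2} (h : Wk Adj w u v n s) :
    ∃ c : ℕ → V, c 0 = u ∧ c n = v ∧ (∀ i < n, Adj (c i) (c (i + 1))) ∧
      ∑ i ∈ Finset.range n, w (c i) (c (i + 1)) = s := by
  induction h with
  | nil => exact ⟨fun _ => u, rfl, rfl, by simp, by simp⟩
  | @snoc v z n s h1 h2 ih =>
    obtain ⟨c, h0, hn, ha, hs⟩ := ih
    refine ⟨fun i => if i ≤ n then c i else z, by simpa using h0, by simp, ?_, ?_⟩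
    · intro i hi
      rcases Nat.lt_or_ge i n with h | h
      · have h1 : i ≤ n := h.le
        have h2 : i + 1 ≤ n := h
        simp only [h1, h2, if_true]
        exact ha i h
      · have : i = n := by omega
        subst this
        simp [hn, h2]
    · rw [Finset.sum_range_succ]
      congr 1
      · rw [← hs]
        refine Finset.sum_congr rfl fun i hi => ?_
        have h : i < n := Finset.mem_range.1 hi
        have h1 : i ≤ n := h.le
        have h2 : i + 1 ≤ n := h
        simp only [h1, h2, if_true]
      · simp [hn]

lemma Wk.ofFun (c : ℕ → V) (n : ℕ) (hc : ∀ i < n, Adj (c i) (c (i + 1))) (i m : ℕ)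
    (h : i + m ≤ n) :
    Wk Adj w (c i) (c (i + m)) m (∑ j ∈ Finset.range m, w (c (i + j)) (c (i + j + 1))) := by
  induction m with
  | zero => simpa using Wk.nil (c i)
  | succ m ih =>
    rw [Finset.sum_range_succ]
    exact (ih (by omega)).snoc (hc (i + m) (by omega))

/-- a weight whose sum over induced cycles vanishes is a coboundary -/
lemma coboundary (hA : ∀ u v, Adj u v → Adj v u) (hirr : ∀ u, ¬ Adj u u)
    (hw : ∀ u v, w u v = w v u)
    (tri : ∀ a b c, Adj a b → Adj b c → Adj c a → w a b + w b c + w c a = 0)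
    (cyc : ∀ k : ℕ, 4 ≤ k → ∀ c : ZMod k → V, Function.Injective c →
      (∀ i, Adj (c i) (c (i + 1))) → (∀ i j, Adj (c i) (c j) → j = i + 1 ∨ i = j + 1) →
      ∀ s, s = (∑ i ∈ Finset.range k, w (c (i : ZMod k)) (c ((i : ZMod k) + 1))) → s = 0) :
    ∃ x : V → ZMod 2, ∀ u v, Adj u v → w u v = x u + x v := by
  classical
  have closed : ∀ n u s, Wk Adj w u u n s → s = 0 := by
    intro k
    induction k using Nat.strong_induction_on with
    | _ k IH =>
    intro u s hW
    by_contra hs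
    have hs := z2_ne hs
    subst hs
    obtain ⟨c, h0, hk, hc, hsum⟩ := hW.toFun
    have IH' : ∀ m < k, ∀ u s, Wk Adj w u u m s → s = 0 := IH
    -- splitting the sum
    have split : ∀ i m, i + m ≤ k → ∃ s t, Wk Adj w (c i) (c (i + m)) m s ∧
        Wk Adj w (c (i + m)) (c i) (k - m) t ∧ s + t = 1 := by
      intro i m him
      have w1 := Wk.ofFun (w := w) c k hc i m him
      have w2 := Wk.ofFun (w := w) c k hc (i + m) (k - (i + m)) (by omega)
      have w3 := Wk.ofFun (w := w) c k hc 0 i (by omega)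
      rw [show i + m + (k - (i + m)) = k by omega, hk, ← h0] at w2
      rw [zero_add] at w3
      have w4 := w2.append w3
      rw [show k - (i + m) + i = k - m by omega] at w4
      refine ⟨_, _, w1, w4, ?_⟩
      rw [← hsum]
      have e1 := Finset.sum_range_add (fun j => w (c j) (c (j + 1))) i m
      have e2 := Finset.sum_range_add (fun j => w (c j) (c (j + 1))) (i + m) (k - (i + m))
      rw [show i + m + (k - (i + m)) = k by omega] at e2
      rw [e2, e1]
      simp only [zero_add]
      ring
    have hk3 : 3 ≤ k := by
      by_contra hlt
      have : k = 0 ∨ k = 1 ∨ k = 2 := by omega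
      rcases this with rfl | rfl | rfl
      · simp at hsum
      · have := hc 0 (by omega)
        rw [h0] at this
        simp only [zero_add] at this
        rw [hk] at this
        exact hirr _ this
      · simp only [Finset.sum_range_succ, Finset.sum_range_zero, zero_add] at hsum
        rw [show 1 + 1 = 2 from rfl, hk, ← h0, hw (c 1) (c 0)] at hsum
        have : w (c 0) (c 1) + w (c 0) (c 1) = 0 := CharTwo.add_self_eq_zero _
        rw [this] at hsum
        exact absurd hsum (by decide)
    have inj : ∀ i m, 0 < m → i + m < k → c i ≠ c (i + m) := by
      intro i m hm him heq
      obtain ⟨s, t, w1, w2, h⟩ := split i m him.le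
      rw [← heq] at w1 w2
      have a := IH' m (by omega) _ _ w1
      have b := IH' (k - m) (by omega) _ _ w2
      rw [a, b] at h
      exact absurd h (by decide)
    have nadj : ∀ i m, 2 ≤ m → m + 2 ≤ k → i + m < k → ¬ Adj (c i) (c (i + m)) := by
      intro i m hm hmk him hadj
      obtain ⟨s, t, w1, w2, h⟩ := split i m him.le
      have w1' := w1.append (Wk.single (w := w) (hA _ _ hadj))
      have w2' := (Wk.single (w := w) hadj).append w2
      have a := IH' _ (by omega) _ _ w1'
      have b := IH' _ (by omega) _ _ (w2.append (Wk.single (w := w) hadj))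
      rw [hw (c (i + m)) (c i)] at a
      generalize w (c i) (c (i + m)) = q at a b
      have : ∀ s t q : ZMod 2, s + t = 1 → s + q = 0 → t + q = 0 → False := by decide
      exact this s t q h a b
    rcases Nat.lt_or_ge k 4 with h4 | h4
    · have : k = 3 := by omega
      subst this
      have t := tri (c 0) (c 1) (c 2) (hc 0 (by omega)) (hc 1 (by omega))
        (by have := hc 2 (by omega); rwa [hk, ← h0] at this)
      simp only [Finset.sum_range_succ, Finset.sum_range_zero, zero_add] at hsum
      rw [show 1 + 1 = 2 from rfl, show 2 + 1 = 3 from rfl, hk, ← h0, t] at hsum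
      exact absurd hsum (by decide)
    · have : NeZero k := ⟨by omega⟩
      have : Fact (1 < k) := ⟨by omega⟩
      have hval : ∀ i : ZMod k, c (i + 1).val = c (i.val + 1) := by
        intro i
        rcases Nat.lt_or_ge (i.val + 1) k with h | h
        · rw [ZMod.val_add_of_lt (by rwa [ZMod.val_one]), ZMod.val_one]
        · have h2 : i.val + 1 = k := le_antisymm (ZMod.val_lt i) h
          rw [h2, hk, ← h0]
          congr 1
          have : (i + 1) = ((i.val + 1 : ℕ) : ZMod k) := by
            push_cast; rw [ZMod.natCast_zmod_val]
          rw [this, h2]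
          simp
      have one : (1 : ZMod 2) = 0 := by
        refine cyc k h4 (fun i => c i.val) ?_ ?_ ?_ 1 ?_
        · intro i j hij
          apply ZMod.val_injective k
          by_contra hne
          rcases Nat.lt_or_gt_of_ne hne with h | h
          · refine inj i.val (j.val - i.val) (by omega) ?_ ?_
            · have := ZMod.val_lt j; omega
            · rw [show i.val + (j.val - i.val) = j.val by omega]; exact hij
          · refine inj j.val (i.val - j.val) (by omega) ?_ ?_
            · have := ZMod.val_lt i; omega
            · rw [show j.val + (i.val - j.val) = i.val by omega]; exact hij.symm
        · intro i
          simp only [hval]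
          exact hc _ (ZMod.val_lt i)
        · -- induced
          have aux : ∀ i j : ZMod k, i.val < j.val → Adj (c i.val) (c j.val) →
              j = i + 1 ∨ i = j + 1 := by
            intro i j hlt hadj
            have hj := ZMod.val_lt j
            have e : i.val + (j.val - i.val) = j.val := by omega
            by_cases h1 : j.val = i.val + 1
            · left
              rw [← ZMod.natCast_zmod_val j, h1]
              push_cast
              rw [ZMod.natCast_zmod_val]
            · by_cases h2 : j.val - i.val + 2 ≤ k
              · exact absurd (by rwa [e]) (nadj i.val (j.val - i.val) (by omega) h2 (by omega))
              · right
                have hi0 : i.val = 0 := by omega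
                have hjk : j.val + 1 = k := by omega
                have : j + 1 = ((j.val + 1 : ℕ) : ZMod k) := by
                  push_cast; rw [ZMod.natCast_zmod_val]
                rw [this, hjk, ← ZMod.natCast_zmod_val i, hi0]
                simp
          intro i j hadj
          rcases lt_trichotomy i.val j.val with h | h | h
          · exact aux i j h hadj
          · exact absurd (by simpa [h] using hadj) (hirr (c j.val))
          · exact (aux j i h (hA _ _ hadj)).symm
        · rw [← hsum]
          refine Finset.sum_congr rfl fun i hi => ?_
          have hi : i < k := Finset.mem_range.1 hi
          simp only [hval]
          rw [ZMod.val_natCast_of_lt hi]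
      exact absurd one (by decide)
  -- construct the potential
  let r : Setoid V :=
    { r := fun u v => ∃ n s, Wk Adj w u v n s
      iseqv := ⟨fun u => ⟨0, 0, Wk.nil u⟩, fun ⟨n, s, h⟩ => ⟨n, s, h.symm hA hw⟩,
        fun ⟨n, s, h⟩ ⟨m, t, h'⟩ => ⟨n + m, s + t, h.append h'⟩⟩ }
  let b : V → V := fun v => (Quotient.mk r v).out
  have hb : ∀ v, ∃ s n, Wk Adj w (b v) v n s := by
    intro v
    obtain ⟨n, s, h⟩ : r (b v) v := Quotient.exact (Quotient.out_eq _)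
    exact ⟨s, n, h⟩
  choose x n hx using hb
  refine ⟨x, fun u v huv => ?_⟩
  have e : b u = b v := by
    have : Quotient.mk r u = Quotient.mk r v := Quotient.sound ⟨1, _, Wk.single huv⟩
    simp only [b, this]
  have h1 := (hx u).snoc huv
  rw [e] at h1
  have := closed _ _ _ (h1.append ((hx v).symm hA hw))
  generalize x u = p at *
  generalize x v = q at *
  generalize w u v = o at *
  have : ∀ p q o : ZMod 2, p + o + q = 0 → o = p + q := by decide
  exact this _ _ _ ‹_›

end graphLemma

end VO


namespace VO

/-- an abstract 4-valent graph: darts with an edge involution `ι` and a free action of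
`ℤ/2 × ℤ/2` (generated by `σ`, `τ`) whose orbits are the vertices -/
structure Quad (D : Type*) where
  ι : D → D
  σ : D → D
  τ : D → D
  ιι : ∀ d, ι (ι d) = d
  ιn : ∀ d, ι d ≠ d
  σσ : ∀ d, σ (σ d) = d
  σn : ∀ d, σ d ≠ d
  ττ : ∀ d, τ (τ d) = d
  τn : ∀ d, τ d ≠ d
  στ : ∀ d, σ (τ d) = τ (σ d)
  στn : ∀ d, σ (τ d) ≠ d

namespace Quad

variable {D : Type*} (q : Quad D)

/-- even subgraphs -/
def IsZ (A : D → ZMod 2) : Prop :=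
  (∀ d, A (q.ι d) = A d) ∧ ∀ d, A d + A (q.σ d) + A (q.τ d) + A (q.σ (q.τ d)) = 0

variable {q}

lemma IsZ.add {A B : D → ZMod 2} (hA : q.IsZ A) (hB : q.IsZ B) : q.IsZ (A + B) := by
  refine ⟨fun d => by simp [hA.1, hB.1], fun d => ?_⟩
  have h1 := hA.2 d
  have h2 := hB.2 d
  simp only [Pi.add_apply]
  linear_combination h1 + h2

lemma isZ_zero : q.IsZ (0 : D → ZMod 2) := ⟨fun _ => rfl, fun _ => by simp⟩

lemma IsZ.smul {A : D → ZMod 2} (c : ZMod 2) (hA : q.IsZ A) : q.IsZ (c • A) := by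
  refine ⟨fun d => by simp [hA.1], fun d => ?_⟩
  have h1 := hA.2 d
  simp only [Pi.smul_apply, smul_eq_mul]
  linear_combination c * h1

lemma IsZ.sum {T : Type*} (s : Finset T) (f : T → D → ZMod 2) (h : ∀ t, q.IsZ (f t)) :
    q.IsZ (∑ t ∈ s, f t) := by
  classical
  induction s using Finset.induction_on with
  | empty => simpa using isZ_zero
  | insert a s ha ih => rw [Finset.sum_insert ha]; exact (h a).add ih

variable (q)

/-- invariant functions -/
def Inv (A : D → ZMod 2) : Prop :=
  (∀ d, A (q.ι d) = A d) ∧ (∀ d, A (q.σ d) = A d) ∧ (∀ d, A (q.τ d) = A d)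

variable {q}

lemma Inv.mulZ {κ B : D → ZMod 2} (hκ : q.Inv κ) (hB : q.IsZ B) : q.IsZ (κ * B) := by
  refine ⟨fun d => by simp [hκ.1, hB.1], fun d => ?_⟩
  have := hB.2 d
  simp only [Pi.mul_apply, hκ.2.1, hκ.2.2]
  linear_combination κ d * this

lemma Inv.isZ {κ : D → ZMod 2} (hκ : q.Inv κ) : q.IsZ κ := by
  refine ⟨hκ.1, fun d => ?_⟩
  simp only [hκ.2.1, hκ.2.2]
  generalize κ d = a
  revert a; decide

lemma inv_const (a : ZMod 2) : q.Inv (fun _ => a) := ⟨fun _ => rfl, fun _ => rfl, fun _ => rfl⟩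

variable (q)

/-- an alternating form vanishing on edge-disjoint pairs, and a one-circuit smoothing `σ` -/
structure Good (I : (D → ZMod 2) →ₗ[ZMod 2] (D → ZMod 2) →ₗ[ZMod 2] ZMod 2) : Prop where
  alt : ∀ A, q.IsZ A → I A A = 0
  disj : ∀ A B, q.IsZ A → q.IsZ B → (∀ d, A d * B d = 0) → I A B = 0

def HK : Prop := ∀ A : D → ZMod 2, (∀ d, A (q.ι d) = A d) → (∀ d, A (q.σ d) = A d) →
  ∀ d, A (q.τ d) = A d

variable {q}
variable {I : (D → ZMod 2) →ₗ[ZMod 2] (D → ZMod 2) →ₗ[ZMod 2] ZMod 2}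

lemma Good.symm (h : q.Good I) {A B : D → ZMod 2} (hA : q.IsZ A) (hB : q.IsZ B) :
    I A B = I B A := by
  have := h.alt _ (hA.add hB)
  simp only [map_add, LinearMap.add_apply, h.alt _ hA, h.alt _ hB] at this
  generalize I A B = a at *
  generalize I B A = b at *
  revert a b; decide

lemma Good.inv (h : q.Good I) {κ B : D → ZMod 2} (hκ : q.Inv κ) (hB : q.IsZ B) :
    I κ B = 0 := by
  have hκB := hκ.mulZ hB
  have h1 := h.disj (κ + κ * B) (κ * B) (hκ.isZ.add hκB) hκB (fun d => by
    simp only [Pi.add_apply, Pi.mul_apply]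
    generalize κ d = a
    generalize B d = b
    revert a b; decide)
  have h2 := h.disj κ (B + κ * B) hκ.isZ (hB.add hκB) (fun d => by
    simp only [Pi.add_apply, Pi.mul_apply]
    generalize κ d = a
    generalize B d = b
    revert a b; decide)
  simp only [map_add, LinearMap.add_apply, h.alt _ hκB] at h1 h2
  simp only [add_zero] at h1
  rw [h1, add_zero] at h2
  exact h2

lemma Good.inv' (h : q.Good I) {κ B : D → ZMod 2} (hκ : q.Inv κ) (hB : q.IsZ B) :
    I B κ = 0 := by
  rw [h.symm hB hκ.isZ]; exact h.inv hκ hB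

/-- the main vanishing lemma -/
lemma Good.fl (h : q.Good I) (hK : q.HK) {A B : D → ZMod 2} (hA : q.IsZ A) (hB : q.IsZ B)
    (hAB : ∀ d, A d = 0 → B d = 0 → A (q.σ d) = 0 ∧ B (q.σ d) = 0) : I A B = 0 := by
  let U : D → ZMod 2 := fun d => (1 + A d) * (1 + B d)
  have hσ : ∀ d, U (q.σ d) = U d := by
    intro d
    have h1 := hAB d
    have h2 := hAB (q.σ d)
    rw [q.σσ] at h2
    simp only [U]
    generalize A d = a at *
    generalize B d = b at *
    generalize A (q.σ d) = a' at *
    generalize B (q.σ d) = b' at *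
    revert a b a' b'; decide
  have hU0 : ∀ d, U (q.ι d) = U d := fun d => by simp only [U, hA.1, hB.1]
  have hU : q.Inv U := ⟨hU0, hσ, hK U hU0 hσ⟩
  have h1 : q.Inv (fun _ => (1 : ZMod 2)) := inv_const 1
  have e := h.disj (A + ((fun _ => 1) + U)) (B + ((fun _ => 1) + U))
    (hA.add (h1.isZ.add hU.isZ)) (hB.add (h1.isZ.add hU.isZ)) (fun d => by
      simp only [Pi.add_apply, U]
      generalize A d = a
      generalize B d = b
      revert a b; decide)
  simp only [map_add, LinearMap.add_apply, h.inv h1 hB, h.inv hU hB, h.inv h1 h1.isZ,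
    h.inv h1 hU.isZ, h.inv hU h1.isZ, h.inv hU hU.isZ, h.inv' h1 hA, h.inv' hU hA, add_zero] at e
  exact e

variable (q)

/-- the vertices -/
def vs : Setoid D where
  r d e := e = d ∨ e = q.σ d ∨ e = q.τ d ∨ e = q.σ (q.τ d)
  iseqv := by
    refine ⟨fun d => Or.inl rfl, ?_, ?_⟩
    · rintro d e (rfl | rfl | rfl | rfl)
      · simp
      · simp [q.σσ]
      · simp [q.ττ]
      · simp [q.στ, q.σσ, q.ττ]
    · rintro d e f (rfl | rfl | rfl | rfl) (rfl | rfl | rfl | rfl) <;>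
        simp [q.στ, q.σσ, q.ττ]

abbrev V := Quotient q.vs

def vx (d : D) : q.V := Quotient.mk q.vs d

variable {q}

lemma vx_eq {d e : D} : q.vx d = q.vx e ↔ e = d ∨ e = q.σ d ∨ e = q.τ d ∨ e = q.σ (q.τ d) :=
  ⟨fun h => Quotient.exact h, fun h => Quotient.sound h⟩

lemma vx_σ (d : D) : q.vx (q.σ d) = q.vx d := (vx_eq.2 (by simp)).symm
lemma vx_τ (d : D) : q.vx (q.τ d) = q.vx d := (vx_eq.2 (by simp)).symm

lemma vx_surj (v : q.V) : ∃ d, q.vx d = v := ⟨v.out, Quotient.out_eq v⟩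

lemma fiber_sum [Fintype D] [DecidableEq D] [DecidableEq q.V] (d : D) (f : D → ZMod 2) :
    ∑ e ∈ Finset.univ.filter (fun e => q.vx e = q.vx d), f e =
      f d + f (q.σ d) + f (q.τ d) + f (q.σ (q.τ d)) := by
  have : Finset.univ.filter (fun e => q.vx e = q.vx d) =
      {d, q.σ d, q.τ d, q.σ (q.τ d)} := by
    ext e
    simp only [Finset.mem_filter, Finset.mem_univ, true_and, Finset.mem_insert,
      Finset.mem_singleton]
    rw [eq_comm, vx_eq]
  have n1 : q.σ d ≠ q.τ d := fun h => q.στn d (by rw [← h, q.σσ])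
  have n2 : q.σ d ≠ q.σ (q.τ d) := fun h => q.τn d (by
    have := congrArg q.σ h
    rw [q.σσ, q.σσ] at this
    exact this.symm)
  rw [this, Finset.sum_insert, Finset.sum_insert, Finset.sum_insert, Finset.sum_singleton]
  · ring
  · simpa using (q.σn (q.τ d)).symm
  · simp [n1, n2]
  · simp [(q.σn d).symm, (q.τn d).symm, (q.στn d).symm]

variable (q)

/-- an even subgraph changing exactly at the vertex `v` -/
def Arc (v : q.V) (X : D → ZMod 2) : Prop :=
  (∀ d, X (q.ι d) = X d) ∧ (∀ d, q.vx d = v → X (q.σ d) = X d + 1) ∧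
    (∀ d, q.vx d ≠ v → X (q.σ d) = X d)

variable {q}

lemma Arc.isZ {v : q.V} {X : D → ZMod 2} (h : q.Arc v X) : q.IsZ X := by
  refine ⟨h.1, fun d => ?_⟩
  by_cases hd : q.vx d = v
  · rw [h.2.1 d hd, h.2.1 (q.τ d) (by rw [vx_τ, hd])]
    generalize X d = a
    generalize X (q.τ d) = b
    revert a b; decide
  · rw [h.2.2 d hd, h.2.2 (q.τ d) (by rwa [vx_τ])]
    generalize X d = a
    generalize X (q.τ d) = b
    revert a b; decide

lemma Arc.addc {v : q.V} {X : D → ZMod 2} (h : q.Arc v X) (a : ZMod 2) :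
    q.Arc v (X + fun _ => a) := by
  refine ⟨fun d => by simp [h.1], fun d hd => ?_, fun d hd => ?_⟩
  · simp only [Pi.add_apply, h.2.1 d hd]; ring
  · simp only [Pi.add_apply, h.2.2 d hd]

lemma Good.addc (h : q.Good I) {X Y : D → ZMod 2} (hX : q.IsZ X) (hY : q.IsZ Y) (a b : ZMod 2) :
    I (X + fun _ => a) (Y + fun _ => b) = I X Y := by
  simp only [map_add, LinearMap.add_apply, h.inv (inv_const a) hY, h.inv' (inv_const b) hX,
    h.inv (inv_const a) (inv_const b).isZ, add_zero]

/-- existence of arcs, by duality -/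
lemma exists_arc [Fintype D] (hK : q.HK) (v : q.V) : ∃ X, q.Arc v X := by
  classical
  let W : Submodule (ZMod 2) (D → ZMod 2) :=
    { carrier := {Y | ∃ C : D → ZMod 2, (∀ d, C (q.ι d) = C d) ∧ ∀ d, Y d = C d + C (q.σ d)}
      add_mem' := by
        rintro Y Y' ⟨C, h1, h2⟩ ⟨C', h1', h2'⟩
        exact ⟨C + C', fun d => by simp [h1, h1'], fun d => by simp [h2, h2']; ring⟩
      zero_mem' := ⟨0, by simp, by simp⟩
      smul_mem' := by
        rintro c Y ⟨C, h1, h2⟩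
        exact ⟨c • C, fun d => by simp [h1], fun d => by simp [h2]; ring⟩ }
  have : (fun d => if q.vx d = v then (1 : ZMod 2) else 0) ∈ W := by
    apply mem_of_dual
    intro B hB
    let σe : Equiv.Perm D := ⟨q.σ, q.σ, q.σσ, q.σσ⟩
    let ιe : Equiv.Perm D := ⟨q.ι, q.ι, q.ιι, q.ιι⟩
    let P : D → ZMod 2 := fun d => B d + B (q.σ d)
    have hPσ : ∀ d, P (q.σ d) = P d := fun d => by simp only [P, q.σσ]; ring
    -- P is orthogonal to ι-invariant functions
    have hP : ∀ C : D → ZMod 2, (∀ d, C (q.ι d) = C d) → ∑ d, P d * C d = 0 := by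
      intro C hC
      have := hB (fun d => C d + C (q.σ d)) ⟨C, hC, fun d => rfl⟩
      rw [← this]
      simp only [P, add_mul, mul_add, Finset.sum_add_distrib]
      congr 1
      rw [← Equiv.sum_comp σe]
      refine Finset.sum_congr rfl fun d _ => ?_
      show B (q.σ (q.σ d)) * C (q.σ d) = _
      rw [q.σσ]
    have hPι : ∀ d, P (q.ι d) = P d := by
      intro d
      have := hP (fun e => if e = d ∨ e = q.ι d then 1 else 0) (fun e => by
        have : (q.ι e = d ∨ q.ι e = q.ι d) ↔ (e = d ∨ e = q.ι d) := by
          constructor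
          · rintro (h | h)
            · right; rw [← h, q.ιι]
            · left; have := congrArg q.ι h; rwa [q.ιι, q.ιι] at this
          · rintro (rfl | rfl)
            · simp
            · simp [q.ιι]
        simp only [this])
      have e : ∑ e, P e * (if e = d ∨ e = q.ι d then (1 : ZMod 2) else 0) = P d + P (q.ι d) := by
        have : ∀ e, P e * (if e = d ∨ e = q.ι d then (1 : ZMod 2) else 0) =
            (if e = d then P e else 0) + (if e = q.ι d then P e else 0) := by
          intro e
          by_cases h1 : e = d
          · have : e ≠ q.ι d := by rw [h1]; exact (q.ιn d).symm
            simp [h1, (q.ιn d).symm]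
          · by_cases h2 : e = q.ι d <;> simp [h1, h2, q.ιn d]
        simp [this, Finset.sum_add_distrib]
      rw [e] at this
      have h2 : ∀ a b : ZMod 2, a + b = 0 → b = a := by decide
      exact h2 _ _ this
    have hPτ := hK P hPι hPσ
    obtain ⟨d, rfl⟩ := vx_surj v
    have : ∑ e, B e * (if q.vx e = q.vx d then (1 : ZMod 2) else 0) =
        ∑ e ∈ Finset.univ.filter (fun e => q.vx e = q.vx d), B e := by
      rw [Finset.sum_filter]
      refine Finset.sum_congr rfl fun e _ => by split_ifs <;> simp
    rw [this, fiber_sum]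
    have := hPτ d
    simp only [P] at this
    rw [add_assoc, this]
    exact CharTwo.add_self_eq_zero _
  obtain ⟨C, hC, hCd⟩ := this
  refine ⟨C, hC, fun d hd => ?_, fun d hd => ?_⟩
  · have := hCd d
    simp only [hd, if_true] at this
    generalize C d = a at *
    generalize C (q.σ d) = b at *
    revert a b; decide
  · have := hCd d
    simp only [hd, if_false] at this
    generalize C d = a at *
    generalize C (q.σ d) = b at *
    revert a b; decide

end Quad

end VO


namespace VO

namespace Quad

variable {D : Type*} {q : Quad D}
variable {I : (D → ZMod 2) →ₗ[ZMod 2] (D → ZMod 2) →ₗ[ZMod 2] ZMod 2}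

lemma vconst {v : q.V} {F : D → ZMod 2} (h1 : ∀ d, q.vx d = v → F (q.σ d) = F d)
    (h2 : ∀ d, q.vx d = v → F (q.τ d) = F d) : ∃ c, ∀ d, q.vx d = v → F d = c := by
  obtain ⟨d, rfl⟩ := vx_surj v
  refine ⟨F d, fun e he => ?_⟩
  rcases vx_eq.1 he.symm with rfl | rfl | rfl | rfl
  · rfl
  · exact h1 _ rfl
  · exact h2 _ rfl
  · rw [h1 _ (vx_τ d), h2 _ rfl]

lemma Arc.dich {v w : q.V} {Y : D → ZMod 2} (h : q.Arc w Y) (hvw : v ≠ w) :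
    (∀ d, q.vx d = v → Y (q.τ d) = Y d + 1) ∨ ∃ c, ∀ d, q.vx d = v → Y d = c := by
  by_cases hc : ∃ c, ∀ d, q.vx d = v → Y d = c
  · exact Or.inr hc
  · left
    obtain ⟨d, rfl⟩ := vx_surj v
    have hσ : ∀ e, q.vx e = q.vx d → Y (q.σ e) = Y e := fun e he => h.2.2 e (he ▸ hvw)
    have h1 : Y (q.τ d) ≠ Y d := by
      intro h1
      apply hc
      refine ⟨Y d, fun e he => ?_⟩
      rcases vx_eq.1 he.symm with rfl | rfl | rfl | rfl
      · rfl
      · exact hσ _ rfl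
      · exact h1
      · rw [hσ _ (vx_τ d), h1]
    have h2 : ∀ a b : ZMod 2, a ≠ b → a = b + 1 ∧ b = a + 1 := by decide
    have h3 := h2 _ _ h1
    intro e he
    rcases vx_eq.1 he.symm with rfl | rfl | rfl | rfl
    · exact h3.1
    · rw [← q.στ, hσ _ (vx_τ d), hσ _ rfl]; exact h3.1
    · rw [q.ττ]; exact h3.2
    · rw [← q.στ, q.ττ, hσ _ rfl, hσ _ (vx_τ d)]; exact h3.2

lemma key_sum [Fintype D] {v w : q.V} {X Y x : D → ZMod 2} (hX : q.Arc v X) (hY : q.Arc w Y)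
    (hvw : v ≠ w) (hσ : ∀ d, x (q.σ d) = x d) (hτ : ∀ d, x (q.τ d) = x d) (d e : D)
    (hd : q.vx d = v) (he : q.vx e = w) :
    ∑ f, x f * X f * Y f = x d * (Y d + Y (q.τ d)) + x e * (X e + X (q.τ e)) := by
  classical
  have hdτ := (vx_τ d).trans hd
  have heτ := (vx_τ e).trans he
  have : Fintype q.V := Fintype.ofFinite _
  rw [← Finset.sum_fiberwise (s := Finset.univ) (g := fun f => q.vx f)]
  rw [Finset.sum_eq_add v w hvw]
  · subst hd he
    rw [fiber_sum, fiber_sum]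
    simp only [hσ, hτ, hX.2.1 _ rfl, hY.2.1 _ rfl, hX.2.1 _ hdτ, hY.2.1 _ heτ, hX.2.2 _ hvw.symm,
      hY.2.2 _ hvw, hX.2.2 (q.τ e) (heτ ▸ hvw.symm), hY.2.2 (q.τ d) (hdτ ▸ hvw)]
    have h1 : ∀ x X Y X' Y' : ZMod 2, x * X * Y + x * (X + 1) * Y + x * X' * Y' + x * (X' + 1) * Y'
      = x * (Y + Y') := by decide
    have h2 : ∀ x X Y X' Y' : ZMod 2, x * X * Y + x * X * (Y + 1) + x * X' * Y' + x * X' * (Y' + 1)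
      = x * (X + X') := by decide
    rw [h1, h2]
  · rintro u - ⟨h1, h2⟩
    obtain ⟨f, rfl⟩ := vx_surj u
    rw [fiber_sum]
    rw [hX.2.2 f h1, hX.2.2 (q.τ f) (by rwa [vx_τ]), hY.2.2 f h2, hY.2.2 (q.τ f) (by rwa [vx_τ]),
      hσ, hσ]
    have h3 : ∀ a b : ZMod 2, a + a + b + b = 0 := by decide
    exact h3 _ _
  · simp
  · simp

lemma sum_inv_mul [Fintype D] {x A : D → ZMod 2} (hσ : ∀ d, x (q.σ d) = x d)
    (hτ : ∀ d, x (q.τ d) = x d) (hA : q.IsZ A) : ∑ d, x d * A d = 0 := by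
  classical
  have : Fintype q.V := Fintype.ofFinite _
  rw [← Finset.sum_fiberwise (s := Finset.univ) (g := fun f => q.vx f)]
  refine Finset.sum_eq_zero fun u _ => ?_
  obtain ⟨f, rfl⟩ := vx_surj u
  rw [fiber_sum, hσ, hσ, hτ]
  have := hA.2 f
  linear_combination x f * this

lemma lk_symm [Fintype D] {v w : q.V} {X Y : D → ZMod 2} (hX : q.Arc v X) (hY : q.Arc w Y)
    (hvw : v ≠ w) (h : ∀ d, q.vx d = v → Y (q.τ d) = Y d + 1) :
    ∀ d, q.vx d = w → X (q.τ d) = X d + 1 := by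
  intro e he
  obtain ⟨d, hd⟩ := vx_surj v
  have h1 := key_sum (x := fun _ => 1) hX hY hvw (fun _ => rfl) (fun _ => rfl) d e hd he
  rw [sum_invol q.ι q.ιι q.ιn _ (fun d => by
    rw [hX.1, hY.1]; exact CharTwo.add_self_eq_zero _), h d hd] at h1
  have h2 : ∀ a b c : ZMod 2, 0 = 1 * (a + (a + 1)) + 1 * (b + c) → c = b + 1 := by decide
  exact h2 _ _ _ h1

lemma Good.unlinked (h : q.Good I) (hK : q.HK) {v w : q.V} {X Y : D → ZMod 2} (hX : q.Arc v X)
    (hY : q.Arc w Y) {a c : ZMod 2} (ha : ∀ d, q.vx d = w → X d = a)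
    (hc : ∀ d, q.vx d = v → Y d = c) : I X Y = 0 := by
  rw [← h.addc hX.isZ hY.isZ (a + 1) (c + 1)]
  have ne : ∀ a : ZMod 2, a + (a + 1) ≠ 0 := by decide
  refine h.fl hK (hX.addc _).isZ (hY.addc _).isZ fun d h1 h2 => ?_
  simp only [Pi.add_apply] at *
  by_cases hv : q.vx d = v
  · rw [hc d hv] at h2; exact absurd h2 (ne _)
  · by_cases hw : q.vx d = w
    · rw [ha d hw] at h1; exact absurd h1 (ne _)
    · rw [hX.2.2 d hv, hY.2.2 d hw]; exact ⟨h1, h2⟩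

lemma Good.side (hK : q.HK) {u v w : q.V} {X Y : D → ZMod 2} (hX : q.Arc v X)
    (hY : q.Arc w Y) (huv : u ≠ v) (huw : u ≠ w) {a a' c : ZMod 2}
    (ha : ∀ d, q.vx d = w → X d = a) (ha' : ∀ d, q.vx d = u → X d = a')
    (hc : ∀ d, q.vx d = v → Y d = c) (hl : ∀ d, q.vx d = u → Y (q.τ d) = Y d + 1) : a' = a := by
  obtain ⟨d, rfl⟩ := vx_surj u
  have := hK (fun d => (X d + a) * (Y d + c)) (fun d => by simp only [hX.1, hY.1]) (fun e => by
    by_cases hv : q.vx e = v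
    · rw [hc e hv, hc (q.σ e) (by rwa [vx_σ]), CharTwo.add_self_eq_zero, mul_zero, mul_zero]
    · by_cases hw : q.vx e = w
      · rw [ha e hw, ha (q.σ e) (by rwa [vx_σ]), CharTwo.add_self_eq_zero, zero_mul, zero_mul]
      · rw [hX.2.2 e hv, hY.2.2 e hw]) d
  rw [ha' d rfl, ha' (q.τ d) (vx_τ d), hl d rfl] at this
  have h2 : ∀ a a' y c : ZMod 2, (a' + a) * (y + 1 + c) = (a' + a) * (y + c) → a' = a := by decide
  exact h2 _ _ _ _ this

lemma Good.tri (h : q.Good I) (hK : q.HK) {u v w : q.V} {X Y Z : D → ZMod 2} (hX : q.Arc u X)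
    (hY : q.Arc v Y) (hZ : q.Arc w Z) (huv : u ≠ v) (huw : u ≠ w) (hvw : v ≠ w)
    (hXv : ∀ d, q.vx d = v → X (q.τ d) = X d + 1)
    (hXw : ∀ d, q.vx d = w → X (q.τ d) = X d + 1)
    (hYu : ∀ d, q.vx d = u → Y (q.τ d) = Y d + 1)
    (hYw : ∀ d, q.vx d = w → Y (q.τ d) = Y d + 1)
    (hZu : ∀ d, q.vx d = u → Z (q.τ d) = Z d + 1)
    (hZv : ∀ d, q.vx d = v → Z (q.τ d) = Z d + 1) : I X Y + I Y Z + I Z X = 0 := by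
  have hs : ∀ a b : ZMod 2, a + 1 + (b + 1) = a + b := by decide
  obtain ⟨p, hp⟩ := vconst (v := u) (F := fun d => Y d + Z d)
    (fun d hd => by rw [hY.2.2 d (hd ▸ huv), hZ.2.2 d (hd ▸ huw)])
    (fun d hd => by rw [hYu d hd, hZu d hd, hs])
  obtain ⟨k, hk⟩ := vconst (v := v) (F := fun d => X d + Z d)
    (fun d hd => by rw [hX.2.2 d (hd ▸ huv.symm), hZ.2.2 d (hd ▸ hvw)])
    (fun d hd => by rw [hXv d hd, hZv d hd, hs])
  obtain ⟨r, hr⟩ := vconst (v := w) (F := fun d => X d + Y d)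
    (fun d hd => by rw [hX.2.2 d (hd ▸ huw.symm), hY.2.2 d (hd ▸ hvw.symm)])
    (fun d hd => by rw [hXw d hd, hYw d hd, hs])
  have cases4 : ∀ d, (q.vx d = u) ∨ (q.vx d = v) ∨ (q.vx d = w) ∨
      (q.vx d ≠ u ∧ q.vx d ≠ v ∧ q.vx d ≠ w) := by intro d; tauto
  by_cases hpqr : p = k + r
  · exfalso
    obtain ⟨d, hd⟩ := vx_surj u
    have e1 : ∀ k r x y z : ZMod 2, y + z = k + r →
      x * (y + r) + (y + r) * (z + k) + (z + k) * x = y + r := by decide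
    have := hK (fun d => X d * (Y d + r) + (Y d + r) * (Z d + k) + (Z d + k) * X d)
      (fun d => by simp only [hX.1, hY.1, hZ.1]) (fun d => by
        rcases cases4 d with hd | hd | hd | ⟨h1, h2, h3⟩
        · have e := hp d hd
          rw [hX.2.1 d hd, hY.2.2 d (hd ▸ huv), hZ.2.2 d (hd ▸ huw), e1 _ _ _ _ _ (e.trans hpqr),
            e1 _ _ _ _ _ (e.trans hpqr)]
        · have e := hk d hd
          rw [hY.2.1 d hd, hX.2.2 d (hd ▸ huv.symm), hZ.2.2 d (hd ▸ hvw), ← e]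
          generalize X d = x
          generalize Y d = y
          generalize Z d = z
          clear hpqr hr; revert x y z r; decide
        · have e := hr d hd
          rw [hZ.2.1 d hd, hX.2.2 d (hd ▸ huw.symm), hY.2.2 d (hd ▸ hvw.symm), ← e]
          generalize X d = x
          generalize Y d = y
          generalize Z d = z
          clear hpqr hk; revert x y z k; decide
        · rw [hX.2.2 d h1, hY.2.2 d h2, hZ.2.2 d h3]) d
    rw [e1 _ _ _ _ _ ((hp d hd).trans hpqr), e1 _ _ _ _ _ ((hp _ ((vx_τ d).trans hd)).trans hpqr),
      hYu d hd] at this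
    have e2 : ∀ y r : ZMod 2, y + 1 + r ≠ y + r := by decide
    exact e2 _ _ this
  · have hp1 : p = k + r + 1 := by
      revert hpqr
      have : ∀ p k r : ZMod 2, ¬ p = k + r → p = k + r + 1 := by decide
      exact this p k r
    have hXZ := hX.isZ.add hZ.isZ
    have hYZ := hY.isZ.add hZ.isZ
    have := h.fl hK (hXZ.add (inv_const (k + 1)).isZ) (hYZ.add (inv_const (r + k)).isZ)
      (fun d h1 h2 => by
        simp only [Pi.add_apply] at *
        rcases cases4 d with hd | hd | hd | ⟨h3, h4, h5⟩
        · exfalso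
          rw [hp d hd, hp1] at h2
          revert h2
          have : ∀ k r : ZMod 2, ¬ (k + r + 1 + (r + k) = 0) := by decide
          exact this _ _
        · exfalso
          rw [hk d hd] at h1
          revert h1
          have : ∀ k : ZMod 2, ¬ (k + (k + 1) = 0) := by decide
          exact this _
        · exfalso
          have e := hr d hd
          have : ∀ x y z k r : ZMod 2, x + y = r → x + z + (k + 1) = 0 → y + z + (r + k) = 0 →
            False := by decide
          exact this _ _ _ _ _ e h1 h2
        · rw [hX.2.2 d h3, hY.2.2 d h4, hZ.2.2 d h5]; exact ⟨h1, h2⟩)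
    rw [h.addc hXZ hYZ] at this
    simp only [map_add, LinearMap.add_apply, h.alt _ hZ.isZ, h.symm hX.isZ hZ.isZ,
      h.symm hZ.isZ hY.isZ] at this
    rw [← this]; ring

end Quad

end VO


namespace VO

lemma zmod_ne {k : ℕ} (m : ℕ) (h0 : 0 < m) (hm : m < k) : ((m : ℕ) : ZMod k) ≠ 0 := by
  intro h
  rw [ZMod.natCast_eq_zero_iff] at h
  exact absurd (Nat.le_of_dvd h0 h) (by omega)

/-- a proper colouring of a cycle by the nonzero vectors of the plane -/
lemma colours (k : ℕ) (hk : 4 ≤ k) : ∃ s t : ZMod k → ZMod 2,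
    ∀ i, s i * t (i + 1) + s (i + 1) * t i = 1 := by
  have : NeZero k := ⟨by omega⟩
  refine ⟨fun i => if i.val % 2 = 0 ∨ i.val = k - 1 ∧ k % 2 = 1 then 1 else 0,
    fun i => if i.val % 2 = 1 ∨ i.val = k - 1 ∧ k % 2 = 1 then 1 else 0, fun i => ?_⟩
  have hi := ZMod.val_lt i
  have : i.val + 1 < k ∧ (i + 1).val = i.val + 1 ∨ i.val + 1 = k ∧ (i + 1).val = 0 := by
    by_cases h : i.val + 1 < k
    · left; exact ⟨h, by
        rw [ZMod.val_add_of_lt] <;> rw [ZMod.val_one'' (by omega)]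
        exact h⟩
    · right
      refine ⟨by omega, ?_⟩
      have h1 : i.val + 1 = k := by omega
      have : i + 1 = 0 := by
        have h2 := congrArg (Nat.cast : ℕ → ZMod k) h1
        push_cast at h2
        rwa [ZMod.natCast_zmod_val, ZMod.natCast_self] at h2
      rw [this, ZMod.val_zero]
  rcases this with ⟨h1, h2⟩ | ⟨h1, h2⟩ <;> simp only [h2]
  · split_ifs <;> first | omega | decide
  · have h3 : i.val = k - 1 := by omega
    have h4 : ¬ (0 = k - 1) := by omega
    simp only [h3, h4]
    rcases Nat.mod_two_eq_zero_or_one k with h | h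
    · have h5 : (k - 1) % 2 = 1 := by omega
      simp [h, h5]
    · have h5 : (k - 1) % 2 = 0 := by omega
      simp [h, h5]

lemma sum_zmod_range (k : ℕ) (hk : 0 < k) (f : ZMod k → ZMod 2) [Fintype (ZMod k)] :
    ∑ i ∈ Finset.range k, f (i : ZMod k) = ∑ i, f i := by
  have : NeZero k := ⟨by omega⟩
  refine Finset.sum_bij (fun i _ => (i : ZMod k)) (by simp) ?_ ?_ (fun _ _ => rfl)
  · intro a ha b hb h
    have := congrArg ZMod.val h
    rwa [ZMod.val_natCast_of_lt (Finset.mem_range.1 ha),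
      ZMod.val_natCast_of_lt (Finset.mem_range.1 hb)] at this
  · intro b _
    exact ⟨b.val, Finset.mem_range.2 (ZMod.val_lt b), ZMod.natCast_zmod_val b⟩

/-- sums over a cycle supported on three consecutive places -/
lemma sum_three {k : ℕ} (hk : 4 ≤ k) [Fintype (ZMod k)] (l : ZMod k) (f : ZMod k → ZMod 2)
    (hf : ∀ i, i ≠ l → i ≠ l + 1 → i ≠ l - 1 → f i = 0) :
    ∑ i, f i = f (l - 1) + f l + f (l + 1) := by
  have e1 := zmod_ne (k := k) 1 (by omega) (by omega)
  have e2 := zmod_ne (k := k) 2 (by omega) (by omega)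
  push_cast at e1 e2
  classical
  have h : ∑ i, f i = ∑ i ∈ ({l - 1, l, l + 1} : Finset (ZMod k)), f i := by
    symm
    apply Finset.sum_subset (Finset.subset_univ _)
    intro i _ hi
    simp only [Finset.mem_insert, Finset.mem_singleton, not_or] at hi
    exact hf i hi.2.1 hi.2.2 hi.1
  rw [h, Finset.sum_insert, Finset.sum_insert, Finset.sum_singleton, add_assoc]
  · simp only [Finset.mem_singleton]
    intro h; apply e1; linear_combination -h
  · simp only [Finset.mem_insert, Finset.mem_singleton, not_or]
    exact ⟨fun h => e1 (by linear_combination -h), fun h => e2 (by linear_combination -h)⟩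

namespace Quad

variable {D : Type*} {q : Quad D}
variable {I : (D → ZMod 2) →ₗ[ZMod 2] (D → ZMod 2) →ₗ[ZMod 2] ZMod 2}

/-- vanishing along a normalised induced cycle -/
lemma Good.cyc0 (h : q.Good I) (hK : q.HK) {k : ℕ} (hk : 4 ≤ k) [Fintype (ZMod k)]
    (c : ZMod k → q.V) (hc : Function.Injective c) (X : ZMod k → D → ZMod 2)
    (hX : ∀ i, q.Arc (c i) (X i))
    (hz : ∀ i j, j ≠ i → j ≠ i + 1 → j ≠ i - 1 → ∀ d, q.vx d = c j → X i d = 0)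
    (hl1 : ∀ i d, q.vx d = c (i + 1) → X i (q.τ d) = X i d + 1)
    (hl2 : ∀ i d, q.vx d = c (i - 1) → X i (q.τ d) = X i d + 1) :
    ∑ i, I (X i) (X (i + 1)) = 0 := by
  have e1 := zmod_ne (k := k) 1 (by omega) (by omega)
  have e2 := zmod_ne (k := k) 2 (by omega) (by omega)
  have e3 := zmod_ne (k := k) 3 (by omega) (by omega)
  push_cast at e1 e2 e3
  have hopp : ∀ l d, q.vx d = c l → X (l + 1) d = X (l - 1) d + 1 := by
    intro l d hd
    have := hK (fun d => X (l - 1) d * X (l + 1) d) (fun d => by rw [(hX _).1, (hX _).1])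
      (fun d => by
        by_cases h1 : q.vx d = c (l - 1)
        · have hh := hz (l + 1) (l - 1) (fun h => e2 (by linear_combination -h))
            (fun h => e3 (by linear_combination -h)) (fun h => e1 (by linear_combination -h))
          rw [hh d h1, hh (q.σ d) (by rwa [vx_σ]), mul_zero, mul_zero]
        · by_cases h2 : q.vx d = c (l + 1)
          · have hh := hz (l - 1) (l + 1) (fun h => e2 (by linear_combination h))
              (fun h => e1 (by linear_combination h)) (fun h => e3 (by linear_combination h))
            rw [hh d h2, hh (q.σ d) (by rwa [vx_σ]), zero_mul, zero_mul]
          · rw [(hX _).2.2 d h1, (hX _).2.2 d h2]) d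
    rw [hl1 (l - 1) d (by rw [sub_add_cancel, hd]), hl2 (l + 1) d (by rw [add_sub_cancel_right, hd])]
      at this
    have hh : ∀ a b : ZMod 2, (a + 1) * (b + 1) = a * b → b = a + 1 := by decide
    exact hh _ _ this
  obtain ⟨s, t, hst⟩ := colours k hk
  have hA : ∀ s : ZMod k → ZMod 2, q.IsZ (∑ i, s i • X i) := fun s =>
    IsZ.sum _ _ fun i => (hX i).isZ.smul _
  have hval : ∀ (s : ZMod k → ZMod 2) l d, q.vx d = c l → (∑ i, s i • X i) d =
      s (l - 1) * X (l - 1) d + s l * X l d + s (l + 1) * X (l + 1) d := by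
    intro s l d hd
    rw [Finset.sum_apply]
    simp only [Pi.smul_apply, smul_eq_mul]
    rw [sum_three hk l]
    intro i h1 h2 h3
    rw [hz i l h1.symm (fun h => h3 (by rw [h]; ring)) (fun h => h2 (by rw [h]; ring)) d hd,
      mul_zero]
  have hI := h.fl hK (hA s) (hA t) (fun d h1 h2 => by
    by_cases hd : ∃ l, q.vx d = c l
    · exfalso
      obtain ⟨l, hl⟩ := hd
      rw [hval s l d hl, hopp l d hl] at h1
      rw [hval t l d hl, hopp l d hl] at h2
      have g1 := hst l
      have g2 := hst (l - 1)
      rw [sub_add_cancel] at g2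
      have : ∀ s0 t0 s1 t1 s2 t2 a b : ZMod 2, s1 * t2 + s2 * t1 = 1 → s0 * t1 + s1 * t0 = 1 →
        s0 * a + s1 * b + s2 * (a + 1) = 0 → t0 * a + t1 * b + t2 * (a + 1) = 0 → False := by decide
      exact this _ _ _ _ _ _ _ _ g1 g2 h1 h2
    · have : ∀ s : ZMod k → ZMod 2, (∑ i, s i • X i) (q.σ d) = (∑ i, s i • X i) d := by
        intro s
        simp only [Finset.sum_apply, Pi.smul_apply]
        refine Finset.sum_congr rfl fun i _ => ?_
        rw [(hX i).2.2 d (fun h => hd ⟨i, h⟩)]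
      rw [this, this]; exact ⟨h1, h2⟩)
  have hexp : I (∑ i, s i • X i) (∑ j, t j • X j) =
      ∑ i, (s i * t (i - 1) * I (X i) (X (i - 1)) + s i * t (i + 1) * I (X i) (X (i + 1))) := by
    rw [map_sum I, LinearMap.sum_apply]
    refine Finset.sum_congr rfl fun i _ => ?_
    rw [map_sum, sum_three hk i]
    · simp only [map_smul, LinearMap.smul_apply, smul_eq_mul, h.alt _ (hX i).isZ]
      ring
    · intro j h1 h2 h3
      rw [map_smul, map_smul, LinearMap.smul_apply, h.unlinked hK (hX i) (hX j) (hz i j h1 h2 h3)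
        (hz j i h1.symm (fun h => h3 (by rw [h]; ring)) (fun h => h2 (by rw [h]; ring)))]
      simp
  rw [hexp, Finset.sum_add_distrib, ← Equiv.sum_comp (Equiv.addRight (1 : ZMod k)),
    ← Finset.sum_add_distrib] at hI
  rw [← hI]
  refine Finset.sum_congr rfl fun i _ => ?_
  simp only [Equiv.coe_addRight, add_sub_cancel_right]
  rw [h.symm (hX (i + 1)).isZ (hX i).isZ]
  linear_combination -(I (X i) (X (i + 1))) * hst i

/-- linkedness of two vertices with respect to a choice of arcs -/
def Lk (C : q.V → D → ZMod 2) (v w : q.V) : Prop :=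
  v ≠ w ∧ ∀ d, q.vx d = v → C w (q.τ d) = C w d + 1

lemma Good.cyc1 (h : q.Good I) (hK : q.HK) (C : q.V → D → ZMod 2) (hC : ∀ v, q.Arc v (C v))
    [Fintype D] {k : ℕ} (hk : 4 ≤ k) [Fintype (ZMod k)]
    (c : ZMod k → q.V) (hc : Function.Injective c)
    (hl : ∀ i, Lk C (c i) (c (i + 1)))
    (hnl : ∀ i j, Lk C (c i) (c j) → j = i + 1 ∨ i = j + 1) :
    ∑ i, I (C (c i)) (C (c (i + 1))) = 0 := by
  have : NeZero k := ⟨by omega⟩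
  have hls : ∀ v w, Lk C v w → Lk C w v := fun v w hvw =>
    ⟨hvw.1.symm, lk_symm (hC v) (hC w) hvw.1 hvw.2⟩
  -- constants on the far vertices
  have hconst : ∀ i j, j ≠ i → j ≠ i + 1 → j ≠ i - 1 →
      ∃ a, ∀ d, q.vx d = c j → C (c i) d = a := by
    intro i j h1 h2 h3
    rcases (hC (c i)).dich (v := c j) (fun h => h1 (hc h)) with h4 | h4
    · exfalso
      rcases hnl j i ⟨fun h => h1 (hc h), h4⟩ with h5 | h5
      · exact h3 (by rw [h5]; ring)
      · exact h2 h5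
    · exact h4
  have far : ∀ (i : ZMod k) (n : ℕ), n ≤ k - 4 → i + 2 + n ≠ i ∧ i + 2 + n ≠ i + 1 ∧
      i + 2 + n ≠ i - 1 := by
    intro i n hn
    have e1 := zmod_ne (k := k) (n + 1) (by omega) (by omega)
    have e2 := zmod_ne (k := k) (n + 2) (by omega) (by omega)
    have e3 := zmod_ne (k := k) (n + 3) (by omega) (by omega)
    push_cast at e1 e2 e3
    exact ⟨fun h => e2 (by linear_combination h), fun h => e1 (by linear_combination h),
      fun h => e3 (by linear_combination h)⟩
  have hn : ∀ i, ∃ a, ∀ n : ℕ, n ≤ k - 4 → ∀ d, q.vx d = c (i + 2 + n) → C (c i) d = a := by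
    intro i
    have h0 := far i 0 (by omega)
    obtain ⟨a, ha⟩ := hconst i _ h0.1 h0.2.1 h0.2.2
    refine ⟨a, fun n => ?_⟩
    induction n with
    | zero => intro _; exact ha
    | succ n ih =>
      intro hn
      have ih := ih (by omega)
      have f1 := far i n (by omega)
      have f2 := far i (n + 1) (by omega)
      obtain ⟨a', ha'⟩ := hconst i _ f2.1 f2.2.1 f2.2.2
      obtain ⟨b, hb⟩ := hconst (i + 2 + n) i f1.1.symm
        (fun h => f1.2.2 (by linear_combination -h)) (fun h => f1.2.1 (by linear_combination -h))
      have hL := hls _ _ (hl (i + 2 + n))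
      have e : i + 2 + (n : ZMod k) + 1 = i + 2 + ((n + 1 : ℕ) : ZMod k) := by push_cast; ring
      rw [e] at hL
      have := Good.side hK (hC (c i)) (hC (c (i + 2 + n))) (fun h => f2.1 (hc h)) hL.1
        ih ha' hb hL.2
      rw [← this]; exact ha'
  choose a ha using hn
  have hfar : ∀ i j, j ≠ i → j ≠ i + 1 → j ≠ i - 1 → ∀ d, q.vx d = c j → C (c i) d = a i := by
    intro i j h1 h2 h3
    have e : j = i + 2 + ((j - i - 2).val : ZMod k) := by rw [ZMod.natCast_zmod_val]; ring
    have hlt := ZMod.val_lt (j - i - 2)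
    have : (j - i - 2).val ≤ k - 4 := by
      by_contra hcon
      have hkk : ((k : ℕ) : ZMod k) = 0 := ZMod.natCast_self k
      have : (j - i - 2).val + 3 = k ∨ (j - i - 2).val + 2 = k ∨ (j - i - 2).val + 1 = k := by
        omega
      rcases this with h | h | h <;> have h' := congrArg (Nat.cast : ℕ → ZMod k) h <;>
        push_cast at h' <;> rw [ZMod.natCast_zmod_val, hkk] at h'
      · exact h3 (by linear_combination h')
      · exact h1 (by linear_combination h')
      · exact h2 (by linear_combination h')
    rw [e]
    exact ha i _ this
  have := h.cyc0 hK hk c hc (fun i => C (c i) + fun _ => a i) (fun i => (hC _).addc _)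
    (fun i j h1 h2 h3 d hd => by
      simp only [Pi.add_apply]; rw [hfar i j h1 h2 h3 d hd]; exact CharTwo.add_self_eq_zero _)
    (fun i d hd => by
      simp only [Pi.add_apply]; rw [(hls _ _ (hl i)).2 d hd]; ring)
    (fun i d hd => by
      simp only [Pi.add_apply]
      have := (hl (i - 1)).2 d hd
      rw [sub_add_cancel] at this
      rw [this]; ring)
  rw [← this]
  exact Finset.sum_congr rfl fun i _ => (h.addc (hC _).isZ (hC _).isZ _ _).symm

lemma Z_induct [Fintype D] (hK : q.HK) (C : q.V → D → ZMod 2) (hC : ∀ v, q.Arc v (C v))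
    (P : (D → ZMod 2) → Prop) (hinv : ∀ κ, q.Inv κ → P κ)
    (hadd : ∀ v A, q.IsZ A → P A → P (A + C v)) : ∀ A, q.IsZ A → P A := by
  classical
  suffices H : ∀ n A, q.IsZ A → (Finset.univ.filter fun d => A (q.σ d) ≠ A d).card = n → P A from
    fun A hA => H _ A hA rfl
  intro n
  induction n using Nat.strong_induction_on with
  | _ n ih =>
  intro A hA hn
  by_cases h0 : ∀ d, A (q.σ d) = A d
  · exact hinv A ⟨hA.1, h0, hK A hA.1 h0⟩
  · push Not at h0
    obtain ⟨d, hd⟩ := h0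
    have hA' := hA.add (hC (q.vx d)).isZ
    have hv : ∀ e, q.vx e = q.vx d → A (q.σ e) = A e + 1 := by
      have h4 := hA.2 d
      intro e he
      rcases vx_eq.1 he.symm with rfl | rfl | rfl | rfl
      · have : ∀ a b : ZMod 2, a ≠ b → a = b + 1 := by decide
        exact this _ _ hd
      · rw [q.σσ]
        have : ∀ a b : ZMod 2, a ≠ b → b = a + 1 := by decide
        exact this _ _ hd
      · have : ∀ a b c e : ZMod 2, a ≠ b → b + a + c + e = 0 → e = c + 1 := by decide
        exact this _ _ _ _ hd h4
      · rw [q.σσ]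
        have : ∀ a b c e : ZMod 2, a ≠ b → b + a + c + e = 0 → c = e + 1 := by decide
        exact this _ _ _ _ hd h4
    have hP := ih _ (by
      rw [← hn]
      apply Finset.card_lt_card
      rw [Finset.ssubset_iff_of_subset]
      · refine ⟨d, by simpa using hd, ?_⟩
        simp only [Finset.mem_filter, Finset.mem_univ, true_and, Pi.add_apply, not_not]
        rw [hv d rfl, (hC _).2.1 d rfl]
        have : ∀ a b : ZMod 2, a + 1 + (b + 1) = a + b := by decide
        exact this _ _
      · intro e
        simp only [Finset.mem_filter, Finset.mem_univ, true_and, Pi.add_apply]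
        intro he heq
        by_cases hed : q.vx e = q.vx d
        · rw [hv e hed] at heq
          have : ∀ a : ZMod 2, a + 1 ≠ a := by decide
          exact this _ heq
        · apply he
          rw [heq, (hC _).2.2 e hed]) (A + C (q.vx d)) hA' rfl
    have := hadd (q.vx d) _ hA' hP
    have e : A + C (q.vx d) + C (q.vx d) = A := by
      ext e; simp only [Pi.add_apply]; rw [add_assoc, CharTwo.add_self_eq_zero, add_zero]
    rwa [e] at this

theorem quadHK [Fintype D] (h : q.Good I) (hK : q.HK) : ∃ x : D → ZMod 2,
    (∀ d, x (q.σ d) = x d) ∧ (∀ d, x (q.τ d) = x d) ∧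
    ∀ A B, q.IsZ A → q.IsZ B → I A B = ∑ d, x d * A d * B d := by
  classical
  choose C hC using fun v => exists_arc hK v
  have hls : ∀ v w, Lk C v w → Lk C w v := fun v w hvw =>
    ⟨hvw.1.symm, lk_symm (hC v) (hC w) hvw.1 hvw.2⟩
  obtain ⟨x, hx⟩ := coboundary (Adj := Lk C) (w := fun v w => I (C v) (C w)) hls
    (fun u hu => hu.1 rfl) (fun u v => h.symm (hC u).isZ (hC v).isZ)
    (fun a b c hab hbc hca => h.tri hK (hC a) (hC b) (hC c) hab.1 hca.1.symm hbc.1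
      (hls _ _ hab).2 hca.2 hab.2 (hls _ _ hbc).2 (hls _ _ hca).2 hbc.2)
    (fun k hk c hc h1 h2 s hs => by
      have : NeZero k := ⟨by omega⟩
      rw [hs, sum_zmod_range k (by omega) (fun i => I (C (c i)) (C (c (i + 1))))]
      exact h.cyc1 hK C hC hk c hc h1 h2)
  have hxσ : ∀ d, x (q.vx (q.σ d)) = x (q.vx d) := fun d => by rw [vx_σ]
  have hxτ : ∀ d, x (q.vx (q.τ d)) = x (q.vx d) := fun d => by rw [vx_τ]
  refine ⟨fun d => x (q.vx d), hxσ, hxτ, ?_⟩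
  have hinv : ∀ κ B, q.Inv κ → q.IsZ B → ∑ d, x (q.vx d) * κ d * B d = 0 := by
    intro κ B hκ hB
    exact sum_inv_mul (x := fun d => x (q.vx d) * κ d) (fun d => by rw [hxσ, hκ.2.1])
      (fun d => by rw [hxτ, hκ.2.2]) hB
  have hadd : ∀ A A' B : D → ZMod 2, I A B = ∑ d, x (q.vx d) * A d * B d →
      I A' B = ∑ d, x (q.vx d) * A' d * B d →
      I (A + A') B = ∑ d, x (q.vx d) * (A + A') d * B d := by
    intro A A' B h1 h2
    rw [map_add, LinearMap.add_apply, h1, h2, ← Finset.sum_add_distrib]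
    refine Finset.sum_congr rfl fun d _ => ?_
    simp only [Pi.add_apply]; ring
  have hsw : ∀ A B : D → ZMod 2, q.IsZ A → q.IsZ B → I A B = ∑ d, x (q.vx d) * A d * B d →
      I B A = ∑ d, x (q.vx d) * B d * A d := by
    intro A B hA hB h1
    rw [← h.symm hA hB, h1]
    exact Finset.sum_congr rfl fun d _ => by ring
  have hCC : ∀ v w, I (C v) (C w) = ∑ d, x (q.vx d) * C v d * C w d := by
    intro v w
    by_cases hvw : v = w
    · subst hvw
      rw [h.alt _ (hC v).isZ]
      symm
      rw [← sum_inv_mul (x := fun d => x (q.vx d)) hxσ hxτ (hC v).isZ]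
      refine Finset.sum_congr rfl fun d _ => ?_
      have : ∀ a b : ZMod 2, a * b * b = a * b := by decide
      exact this _ _
    · obtain ⟨d, hd⟩ := vx_surj v
      obtain ⟨e, he⟩ := vx_surj w
      rw [key_sum (x := fun d => x (q.vx d)) (hC v) (hC w) hvw hxσ hxτ d e hd he]
      rcases (hC w).dich hvw with h1 | ⟨c, hc⟩
      · have h2 := hx v w ⟨hvw, h1⟩
        have h3 := (hls v w ⟨hvw, h1⟩).2 e he
        rw [h2, h1 d hd, h3, hd, he]
        have : ∀ a b c e : ZMod 2, a + b = a * (c + (c + 1)) + b * (e + (e + 1)) := by decide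
        exact this _ _ _ _
      · rcases (hC v).dich (Ne.symm hvw) with h1 | ⟨a, ha⟩
        · exfalso
          have := lk_symm (hC w) (hC v) (Ne.symm hvw) h1 d hd
          rw [hc d hd, hc _ ((vx_τ d).trans hd)] at this
          revert this
          have : ∀ a : ZMod 2, a ≠ a + 1 := by decide
          exact this _
        · rw [h.unlinked hK (hC v) (hC w) ha hc, hc d hd, hc _ ((vx_τ d).trans hd),
            ha e he, ha _ ((vx_τ e).trans he), CharTwo.add_self_eq_zero, CharTwo.add_self_eq_zero]
          ring
  intro A B hA hB
  revert A B
  suffices H : ∀ A, q.IsZ A → ∀ B, q.IsZ B → I A B = ∑ d, x (q.vx d) * A d * B d from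
    fun A B hA hB => H A hA B hB
  refine Z_induct hK C hC _ (fun κ hκ B hB => ?_) (fun v A hA hPA B hB => ?_)
  · rw [h.inv hκ hB, hinv κ B hκ hB]
  · refine hadd _ _ _ (hPA B hB) ?_
    revert B
    refine Z_induct hK C hC _ (fun κ hκ => ?_) (fun w B hB hPB => ?_)
    · exact hsw _ _ hκ.isZ (hC v).isZ (by rw [h.inv hκ (hC v).isZ, hinv κ _ hκ (hC v).isZ])
    · exact hsw _ _ (hB.add (hC w).isZ) (hC v).isZ (hadd _ _ _ (hsw _ _ (hC v).isZ hB hPB)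
        (hCC w v))

end Quad

end VO


namespace VO

namespace Quad

variable {D : Type*} {q : Quad D}
variable {I : (D → ZMod 2) →ₗ[ZMod 2] (D → ZMod 2) →ₗ[ZMod 2] ZMod 2}

/-- swap the two smoothings at some vertices -/
def sw (q : Quad D) (y : D → Prop) [DecidablePred y] (hσ : ∀ d, y (q.σ d) ↔ y d)
    (hτ : ∀ d, y (q.τ d) ↔ y d) : Quad D where
  ι := q.ι
  σ d := if y d then q.τ d else q.σ d
  τ d := if y d then q.σ d else q.τ d
  ιι := q.ιι
  ιn := q.ιn
  σσ d := by by_cases h : y d <;> simp [h, hσ, hτ, q.σσ, q.ττ]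
  σn d := by by_cases h : y d <;> simp [h, q.σn, q.τn]
  ττ d := by by_cases h : y d <;> simp [h, hσ, hτ, q.σσ, q.ττ]
  τn d := by by_cases h : y d <;> simp [h, q.σn, q.τn]
  στ d := by by_cases h : y d <;> simp [h, hσ, hτ, q.στ]
  στn d := by
    by_cases h : y d
    · simp only [h, hσ, if_true]; rw [← q.στ]; exact q.στn d
    · simp only [h, hτ, if_false]; exact q.στn d

/-- same graph, possibly with different smoothings -/
def Rel (q q' : Quad D) : Prop := (∀ d, q'.ι d = q.ι d) ∧
  ∀ d, (q'.σ d = q.σ d ∧ q'.τ d = q.τ d) ∨ (q'.σ d = q.τ d ∧ q'.τ d = q.σ d)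

lemma Rel.isZ {q q' : Quad D} (h : Rel q q') (A : D → ZMod 2) : q'.IsZ A ↔ q.IsZ A := by
  have key : ∀ d, A d + A (q'.σ d) + A (q'.τ d) + A (q'.σ (q'.τ d)) =
      A d + A (q.σ d) + A (q.τ d) + A (q.σ (q.τ d)) := by
    intro d
    have h3 : q'.σ (q'.τ d) = q.σ (q.τ d) := by
      have hn := q'.στn d
      rcases h.2 d with ⟨h1, h2⟩ | ⟨h1, h2⟩
      · rw [h2] at hn ⊢
        rcases h.2 (q.τ d) with ⟨h3, h4⟩ | ⟨h3, h4⟩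
        · exact h3
        · rw [h3, q.ττ] at hn; exact absurd rfl hn
      · rw [h2] at hn ⊢
        rcases h.2 (q.σ d) with ⟨h3, h4⟩ | ⟨h3, h4⟩
        · rw [h3, q.σσ] at hn; exact absurd rfl hn
        · rw [h3, q.στ]
    rw [h3]
    rcases h.2 d with ⟨h1, h2⟩ | ⟨h1, h2⟩
    · rw [h1, h2]
    · rw [h1, h2]; ring
  unfold IsZ
  simp only [h.1, key]

lemma Rel.trans {q q' q'' : Quad D} (h : Rel q q') (h' : Rel q' q'') : Rel q q'' := by
  refine ⟨fun d => by rw [h'.1, h.1], fun d => ?_⟩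
  rcases h.2 d with ⟨h1, h2⟩ | ⟨h1, h2⟩ <;> rcases h'.2 d with ⟨h3, h4⟩ | ⟨h3, h4⟩ <;>
    rw [h3, h4, h1, h2] <;> simp

lemma exists_HK [Fintype D] (q : Quad D) : ∃ q', Rel q q' ∧ q'.HK := by
  classical
  suffices H : ∀ n (q : Quad D), (Finset.univ.filter fun A : D → ZMod 2 =>
      (∀ d, A (q.ι d) = A d) ∧ ∀ d, A (q.σ d) = A d).card = n → ∃ q', Rel q q' ∧ q'.HK from
    H _ q rfl
  intro n
  induction n using Nat.strong_induction_on with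
  | _ n ih =>
  intro q hn
  by_cases hK : q.HK
  · exact ⟨q, ⟨fun _ => rfl, fun _ => Or.inl ⟨rfl, rfl⟩⟩, hK⟩
  unfold HK at hK
  push Not at hK
  obtain ⟨A, hι, hσ, d, hd⟩ := hK
  let q1 := q.sw (fun e => q.vx e = q.vx d) (fun e => by rw [vx_σ]) (fun e => by rw [vx_τ])
  have hR : Rel q q1 := by
    refine ⟨fun _ => rfl, fun e => ?_⟩
    by_cases h : q.vx e = q.vx d
    · right; simp [q1, sw, h]
    · left; simp [q1, sw, h]
  obtain ⟨q2, h1, h2⟩ := ih _ (by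
    rw [← hn]
    apply Finset.card_lt_card
    rw [Finset.ssubset_iff_of_subset]
    · refine ⟨A, by simp [hι, hσ], ?_⟩
      simp only [Finset.mem_filter, Finset.mem_univ, true_and, not_and, not_forall]
      intro _
      refine ⟨d, ?_⟩
      simpa [q1, sw] using hd
    · intro B
      simp only [Finset.mem_filter, Finset.mem_univ, true_and]
      rintro ⟨hB1, hB2⟩
      have hB1 : ∀ e, B (q.ι e) = B e := hB1
      refine ⟨hB1, ?_⟩
      have hBv : ∀ e, q.vx e = q.vx d → B (q.τ e) = B e := fun e he => by
        have := hB2 e; simpa [q1, sw, he] using this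
      have hBn : ∀ e, q.vx e ≠ q.vx d → B (q.σ e) = B e := fun e he => by
        have := hB2 e; simpa [q1, sw, he] using this
      have hsum : ∑ e, A e * B e = 0 := sum_invol q.ι q.ιι q.ιn _ (fun e => by
        rw [hι, hB1]; exact CharTwo.add_self_eq_zero _)
      have : Fintype q.V := Fintype.ofFinite _
      rw [← Finset.sum_fiberwise (s := Finset.univ) (g := fun f => q.vx f),
        Finset.sum_eq_single (q.vx d)] at hsum
      · rw [fiber_sum, q.στ, hBv d rfl, hBv (q.σ d) (vx_σ d), ← q.στ, hσ, hσ] at hsum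
        have h3 : ∀ a a' b b' : ZMod 2, a' ≠ a → a * b + a * b' + a' * b + a' * b' = 0 →
          b' = b := by decide
        have h4 := h3 _ _ _ _ hd hsum
        intro e
        by_cases he : q.vx e = q.vx d
        · rcases vx_eq.1 he.symm with rfl | rfl | rfl | rfl
          · exact h4
          · rw [q.σσ]; exact h4.symm
          · rw [q.στ, hBv d rfl, hBv (q.σ d) (vx_σ d), h4]
          · rw [q.σσ, q.στ, hBv d rfl, hBv (q.σ d) (vx_σ d), h4]
        · exact hBn e he
      · intro u _ hu
        obtain ⟨f, rfl⟩ := vx_surj u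
        rw [fiber_sum, hσ, hσ, hBn f hu, hBn (q.τ f) (by rwa [vx_τ])]
        have h3 : ∀ a b : ZMod 2, a + a + b + b = 0 := by decide
        exact h3 _ _
      · simp) q1 rfl
  exact ⟨q2, hR.trans h1, h2⟩

theorem quad [Fintype D] (h : q.Good I) : ∃ x : D → ZMod 2,
    (∀ d, x (q.σ d) = x d) ∧ (∀ d, x (q.τ d) = x d) ∧
    ∀ A B, q.IsZ A → q.IsZ B → I A B = ∑ d, x d * A d * B d := by
  obtain ⟨q', hR, hK⟩ := exists_HK q
  have hG : q'.Good I := ⟨fun A hA => h.alt A ((hR.isZ A).1 hA),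
    fun A B hA hB => h.disj A B ((hR.isZ A).1 hA) ((hR.isZ B).1 hB)⟩
  obtain ⟨x, h1, h2, h3⟩ := quadHK hG hK
  refine ⟨x, fun d => ?_, fun d => ?_, fun A B hA hB =>
    h3 A B ((hR.isZ A).2 hA) ((hR.isZ B).2 hB)⟩
  · rcases hR.2 d with ⟨h4, h5⟩ | ⟨h4, h5⟩
    · rw [← h4, h1]
    · rw [← h5, h2]
  · rcases hR.2 d with ⟨h4, h5⟩ | ⟨h4, h5⟩
    · rw [← h5, h2]
    · rw [← h4, h1]

end Quad

end VO


set_option linter.unusedSectionVars false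
set_option linter.unusedSimpArgs false

namespace VO

section lin

variable {D : Type*} [Fintype D] [DecidableEq D]

/-- orthogonality to the functions constant on vertices -/
def Ev (r : Equiv.Perm D) (A : D → ZMod 2) : Prop :=
  ∀ B : D → ZMod 2, (∀ d, B (r d) = B d) → ∑ d, A d * B d = 0

/-- even subgraphs -/
def Zc (ι r : Equiv.Perm D) (A : D → ZMod 2) : Prop := (∀ d, A (ι d) = A d) ∧ Ev r A

variable {ι r : Equiv.Perm D}

lemma Ev.add {A B : D → ZMod 2} (hA : Ev r A) (hB : Ev r B) : Ev r (A + B) := by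
  intro C hC
  simp only [Pi.add_apply, add_mul, Finset.sum_add_distrib, hA C hC, hB C hC, add_zero]

lemma Zc.add {A B : D → ZMod 2} (hA : Zc ι r A) (hB : Zc ι r B) : Zc ι r (A + B) :=
  ⟨fun d => by simp only [Pi.add_apply, hA.1, hB.1], hA.2.add hB.2⟩

lemma ev_zero : Ev r (0 : D → ZMod 2) := fun B _ => by simp

lemma zc_zero : Zc ι r (0 : D → ZMod 2) := ⟨fun _ => rfl, ev_zero⟩

lemma perm_inv_self (r : Equiv.Perm D) (d : D) : r (r⁻¹ d) = d := r.apply_symm_apply d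

lemma perm_self_inv (r : Equiv.Perm D) (d : D) : r⁻¹ (r d) = d := r.symm_apply_apply d

lemma inv_symm {B : D → ZMod 2} (hB : ∀ d, B (r d) = B d) (d : D) : B (r⁻¹ d) = B d := by
  have := hB (r⁻¹ d)
  rw [← this, perm_inv_self]

lemma inv_sameCycle {T : Type*} {B : D → T} (hB : ∀ d, B (r d) = B d) {d e : D}
    (h : r.SameCycle d e) : B e = B d := by
  obtain ⟨n, -, rfl⟩ := h.exists_pow_eq'
  clear h
  induction n with
  | zero => rfl
  | succ n ih => rw [pow_succ', Equiv.Perm.mul_apply, hB, ih]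

lemma ev_sum_vertex {A : D → ZMod 2} (hA : Ev r A) (d : D) [DecidablePred (r.SameCycle d)] :
    ∑ e ∈ Finset.univ.filter (r.SameCycle d), A e = 0 := by
  have := hA (fun e => if r.SameCycle d e then 1 else 0) (fun e => by
    simp only [Equiv.Perm.sameCycle_apply_right])
  simpa [Finset.sum_filter] using this

lemma ev_of_vertex [DecidableRel r.SameCycle] {A : D → ZMod 2}
    (h : ∀ d, ∑ e ∈ Finset.univ.filter (r.SameCycle d), A e = 0) : Ev r A := by
  classical
  intro B hB
  let Q := Quotient (Equiv.Perm.SameCycle.setoid r)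
  have : Fintype Q := Fintype.ofFinite _
  rw [← Finset.sum_fiberwise (s := Finset.univ)
    (g := fun d => (Quotient.mk (Equiv.Perm.SameCycle.setoid r) d : Q))]
  refine Finset.sum_eq_zero fun u _ => ?_
  obtain ⟨d, rfl⟩ := Quotient.exists_rep u
  have e1 : (Finset.univ.filter fun e => (Quotient.mk (Equiv.Perm.SameCycle.setoid r) e : Q) =
      Quotient.mk _ d) = Finset.univ.filter (r.SameCycle d) := by
    ext e
    simp only [Finset.mem_filter, Finset.mem_univ, true_and]
    rw [eq_comm]
    exact Quotient.eq
  rw [e1]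
  calc _ = ∑ e ∈ Finset.univ.filter (r.SameCycle d), A e * B d := by
        refine Finset.sum_congr rfl fun e he => ?_
        rw [inv_sameCycle hB (Finset.mem_filter.1 he).2]
    _ = 0 := by rw [← Finset.sum_mul, h, zero_mul]

lemma exists_S (r : Equiv.Perm D) : ∃ S : (D → ZMod 2) →ₗ[ZMod 2] (D → ZMod 2),
    ∀ A, Ev r A → ∀ d, S A (r d) = S A d + A d := by
  let T : (D → ZMod 2) →ₗ[ZMod 2] (D → ZMod 2) := LinearMap.funLeft (ZMod 2) (ZMod 2) r + LinearMap.id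
  have hT : ∀ f d, T f d = f (r d) + f d := fun f d => rfl
  have hrange : ∀ A, Ev r A → A ∈ LinearMap.range T := by
    intro A hA
    apply mem_of_dual
    intro B hB
    have hBr : ∀ d, B (r d) = B d := by
      intro d
      have := hB (T (Pi.single (r d) 1)) ⟨_, rfl⟩
      simp only [hT, mul_add, Finset.sum_add_distrib] at this
      have e1 : ∑ x, B x * (Pi.single (r d) (1 : ZMod 2) : D → ZMod 2) (r x) = B d := by
        rw [Finset.sum_eq_single d]
        · simp
        · intro b _ hb
          rw [Pi.single_eq_of_ne (fun h => hb (r.injective h)), mul_zero]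
        · simp
      have e2 : ∑ x, B x * (Pi.single (r d) (1 : ZMod 2) : D → ZMod 2) x = B (r d) := by
        rw [Finset.sum_eq_single (r d)]
        · simp
        · intro b _ hb
          rw [Pi.single_eq_of_ne hb, mul_zero]
        · simp
      rw [e1, e2] at this
      have h2 : ∀ a b : ZMod 2, a + b = 0 → b = a := by decide
      exact h2 _ _ this
    rw [← hA B hBr]
    exact Finset.sum_congr rfl fun d _ => mul_comm _ _
  obtain ⟨g, hg⟩ := T.rangeRestrict.exists_rightInverse_of_surjective T.range_rangeRestrict
  obtain ⟨S, hS⟩ := LinearMap.exists_extend g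
  refine ⟨S, fun A hA d => ?_⟩
  have h1 : S A = g ⟨A, hrange A hA⟩ := by
    have := LinearMap.congr_fun hS ⟨A, hrange A hA⟩
    exact this
  have h2 : T (S A) = A := by
    rw [h1]
    have := LinearMap.congr_fun hg ⟨A, hrange A hA⟩
    exact congrArg Subtype.val this
  have h3 := congrFun h2 d
  rw [hT] at h3
  have h4 : ∀ a b c : ZMod 2, a + b = c → a = b + c := by decide
  exact h4 _ _ _ h3

lemma exists_o (ι : Equiv.Perm D) (hι : ∀ d, ι (ι d) = d) (hn : ∀ d, ι d ≠ d) :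
    ∃ o : D → ZMod 2, ∀ d, o (ι d) = o d + 1 := by
  let e := Fintype.equivFin D
  refine ⟨fun d => if e d < e (ι d) then 1 else 0, fun d => ?_⟩
  have : e d ≠ e (ι d) := fun h => hn d (e.injective h).symm
  simp only [hι]
  rcases lt_or_gt_of_ne this with h | h
  · rw [if_neg (not_lt.2 h.le), if_pos h]; decide
  · rw [if_pos h, if_neg (not_lt.2 h.le)]; decide

/-- the local alternating form -/
lemma I0_alt {A s o : D → ZMod 2} (hAι : ∀ d, A (ι d) = A d) (ho : ∀ d, o (ι d) = o d + 1)
    (hs : ∀ d, s (r d) = s d + A d) : ∑ d, A d * (s d + o d * A d) = 0 := by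
  have h1 : ∑ d, ((A d).val : ℤ) = 2 * ∑ d, ((A d * s d).val : ℤ) := by
    have e := Equiv.sum_comp r (fun d => ((s d).val : ℤ))
    have : ∀ a s : ZMod 2, ((s + a).val : ℤ) = s.val + a.val - 2 * ((a * s).val : ℤ) := by decide
    simp only [hs, this, Finset.sum_sub_distrib, Finset.sum_add_distrib, ← Finset.mul_sum] at e
    linarith
  have h2 : ∑ d, ((A d).val : ℤ) = 2 * ∑ d, ((A d * o d).val : ℤ) := by
    have e := Equiv.sum_comp ι (fun d => ((A d * o d).val : ℤ))
    have : ∀ a o : ZMod 2, ((a * (o + 1)).val : ℤ) = a.val - ((a * o).val : ℤ) := by decide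
    simp only [ho, hAι, this, Finset.sum_sub_distrib] at e
    linarith
  have h3 : ∑ d, ((A d * s d).val : ℤ) = ∑ d, ((A d * o d).val : ℤ) := by linarith
  have h4 := congrArg (Int.cast : ℤ → ZMod 2) h3
  push_cast at h4
  simp only [ZMod.natCast_zmod_val] at h4
  have : ∀ d, A d * (s d + o d * A d) = A d * s d + A d * o d := by
    intro d
    have : ∀ a s o : ZMod 2, a * (s + o * a) = a * s + a * o := by decide
    exact this _ _ _
  simp only [this, Finset.sum_add_distrib, h4]
  exact CharTwo.add_self_eq_zero _

lemma ev_one [DecidableRel r.SameCycle]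
    (hdeg : ∀ d, (Finset.univ.filter (r.SameCycle d)).card = 4 ∨
      (Finset.univ.filter (r.SameCycle d)).card = 6) : Ev r (fun _ => (1 : ZMod 2)) := by
  apply ev_of_vertex
  intro d
  rw [Finset.sum_const]
  rcases hdeg d with h | h <;> rw [h] <;> decide

end lin

section red

variable {D : Type*} [Fintype D] [DecidableEq D] {ι r : Equiv.Perm D}

lemma mem_pair_of_card {μ : D → D} (hμ : ∀ d, μ (μ d) = d) (hμn : ∀ d, μ d ≠ d) (X : Finset D)
    (hX : ∀ d ∈ X, μ d ∈ X) (hc : X.card ≤ 3) {d : D} (hd : d ∈ X) (t : D → ZMod 2)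
    (ht : ∑ e ∈ X, t e = 0) : t (μ d) = t d := by
  have : X = {d, μ d} := by
    ext e
    simp only [Finset.mem_insert, Finset.mem_singleton]
    constructor
    · intro he
      by_contra hcon
      push Not at hcon
      have hsub : ({d, μ d, e, μ e} : Finset D) ⊆ X := by
        intro f hf
        simp only [Finset.mem_insert, Finset.mem_singleton] at hf
        rcases hf with rfl | rfl | rfl | rfl
        exacts [hd, hX _ hd, he, hX _ he]
      have h4 := Finset.card_le_card hsub
      have n1 : d ≠ μ e := fun h => hcon.2 (by rw [h, hμ])
      have n2 : μ d ≠ μ e := fun h => hcon.1 (by rw [← hμ e, ← h, hμ])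
      rw [Finset.card_insert_of_notMem, Finset.card_insert_of_notMem,
        Finset.card_insert_of_notMem, Finset.card_singleton] at h4
      · omega
      · simpa using (hμn e).symm
      · simp only [Finset.mem_insert, Finset.mem_singleton, not_or]
        exact ⟨hcon.2.symm, n2⟩
      · simp only [Finset.mem_insert, Finset.mem_singleton, not_or]
        exact ⟨(hμn d).symm, hcon.1.symm, n1⟩
    · rintro (rfl | rfl)
      exacts [hd, hX _ hd]
  rw [this, Finset.sum_pair (hμn d).symm] at ht
  have h2 : ∀ a b : ZMod 2, a + b = 0 → b = a := by decide
  exact h2 _ _ ht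

theorem reduction (hι : ∀ d, ι (ι d) = d) (hn : ∀ d, ι d ≠ d) [DecidableRel r.SameCycle]
    (hdeg : ∀ d, (Finset.univ.filter (r.SameCycle d)).card = 4 ∨
      (Finset.univ.filter (r.SameCycle d)).card = 6)
    (S : (D → ZMod 2) →ₗ[ZMod 2] (D → ZMod 2))
    (hS : ∀ A, Ev r A → ∀ d, S A (r d) = S A d + A d)
    (o : D → ZMod 2) (ho : ∀ d, o (ι d) = o d + 1)
    (hL : ∀ A B, Zc ι r A → Zc ι r B → (∀ d, A d * B d = 0) → ∑ d, B d * S A d = 0) :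
    ∃ y : D → ZMod 2, (∀ d, y (r d) = y d) ∧ ∀ A B, Zc ι r A → Zc ι r B →
      ∑ d, B d * (S A d + o d * A d) = ∑ d, y d * A d * B d := by
  classical
  let χ := S (fun _ => 1)
  have hχ : ∀ d, χ (r d) = χ d + 1 := hS _ (ev_one hdeg)
  have hχ' : ∀ d, χ (r⁻¹ d) = χ d + 1 := by
    intro d
    have := hχ (r⁻¹ d)
    rw [perm_inv_self] at this
    have h2 : ∀ a b : ZMod 2, a = b + 1 → b = a + 1 := by decide
    exact h2 _ _ this
  have hχs : ∀ d, χ (Equiv.symm r d) = χ d + 1 := hχ'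
  let μ : D → D := fun d => if χ d = 0 then r d else r⁻¹ d
  let ν : D → D := fun d => if χ d = 0 then r⁻¹ d else r d
  have z10 : ¬ ((1 : ZMod 2) = 0) := by decide
  have z11 : ((1 : ZMod 2) + 1 = 0) := by decide
  have hμχ : ∀ d, χ (μ d) = χ d + 1 := fun d => by
    simp only [μ]; split_ifs <;> simp only [hχ, hχ']
  have hνχ : ∀ d, χ (ν d) = χ d + 1 := fun d => by
    simp only [ν]; split_ifs <;> simp only [hχ, hχ']
  have hμμ : ∀ d, μ (μ d) = d := by
    intro d
    rcases z2 (χ d) with h | h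
    · simp [μ, h, hχ]
    · simp [μ, h, hχs, z11]
  have hνν : ∀ d, ν (ν d) = d := by
    intro d
    rcases z2 (χ d) with h | h
    · simp [ν, h, hχs]
    · simp [ν, h, hχ, z11]
  have hne : ∀ a : ZMod 2, a + 1 ≠ a := by decide
  have hμn : ∀ d, μ d ≠ d := fun d h => hne (χ d) (by rw [← hμχ, h])
  have hνn : ∀ d, ν d ≠ d := fun d h => hne (χ d) (by rw [← hνχ, h])
  have hμinv : ∀ B : D → ZMod 2, (∀ d, B (r d) = B d) → ∀ d, B (μ d) = B d := by
    intro B hB d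
    simp only [μ]; split_ifs
    · exact hB d
    · exact inv_symm hB d
  have hνinv : ∀ B : D → ZMod 2, (∀ d, B (r d) = B d) → ∀ d, B (ν d) = B d := by
    intro B hB d
    simp only [ν]; split_ifs
    · exact inv_symm hB d
    · exact hB d
  let q : Quad (D × Bool) :=
    { ι := fun p => if p.2 then (ν p.1, true) else (ι p.1, false)
      σ := fun p => (μ p.1, p.2)
      τ := fun p => (p.1, !p.2)
      ιι := by rintro ⟨d, b⟩; cases b <;> simp [hι, hνν]
      ιn := by rintro ⟨d, b⟩; cases b <;> simp [hn, hνn]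
      σσ := by rintro ⟨d, b⟩; simp [hμμ]
      σn := by rintro ⟨d, b⟩; simp [hμn]
      ττ := by rintro ⟨d, b⟩; simp
      τn := by rintro ⟨d, b⟩; simp
      στ := by rintro ⟨d, b⟩; rfl
      στn := by rintro ⟨d, b⟩; simp }
  let I0 : (D → ZMod 2) →ₗ[ZMod 2] (D → ZMod 2) →ₗ[ZMod 2] ZMod 2 :=
    LinearMap.mk₂ (ZMod 2) (fun A B => ∑ d, B d * (S A d + o d * A d))
      (fun A A' B => by
        rw [← Finset.sum_add_distrib]
        refine Finset.sum_congr rfl fun d _ => ?_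
        simp only [map_add, Pi.add_apply]; ring)
      (fun c A B => by
        rw [Finset.smul_sum]
        refine Finset.sum_congr rfl fun d _ => ?_
        simp only [map_smul, Pi.smul_apply, smul_eq_mul]; ring)
      (fun A B B' => by
        rw [← Finset.sum_add_distrib]
        refine Finset.sum_congr rfl fun d _ => ?_
        simp only [Pi.add_apply]; ring)
      (fun c A B => by
        rw [Finset.smul_sum]
        refine Finset.sum_congr rfl fun d _ => ?_
        simp only [Pi.smul_apply, smul_eq_mul]; ring)
  have hI0 : ∀ A B, I0 A B = ∑ d, B d * (S A d + o d * A d) := fun A B => rfl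
  let res : (D × Bool → ZMod 2) →ₗ[ZMod 2] (D → ZMod 2) :=
    LinearMap.funLeft (ZMod 2) (ZMod 2) (fun d => (d, false))
  have hres : ∀ A d, res A d = A (d, false) := fun A d => rfl
  let I' := I0.compl₁₂ res res
  have hI' : ∀ A B, I' A B = I0 (res A) (res B) := fun A B => rfl
  have hresZ : ∀ A, q.IsZ A → Zc ι r (res A) := by
    intro A hA
    refine ⟨fun d => ?_, fun B hB => ?_⟩
    · have := hA.1 (d, false)
      simpa [q, hres] using this
    · have h1 : ∀ d, A (d, false) + A (μ d, false) + A (d, true) + A (μ d, true) = 0 := by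
        intro d
        have := hA.2 (d, false)
        simpa [q] using this
      have h2 : ∀ d, A (ν d, true) = A (d, true) := by
        intro d
        have := hA.1 (d, true)
        simpa [q] using this
      have h3 : ∑ d, (A (d, false) + A (d, true)) * B d = 0 :=
        sum_invol μ hμμ hμn _ (fun d => by
          rw [hμinv B hB]
          linear_combination B d * h1 d)
      have h4 : ∑ d, A (d, true) * B d = 0 :=
        sum_invol ν hνν hνn _ (fun d => by
          rw [hνinv B hB, h2]; exact CharTwo.add_self_eq_zero _)
      simp only [add_mul, Finset.sum_add_distrib, h4, add_zero] at h3
      exact h3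
  have hG : q.Good I' := by
    refine ⟨fun A hA => ?_, fun A B hA hB hAB => ?_⟩
    · rw [hI', hI0]
      exact I0_alt (hresZ A hA).1 ho (hS _ (hresZ A hA).2)
    · rw [hI', hI0, ← hL _ _ (hresZ A hA) (hresZ B hB) (fun d => hAB _)]
      refine Finset.sum_congr rfl fun d _ => ?_
      have : res A d * res B d = 0 := hAB _
      linear_combination o d * this
  obtain ⟨x', hx1, hx2, hx3⟩ := Quad.quad hG
  let x : D → ZMod 2 := fun d => x' (d, false)
  have hxt : ∀ d, x' (d, true) = x d := fun d => hx2 (d, false)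
  have hxμ : ∀ d, x (μ d) = x d := fun d => hx1 (d, false)
  -- lifts
  let t : (D → ZMod 2) → D → ZMod 2 := fun A d => if χ d = 0 then S A d else S A (r d)
  have ht1 : ∀ A d, t A (ν d) = t A d := by
    intro A d
    rcases z2 (χ d) with h | h
    · simp [t, ν, h, hχs]
    · simp [t, ν, h, hχ, z11]
  have ht2 : ∀ A, Zc ι r A → ∀ d, A d + A (μ d) + t A d + t A (μ d) = 0 := by
    intro A hA
    have h0 : ∀ d, χ d = 0 → A d + A (μ d) + t A d + t A (μ d) = 0 := by
      intro d h
      simp only [t, μ, h, hχ, if_true, zero_add, z10, if_false, hS A hA.2]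
      have : ∀ a b s : ZMod 2, a + b + s + (s + a + b) = 0 := by decide
      exact this _ _ _
    intro d
    rcases z2 (χ d) with h | h
    · exact h0 d h
    · have := h0 (μ d) (by rw [hμχ, h]; exact z11)
      rw [hμμ] at this
      linear_combination this
  let lift : (D → ZMod 2) → (D → ZMod 2) → D × Bool → ZMod 2 :=
    fun A T p => if p.2 then T p.1 else A p.1
  have hlift : ∀ A T, (∀ d, A (ι d) = A d) → (∀ d, T (ν d) = T d) →
      (∀ d, A d + A (μ d) + T d + T (μ d) = 0) → q.IsZ (lift A T) := by
    intro A T h1 h2 h3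
    refine ⟨?_, ?_⟩
    · rintro ⟨d, b⟩; cases b <;> simp [q, lift, h1, h2]
    · rintro ⟨d, b⟩
      cases b
      · simpa [q, lift] using h3 d
      · have := h3 d
        simp only [q, lift]
        simp only [Bool.not_true, if_true]
        simp
        linear_combination this
  have hform : ∀ A TA B TB, q.IsZ (lift A TA) → q.IsZ (lift B TB) →
      I0 A B = ∑ d, x d * (A d * B d + TA d * TB d) := by
    intro A TA B TB h1 h2
    have := hx3 _ _ h1 h2
    rw [hI', Fintype.sum_prod_type] at this
    have e : ∀ A T, res (lift A T) = A := fun A T => rfl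
    rw [e, e] at this
    rw [this]
    refine Finset.sum_congr rfl fun d _ => ?_
    rw [Fintype.sum_bool, hxt]
    simp only [lift, if_true]
    simp [x]
    ring
  have hZlift : ∀ A, Zc ι r A → q.IsZ (lift A (t A)) := fun A hA =>
    hlift A (t A) hA.1 (ht1 A) (ht2 A hA)
  have hvert : ∀ g B : D → ZMod 2, (∀ d, g (r d) = g d) → Zc ι r B → ∑ d, x d * (g d * t B d) = 0 := by
    intro g B hg hB
    have h1 : q.IsZ (lift 0 g) := hlift 0 g (fun _ => rfl) (hνinv g hg) (fun d => by
      rw [hμinv g hg]; simp [CharTwo.add_self_eq_zero])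
    have := hform 0 g B (t B) h1 (hZlift B hB)
    rw [map_zero, LinearMap.zero_apply] at this
    simpa using this.symm
  have hvert0 : ∀ g B : D → ZMod 2, (∀ d, g (r d) = g d) → Zc ι r B → ∑ d, g d * t B d = 0 := by
    intro g B hg hB
    exact sum_invol ν hνν hνn _ (fun d => by
      rw [ht1, hνinv g hg]; exact CharTwo.add_self_eq_zero _)
  have hsc : ∀ d, r.SameCycle d (μ d) := by
    intro d
    simp only [μ]; split_ifs
    · exact Equiv.Perm.sameCycle_apply_right.2 (Equiv.Perm.SameCycle.refl _ _)
    · exact ⟨-1, by simp⟩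
  -- the vertexwise choice
  have hY : ∀ d0, ∃ c, ∀ d, r.SameCycle d0 d → x d = c ∨ ∀ B, Zc ι r B → t B (μ d) = t B d := by
    intro d0
    let X : ZMod 2 → Finset D := fun a => (Finset.univ.filter (r.SameCycle d0)).filter (x · = a)
    have hXm : ∀ a d, d ∈ X a ↔ r.SameCycle d0 d ∧ x d = a := by
      intro a d; simp [X]
    have hXμ : ∀ a, ∀ d ∈ X a, μ d ∈ X a := by
      intro a d hd
      rw [hXm] at hd ⊢
      exact ⟨hd.1.trans (hsc d), by rw [hxμ]; exact hd.2⟩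
    have hcard : (X 0).card + (X 1).card ≤ 6 := by
      rw [← Finset.card_union_of_disjoint]
      · calc _ ≤ (Finset.univ.filter (r.SameCycle d0)).card := by
              apply Finset.card_le_card
              intro d hd
              rw [Finset.mem_union, hXm, hXm] at hd
              simp only [Finset.mem_filter, Finset.mem_univ, true_and]
              tauto
          _ ≤ 6 := by rcases hdeg d0 with h | h <;> omega
      · rw [Finset.disjoint_left]
        intro d h1 h2
        rw [hXm] at h1 h2
        rw [h1.2] at h2
        exact z10 h2.2.symm
    let g : D → ZMod 2 := fun e => if r.SameCycle d0 e then 1 else 0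
    have hg : ∀ e, g (r e) = g e := fun e => by
      simp only [g, Equiv.Perm.sameCycle_apply_right]
    have hs1 : ∀ B, Zc ι r B → ∑ e ∈ X 1, t B e = 0 := by
      intro B hB
      rw [← hvert g B hg hB]
      simp only [X, Finset.sum_filter]
      refine Finset.sum_congr rfl fun e _ => ?_
      rcases z2 (x e) with h | h <;> by_cases h' : r.SameCycle d0 e <;> simp [g, h, h']
    have hs0 : ∀ B, Zc ι r B → ∑ e ∈ X 0, t B e = 0 := by
      intro B hB
      have h1 := hvert g B hg hB
      have h2 := hvert0 g B hg hB
      have h3 : ∑ e ∈ X 0, t B e = ∑ d, g d * t B d + ∑ d, x d * (g d * t B d) := by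
        rw [← Finset.sum_add_distrib]
        simp only [X, Finset.sum_filter]
        refine Finset.sum_congr rfl fun e _ => ?_
        rcases z2 (x e) with h | h <;> by_cases h' : r.SameCycle d0 e <;>
          simp [g, h, h', CharTwo.add_self_eq_zero]
      rw [h3, h1, h2, add_zero]
    by_cases hc : (X 1).card ≤ 3
    · refine ⟨0, fun d hd => ?_⟩
      rcases z2 (x d) with h | h
      · exact Or.inl h
      · exact Or.inr fun B hB => mem_pair_of_card hμμ hμn (X 1) (hXμ 1) hc
          ((hXm _ _).2 ⟨hd, h⟩) _ (hs1 B hB)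
    · refine ⟨1, fun d hd => ?_⟩
      rcases z2 (x d) with h | h
      · exact Or.inr fun B hB => mem_pair_of_card hμμ hμn (X 0) (hXμ 0) (by omega)
          ((hXm _ _).2 ⟨hd, h⟩) _ (hs0 B hB)
      · exact Or.inl h
  choose Y hY using hY
  let y : D → ZMod 2 := fun d => Y (Quotient.mk (Equiv.Perm.SameCycle.setoid r) d).out
  have hyr : ∀ d, y (r d) = y d := by
    intro d
    have : Quotient.mk (Equiv.Perm.SameCycle.setoid r) (r d) =
        Quotient.mk (Equiv.Perm.SameCycle.setoid r) d :=
      Quotient.sound (Equiv.Perm.sameCycle_apply_left.2 (Equiv.Perm.SameCycle.refl _ _))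
    simp only [y, this]
  have hy : ∀ d, x d = y d ∨ ∀ B, Zc ι r B → t B (μ d) = t B d := by
    intro d
    apply hY
    exact Quotient.exact (Quotient.out_eq (Quotient.mk (Equiv.Perm.SameCycle.setoid r) d))
  refine ⟨y, hyr, fun A B hA hB => ?_⟩
  have h1 := hform A (t A) B (t B) (hZlift A hA) (hZlift B hB)
  rw [hI0] at h1
  rw [h1]
  have h2 : ∑ d, (x d + y d) * (A d * B d + t A d * t B d) = 0 := by
    refine sum_invol μ hμμ hμn _ (fun d => ?_)
    rw [hxμ, hμinv y hyr]
    rcases hy d with h | h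
    · rw [h, CharTwo.add_self_eq_zero]; ring
    · have hh : ∀ a b c : ZMod 2, a + b + c + c = 0 → b = a := by decide
      have e1 := ht2 A hA d
      have e2 := ht2 B hB d
      rw [h A hA] at e1
      rw [h B hB] at e2
      rw [h A hA, h B hB, hh _ _ _ e1, hh _ _ _ e2]
      exact CharTwo.add_self_eq_zero _
  have h3 : ∑ d, y d * (t A d * t B d) = 0 :=
    sum_invol ν hνν hνn _ (fun d => by
      rw [ht1, ht1, hνinv y hyr]; exact CharTwo.add_self_eq_zero _)
  have h4 : ∑ d, (x d + y d) * (A d * B d + t A d * t B d) =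
      ∑ d, x d * (A d * B d + t A d * t B d) + ∑ d, y d * A d * B d +
        ∑ d, y d * (t A d * t B d) := by
    rw [← Finset.sum_add_distrib, ← Finset.sum_add_distrib]
    exact Finset.sum_congr rfl fun d _ => by ring
  rw [h2, h3, add_zero] at h4
  have hh : ∀ a b : ZMod 2, 0 = a + b → a = b := by decide
  exact hh _ _ h4

end red

end VO


set_option linter.unusedSectionVars false
set_option linter.unusedSimpArgs false

namespace VO

section euler

open Module

variable {D : Type*} [Fintype D] [DecidableEq D]

/-- functions invariant under a map -/
def InvS (f : Equiv.Perm D) : Submodule (ZMod 2) (D → ZMod 2) where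
  carrier := {B | ∀ d, B (f d) = B d}
  add_mem' := fun {a b} ha hb d => by simp only [Pi.add_apply]; rw [ha d, hb d]
  zero_mem' := fun d => rfl
  smul_mem' := fun c a ha d => by simp only [Pi.smul_apply]; rw [ha d]

lemma mem_InvS {f : Equiv.Perm D} {B : D → ZMod 2} : B ∈ InvS f ↔ ∀ d, B (f d) = B d := Iff.rfl

lemma finrank_of_setoid (s : Setoid D) (W : Submodule (ZMod 2) (D → ZMod 2))
    (h : ∀ B, B ∈ W ↔ ∀ d e, s d e → B d = B e) :
    finrank (ZMod 2) W = Nat.card (Quotient s) := by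
  classical
  have : Fintype (Quotient s) := Fintype.ofFinite _
  let L := LinearMap.funLeft (ZMod 2) (ZMod 2) (fun d : D => (Quotient.mk s d))
  have hW : W = LinearMap.range L := by
    ext B
    rw [h, LinearMap.mem_range]
    constructor
    · intro hB
      exact ⟨fun q => Quotient.lift B hB q, funext fun d => rfl⟩
    · rintro ⟨C, rfl⟩ d e hde
      simp only [L, LinearMap.funLeft_apply]
      rw [Quotient.sound hde]
  have hL : Function.Injective L :=
    LinearMap.funLeft_injective_of_surjective _ _ _ Quotient.mk_surjective
  rw [hW, LinearMap.finrank_range_of_inj hL, finrank_fintype_fun_eq_card, Nat.card_eq_fintype_card]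

lemma finrank_InvS (f : Equiv.Perm D) :
    finrank (ZMod 2) (InvS f) = Nat.card (Quotient (Equiv.Perm.SameCycle.setoid f)) := by
  refine finrank_of_setoid _ _ fun B => ⟨fun hB d e hde => (inv_sameCycle hB hde).symm,
    fun hB d => hB _ _ ?_⟩
  exact Equiv.Perm.sameCycle_apply_left.2 (Equiv.Perm.SameCycle.refl _ _)

lemma finrank_Inv2 (r ι : Equiv.Perm D) :
    finrank (ZMod 2) (InvS r ⊓ InvS ι : Submodule (ZMod 2) (D → ZMod 2)) =
      Nat.card (Quotient (Relation.EqvGen.setoid (fun d e : D => e = r d ∨ e = ι d))) := by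
  refine finrank_of_setoid _ _ fun B => ⟨fun hB d e hde => ?_, fun hB => ⟨fun d => ?_, fun d => ?_⟩⟩
  · change Relation.EqvGen _ d e at hde
    induction hde with
    | rel x y h => 
      rcases h with rfl | rfl
      · exact (hB.1 x).symm
      · exact (hB.2 x).symm
    | refl => rfl
    | symm x y _ ih => exact ih.symm
    | trans x y z _ _ h1 h2 => exact h1.trans h2
  · exact (hB _ _ (Relation.EqvGen.rel _ _ (Or.inl rfl))).symm
  · exact (hB _ _ (Relation.EqvGen.rel _ _ (Or.inr rfl))).symm

/-- the map adding up the two darts of an edge -/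
def Tm (ι : Equiv.Perm D) : (D → ZMod 2) →ₗ[ZMod 2] (D → ZMod 2) :=
  LinearMap.id + LinearMap.funLeft (ZMod 2) (ZMod 2) ι

lemma Tm_apply (ι : Equiv.Perm D) (c : D → ZMod 2) (d : D) : Tm ι c d = c d + c (ι d) := rfl

lemma z2_add_eq_zero {a b : ZMod 2} : a + b = 0 ↔ b = a := by
  revert a b; decide

lemma ker_Tm (ι : Equiv.Perm D) : LinearMap.ker (Tm ι) = InvS ι := by
  ext c
  rw [LinearMap.mem_ker, funext_iff]
  exact forall_congr' fun d => by rw [Tm_apply]; exact z2_add_eq_zero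

variable {ι r ρ : Equiv.Perm D}

lemma range_Tm (hι : ∀ d, ι (ι d) = d) (hn : ∀ d, ι d ≠ d) : LinearMap.range (Tm ι) = InvS ι := by
  obtain ⟨o, ho⟩ := exists_o ι hι hn
  ext A
  constructor
  · rintro ⟨c, rfl⟩ d
    rw [Tm_apply, Tm_apply, hι, add_comm]
  · intro hA
    refine ⟨fun d => o d * A d, funext fun d => ?_⟩
    rw [Tm_apply, ho, hA]
    generalize o d = a
    generalize A d = b
    revert a b; decide

lemma card_eq (hι : ∀ d, ι (ι d) = d) (hn : ∀ d, ι d ≠ d) :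
    Fintype.card D = 2 * finrank (ZMod 2) (InvS ι) := by
  have h := LinearMap.finrank_range_add_finrank_ker (Tm ι)
  rw [range_Tm hι hn, ker_Tm, finrank_fintype_fun_eq_card] at h
  omega

/-- the space of even subgraphs -/
def Zs (ι r : Equiv.Perm D) : Submodule (ZMod 2) (D → ZMod 2) where
  carrier := {A | Zc ι r A}
  add_mem' := fun ha hb => Zc.add ha hb
  zero_mem' := zc_zero
  smul_mem' := fun c a ha => by
    rcases z2 c with rfl | rfl
    · simpa using zc_zero
    · simpa using ha

lemma mem_Zs {A : D → ZMod 2} : A ∈ Zs ι r ↔ Zc ι r A := Iff.rfl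

lemma finrank_orth (W Z : Submodule (ZMod 2) (D → ZMod 2))
    (h : ∀ A, A ∈ Z ↔ ∀ B ∈ W, ∑ d, B d * A d = 0) :
    finrank (ZMod 2) Z + finrank (ZMod 2) W = Fintype.card D := by
  let B : LinearMap.BilinForm (ZMod 2) (D → ZMod 2) := Matrix.toBilin' 1
  have hB : B.Nondegenerate :=
    Matrix.Nondegenerate.toBilin' (Matrix.nondegenerate_of_det_ne_zero (by simp))
  have hZ : Z = B.orthogonal W := by
    ext A
    rw [h, LinearMap.BilinForm.mem_orthogonal_iff]
    refine forall₂_congr fun C _ => ?_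
    simp [B, Matrix.toBilin'_apply', dotProduct]
  have := LinearMap.BilinForm.finrank_orthogonal hB W
  have h2 := Submodule.finrank_le W
  rw [finrank_fintype_fun_eq_card] at this h2
  rw [hZ, this]
  omega

lemma mem_Zs_iff (hι : ∀ d, ι (ι d) = d) (hn : ∀ d, ι d ≠ d) (A : D → ZMod 2) :
    A ∈ Zs ι r ↔ ∀ B ∈ (InvS r ⊔ InvS ι : Submodule (ZMod 2) (D → ZMod 2)),
      ∑ d, B d * A d = 0 := by
  constructor
  · intro hA B hB
    obtain ⟨h, hh, q, hq, rfl⟩ := Submodule.mem_sup.1 hB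
    simp only [Pi.add_apply, add_mul, Finset.sum_add_distrib]
    have h1 := hA.2 h hh
    simp only [mul_comm (A _)] at h1
    rw [h1, zero_add]
    refine sum_invol ι hι hn _ fun d => ?_
    rw [hq, hA.1]
    exact CharTwo.add_self_eq_zero _
  · intro h
    refine ⟨fun d => ?_, fun B hB => ?_⟩
    · have := h (fun e => if e = d ∨ e = ι d then 1 else 0) (Submodule.mem_sup_right (by
        intro e
        have : (ι e = d ∨ ι e = ι d) ↔ (e = d ∨ e = ι d) := by
          rw [ι.injective.eq_iff, or_comm]
          refine or_congr Iff.rfl ⟨fun h => by rw [← h, hι], fun h => by rw [h, hι]⟩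
        simp only [this]))
      simp only [ite_mul, one_mul, zero_mul, ← Finset.sum_filter] at this
      rw [Finset.filter_or, Finset.filter_eq', Finset.filter_eq'] at this
      simp only [Finset.mem_univ, if_true] at this
      rw [Finset.sum_union (by simpa using (hn d).symm)] at this
      simp only [Finset.sum_singleton] at this
      exact z2_add_eq_zero.1 this
    · have := h B (Submodule.mem_sup_left hB)
      simpa only [mul_comm (B _)] using this

lemma finrank_Zs (hι : ∀ d, ι (ι d) = d) (hn : ∀ d, ι d ≠ d) :
    finrank (ZMod 2) (Zs ι r) + finrank (ZMod 2) (InvS r) =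
      finrank (ZMod 2) (InvS ι) +
      finrank (ZMod 2) (InvS r ⊓ InvS ι : Submodule (ZMod 2) (D → ZMod 2)) := by
  have h1 := finrank_orth (InvS r ⊔ InvS ι) (Zs ι r) (mem_Zs_iff hι hn)
  have h2 := Submodule.finrank_sup_add_finrank_inf_eq (InvS r) (InvS ι)
  have h3 := card_eq hι hn
  omega

/-- boundaries of faces -/
def Bs (ι ρ : Equiv.Perm D) : Submodule (ZMod 2) (D → ZMod 2) := (InvS (ρ * ι)).map (Tm ι)

lemma mem_Bs {A : D → ZMod 2} : A ∈ Bs ι ρ ↔ ∃ c : D → ZMod 2, (∀ d, c (ρ (ι d)) = c d) ∧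
    ∀ d, c d + c (ι d) = A d := by
  constructor
  · rintro ⟨c, hc, rfl⟩
    exact ⟨c, hc, fun d => rfl⟩
  · rintro ⟨c, hc, h⟩
    exact ⟨c, hc, funext h⟩

lemma finrank_map_aux (f : (D → ZMod 2) →ₗ[ZMod 2] (D → ZMod 2))
    (W : Submodule (ZMod 2) (D → ZMod 2)) :
    finrank (ZMod 2) (W.map f) +
      finrank (ZMod 2) (W ⊓ LinearMap.ker f : Submodule (ZMod 2) (D → ZMod 2)) =
      finrank (ZMod 2) W := by
  have h := LinearMap.finrank_range_add_finrank_ker (f.domRestrict W)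
  rw [LinearMap.range_domRestrict] at h
  have h2 : W ⊓ LinearMap.ker f = (LinearMap.ker (f.domRestrict W)).map W.subtype := by
    rw [LinearMap.ker_domRestrict, Submodule.map_comap_subtype]
  rw [h2, Submodule.finrank_map_subtype_eq]
  exact h

lemma finrank_Bs (hι : ∀ d, ι (ι d) = d)
    (hρ : ∀ B : D → ZMod 2, (∀ d, B (ρ d) = B d) ↔ ∀ d, B (r d) = B d) :
    finrank (ZMod 2) (Bs ι ρ) +
      finrank (ZMod 2) (InvS r ⊓ InvS ι : Submodule (ZMod 2) (D → ZMod 2)) =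
      finrank (ZMod 2) (InvS (ρ * ι)) := by
  have h := finrank_map_aux (Tm ι) (InvS (ρ * ι))
  rw [ker_Tm] at h
  have : InvS (ρ * ι) ⊓ InvS ι = InvS r ⊓ InvS ι := by
    ext c
    refine ⟨fun ⟨h1, h2⟩ => ⟨(hρ c).1 fun d => ?_, h2⟩, fun ⟨h1, h2⟩ => ⟨fun d => ?_, h2⟩⟩
    · have := h1 (ι d)
      rw [Equiv.Perm.mul_apply, hι, h2] at this
      exact this
    · rw [Equiv.Perm.mul_apply, (hρ c).2 h1, h2]
  rw [this] at h
  exact h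

lemma Bs_le (hι : ∀ d, ι (ι d) = d)
    (hρ : ∀ B : D → ZMod 2, (∀ d, B (ρ d) = B d) ↔ ∀ d, B (r d) = B d) :
    Bs ι ρ ≤ Zs ι r := by
  intro A hA
  obtain ⟨c, hc, h⟩ := mem_Bs.1 hA
  have hc' : ∀ d, c (ι d) = c (ρ d) := fun d => by rw [← hc (ι d), hι]
  refine ⟨fun d => by rw [← h, ← h, hι, add_comm], fun B hB => ?_⟩
  have hB' := (hρ B).2 hB
  simp only [← h, add_mul, Finset.sum_add_distrib, hc']
  have : ∑ d, c (ρ d) * B d = ∑ d, c d * B d := by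
    rw [← Equiv.sum_comp ρ (fun d => c d * B d)]
    exact Finset.sum_congr rfl fun d _ => by rw [hB']
  rw [this]
  exact CharTwo.add_self_eq_zero _

theorem euler (hι : ∀ d, ι (ι d) = d) (hn : ∀ d, ι d ≠ d)
    (hρ : ∀ B : D → ZMod 2, (∀ d, B (ρ d) = B d) ↔ ∀ d, B (r d) = B d) :
    ((Nat.card (Quotient (Equiv.Perm.SameCycle.setoid r)) : ℤ) - (Fintype.card D / 2 : ℕ) +
      Nat.card (Quotient (Equiv.Perm.SameCycle.setoid (ρ * ι))) =
      2 * Nat.card (Quotient (Relation.EqvGen.setoid (fun d e : D => e = r d ∨ e = ι d)))) ↔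
    ∀ A, Zc ι r A → ∃ c : D → ZMod 2, (∀ d, c (ρ (ι d)) = c d) ∧ ∀ d, c d + c (ι d) = A d := by
  rw [← finrank_InvS, ← finrank_InvS, ← finrank_Inv2]
  have h1 := finrank_Zs (r := r) hι hn
  have h2 := finrank_Bs hι hρ
  have h3 := card_eq hι hn
  have hle := Bs_le hι hρ
  have hh : Fintype.card D / 2 = finrank (ZMod 2) (InvS ι) := by omega
  rw [hh]
  constructor
  · intro h A hA
    have : Bs ι ρ = Zs ι r := Submodule.eq_of_le_of_finrank_eq hle (by omega)
    exact mem_Bs.1 (this ▸ (mem_Zs.2 hA))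
  · intro h
    have : Bs ι ρ = Zs ι r := le_antisymm hle fun A hA => mem_Bs.2 (h A hA)
    rw [this] at h2
    omega

/-- Reverse the rotation where `y = 1`. -/
lemma exists_rho {y : D → ZMod 2} (hy : ∀ d, y (r d) = y d) :
    ∃ ρ : Equiv.Perm D, ∀ d, ρ d = if y d = 0 then r d else r⁻¹ d := by
  have hy' := inv_symm hy
  refine ⟨⟨fun d => if y d = 0 then r d else r⁻¹ d, fun d => if y d = 0 then r⁻¹ d else r d,
    fun d => ?_, fun d => ?_⟩, fun d => rfl⟩
  · by_cases h : y d = 0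
    · simp only [h, if_true, hy, perm_self_inv]
    · simp only [h, if_false, hy', perm_inv_self]
  · by_cases h : y d = 0
    · simp only [h, if_true, hy', perm_inv_self]
    · simp only [h, if_false, hy, perm_self_inv]

lemma exists_face {S : (D → ZMod 2) → (D → ZMod 2)} 
    (hι : ∀ d, ι (ι d) = d) (hn : ∀ d, ι d ≠ d)
    (hS : ∀ A, Ev r A → ∀ d, S A (r d) = S A d + A d) {o y : D → ZMod 2}
    (ho : ∀ d, o (ι d) = o d + 1) (hy : ∀ d, y (r d) = y d)
    (h : ∀ A B, Zc ι r A → Zc ι r B →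
      ∑ d, B d * (S A d + o d * A d) = ∑ d, y d * A d * B d)
    (hρ : ∀ d, ρ d = if y d = 0 then r d else r⁻¹ d) (A : D → ZMod 2) (hA : Zc ι r A) :
    ∃ c : D → ZMod 2, (∀ d, c (ρ (ι d)) = c d) ∧ ∀ d, c d + c (ι d) = A d := by
  have hp := mem_of_dual (InvS r ⊔ InvS ι) (fun d => S A d + o d * A d + y d * A d) (by
    intro B hB
    have hBZ : Zc ι r B := (mem_Zs_iff hι hn B).2 fun w hw => by
      have := hB w hw
      simpa only [mul_comm (w _)] using this
    have := h A B hA hBZ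
    simp only [mul_add (B _) (_ + _), Finset.sum_add_distrib, this]
    rw [← Finset.sum_add_distrib]
    refine Finset.sum_eq_zero fun d _ => ?_
    rw [mul_comm (B d)]
    exact CharTwo.add_self_eq_zero _)
  obtain ⟨g, hg, q, hq, hgq⟩ := Submodule.mem_sup.1 hp
  have hgq' : ∀ d, g d + q d = S A d + o d * A d + y d * A d := fun d => congrFun hgq d
  have hc : ∀ d, S A d + y d * A d + g d = o d * A d + q d := fun d => by
    have := hgq' d
    have key : ∀ a b c d e : ZMod 2, a + b = c + d + e → c + e + a = d + b := by decide
    exact key _ _ _ _ _ this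
  have h2 : ∀ d, (o d * A d + q d) + (o (ι d) * A (ι d) + q (ι d)) = A d := fun d => by
    rw [ho, hA.1, hq]
    have key : ∀ a b c : ZMod 2, (a * b + c) + ((a+1) * b + c) = b := by decide
    exact key _ _ _
  have h3 : ∀ d, o (ρ d) * A (ρ d) + q (ρ d) = o d * A d + q d + A d := fun d => by
    rw [← hc, ← hc, hρ]
    split_ifs with h0
    · rw [hy, hS A hA.2, hg, h0]
      ring
    · have h1 := z2_ne h0
      have e1 := hS A hA.2 (r⁻¹ d)
      rw [perm_inv_self] at e1
      rw [inv_symm hy, inv_symm hg, h1, e1]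
      generalize A (r⁻¹ d) = a
      generalize A d = b
      generalize S A (r⁻¹ d) = u
      generalize g d = v
      revert a b u v
      decide
  refine ⟨fun d => o d * A d + q d, fun d => ?_, h2⟩
  simp only
  rw [h3]
  have := h2 d
  rw [hA.1] at this ⊢
  have key : ∀ a b c : ZMod 2, a + b = c → b + c = a := by decide
  exact key _ _ _ this

end euler

end VO


set_option linter.unusedSectionVars false
set_option linter.unusedSimpArgs false

namespace VO

section steps

variable {D : Type*} [Fintype D] [DecidableEq D] {r : Equiv.Perm D}

lemma stepsTo_spec {x y : D} (h : r.SameCycle x y) :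
    0 < stepsTo r x y ∧ (r ^ stepsTo r x y) x = y := by
  have hne : {m : ℕ | 0 < m ∧ (r ^ m) x = y}.Nonempty := by
    obtain ⟨n, hn, -, h⟩ := Equiv.Perm.SameCycle.exists_pow_eq'' h
    exact ⟨n, hn, h⟩
  exact Nat.sInf_mem hne

lemma stepsTo_le {x y : D} {m : ℕ} (hm : 0 < m) (h : (r ^ m) x = y) : stepsTo r x y ≤ m :=
  Nat.sInf_le ⟨hm, h⟩

lemma stepsTo_inj {x y z : D} (hy : r.SameCycle x y) (hz : r.SameCycle x z)
    (h : stepsTo r x y = stepsTo r x z) : y = z := by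
  rw [← (stepsTo_spec hy).2, ← (stepsTo_spec hz).2, h]

lemma stepsTo_apply_self (x : D) : stepsTo r x (r x) = 1 := by
  have h1 : stepsTo r x (r x) ≤ 1 := stepsTo_le one_pos (by simp)
  have h2 := (stepsTo_spec (r := r) (x := x) (y := r x)
    (Equiv.Perm.sameCycle_apply_right.2 (Equiv.Perm.SameCycle.refl _ _))).1
  omega

lemma stepsTo_apply {x y : D} (h : r.SameCycle x y) (hne : y ≠ x) :
    stepsTo r x (r y) = stepsTo r x y + 1 := by
  obtain ⟨h1, h2⟩ := stepsTo_spec h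
  obtain ⟨h3, h4⟩ := stepsTo_spec (r := r) (x := x) (y := r y)
    (Equiv.Perm.sameCycle_apply_right.2 h)
  have h5 : stepsTo r x (r y) ≤ stepsTo r x y + 1 :=
    stepsTo_le (Nat.succ_pos _) (by rw [pow_succ', Equiv.Perm.mul_apply, h2])
  obtain ⟨n, hn⟩ : ∃ n, stepsTo r x (r y) = n + 1 := ⟨_, (Nat.succ_pred_eq_of_pos h3).symm⟩
  rw [hn, pow_succ', Equiv.Perm.mul_apply] at h4
  have h6 := r.injective h4
  have hn0 : 0 < n := by
    rcases Nat.eq_zero_or_pos n with rfl | h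
    · exact absurd h6.symm hne
    · exact h
  have := stepsTo_le hn0 h6
  omega

lemma stepsTo_le_self {x y : D} (h : r.SameCycle x y) : stepsTo r x y ≤ stepsTo r x x := by
  obtain ⟨h1, h2⟩ := stepsTo_spec h
  obtain ⟨h3, h4⟩ := stepsTo_spec (Equiv.Perm.SameCycle.refl r x)
  by_contra hlt
  push Not at hlt
  have : (r ^ (stepsTo r x y - stepsTo r x x)) x = y := by
    have h5 : stepsTo r x y = (stepsTo r x y - stepsTo r x x) + stepsTo r x x := by omega
    rw [h5, pow_add, Equiv.Perm.mul_apply, h4] at h2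
    exact h2
  have := stepsTo_le (by omega) this
  omega

open Classical in
/-- characteristic function of the half-open interval from `x` to `y` -/
noncomputable def itv (r : Equiv.Perm D) (x y d : D) : ZMod 2 :=
  if r.SameCycle x d ∧ stepsTo r x d ≤ stepsTo r x y then 1 else 0

/-- delta function -/
def dl (x d : D) : ZMod 2 := if d = x then 1 else 0

lemma itv_apply {x y : D} (hxy : r.SameCycle x y) (hne : x ≠ y) (d : D) :
    itv r x y (r d) = itv r x y d + (dl x d + dl y d) := by
  unfold itv dl
  by_cases hd : r.SameCycle x d
  · by_cases hdx : d = x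
    · subst hdx
      have h1 := stepsTo_le_self hxy
      have h2 : stepsTo r d y ≠ stepsTo r d d := fun h => hne (stepsTo_inj hxy hd h).symm
      have h3 := (stepsTo_spec hxy).1
      rw [if_pos ⟨Equiv.Perm.sameCycle_apply_right.2 hd, by rw [stepsTo_apply_self]; omega⟩,
        if_neg (by rintro ⟨-, h⟩; omega), if_pos rfl, if_neg hne]
      rfl
    · rw [if_neg hdx]
      simp only [Equiv.Perm.sameCycle_apply_right, hd, true_and, stepsTo_apply hd hdx]
      have h1 : d = y ↔ stepsTo r x d = stepsTo r x y :=
        ⟨fun h => by rw [h], fun h => stepsTo_inj hd hxy h⟩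
      simp only [h1]
      rcases lt_trichotomy (stepsTo r x d) (stepsTo r x y) with h | h | h
      · rw [if_pos (by omega), if_pos (by omega), if_neg (by omega)]; rfl
      · rw [if_neg (by omega), if_pos (by omega), if_pos (by omega)]; rfl
      · rw [if_neg (by omega), if_neg (by omega), if_neg (by omega)]; rfl
  · rw [if_neg (by rw [Equiv.Perm.sameCycle_apply_right]; tauto), if_neg (by tauto),
      if_neg (by rintro rfl; exact hd (Equiv.Perm.SameCycle.refl _ _)),
      if_neg (by rintro rfl; exact hd hxy)]
    rfl

lemma itv_alt {a₁ a₂ b₁ b₂ : D} (ha : r.SameCycle a₁ a₂) (h1 : r.SameCycle a₁ b₁)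
    (h2 : r.SameCycle a₁ b₂) (n1 : b₁ ≠ a₂) (n2 : b₂ ≠ a₂) :
    itv r a₁ a₂ b₁ + itv r a₁ a₂ b₂ = 1 ↔ Alternating r a₁ a₂ b₁ b₂ := by
  have m1 : stepsTo r a₁ b₁ ≠ stepsTo r a₁ a₂ := fun h => n1 (stepsTo_inj h1 ha h)
  have m2 : stepsTo r a₁ b₂ ≠ stepsTo r a₁ a₂ := fun h => n2 (stepsTo_inj h2 ha h)
  unfold itv Alternating
  simp only [h1, h2, true_and]
  split_ifs with p q q
  · have : (1 : ZMod 2) + 1 ≠ 1 := by decide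
    simp only [this, false_iff]; omega
  · simp only [add_zero, true_iff]; omega
  · simp only [zero_add, true_iff]; omega
  · have : (0 : ZMod 2) + 0 ≠ 1 := by decide
    simp only [this, false_iff]; omega

lemma itv_zero {a₁ a₂ b : D} (h : ¬ r.SameCycle a₁ b) : itv r a₁ a₂ b = 0 := by
  unfold itv
  rw [if_neg (by tauto)]

/-- the local pairing at the vertex of `d` -/
def Lv (r : Equiv.Perm D) [DecidableRel r.SameCycle] (s B : D → ZMod 2) (d : D) : ZMod 2 :=
  ∑ e ∈ Finset.univ.filter (r.SameCycle d), B e * s e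

variable [DecidableRel r.SameCycle]

lemma const_on {s : D → ZMod 2} {d : D} (h : ∀ e, r.SameCycle d e → s (r e) = s e) :
    ∀ e, r.SameCycle d e → s e = s d := by
  intro e he
  obtain ⟨n, -, rfl⟩ := he.exists_pow_eq'
  clear he
  induction n with
  | zero => rfl
  | succ n ih =>
    rw [pow_succ', Equiv.Perm.mul_apply, h _ ⟨n, by simp⟩, ih]

lemma Lv_congr {s s' A A' B B' : D → ZMod 2} {d : D}
    (hs : ∀ e, r.SameCycle d e → s (r e) = s e + A e)
    (hs' : ∀ e, r.SameCycle d e → s' (r e) = s' e + A' e)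
    (hA : ∀ e, r.SameCycle d e → A e = A' e)
    (hB : ∀ e, r.SameCycle d e → B e = B' e)
    (hev : ∑ e ∈ Finset.univ.filter (r.SameCycle d), B e = 0) :
    Lv r s B d = Lv r s' B' d := by
  have hc := const_on (r := r) (s := s + s') (d := d) (fun e he => by
    simp only [Pi.add_apply]
    rw [hs e he, hs' e he, hA e he]
    generalize s e = a
    generalize s' e = b
    generalize A' e = c
    revert a b c; decide)
  have : Lv r s B d = Lv r s' B' d + (s + s') d * ∑ e ∈ Finset.univ.filter (r.SameCycle d), B e := by
    unfold Lv
    rw [Finset.mul_sum, ← Finset.sum_add_distrib]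
    refine Finset.sum_congr rfl fun e he => ?_
    rw [Finset.mem_filter] at he
    rw [← hc e he.2, ← hB e he.2]
    simp only [Pi.add_apply]
    generalize s e = a
    generalize s' e = b
    generalize B e = c
    revert a b c; decide
  rw [this, hev, mul_zero, add_zero]

lemma Lv_dl {s : D → ZMod 2} {d b : D} (hb : r.SameCycle d b) : Lv r s (dl b) d = s b := by
  unfold Lv dl
  rw [Finset.sum_eq_single_of_mem b (by simp [hb]) (fun c _ hc => by simp [hc])]
  simp

lemma Lv_add {s B B' : D → ZMod 2} {d : D} : Lv r s (B + B') d = Lv r s B d + Lv r s B' d := by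
  unfold Lv
  rw [← Finset.sum_add_distrib]
  exact Finset.sum_congr rfl fun e _ => by rw [Pi.add_apply, add_mul]

lemma sum_dl {d b : D} (hb : r.SameCycle d b) :
    ∑ e ∈ Finset.univ.filter (r.SameCycle d), dl b e = 1 := by
  have := Lv_dl (s := fun _ => 1) hb
  simpa [Lv] using this

lemma Lv_pair {s A B : D → ZMod 2} {d a₁ a₂ b₁ b₂ : D}
    (hs : ∀ e, r.SameCycle d e → s (r e) = s e + A e)
    (hA : ∀ e, r.SameCycle d e → A e = dl a₁ e + dl a₂ e)
    (hB : ∀ e, r.SameCycle d e → B e = dl b₁ e + dl b₂ e)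
    (ha : a₁ ≠ a₂) (h1 : r.SameCycle d a₁) (h2 : r.SameCycle d a₂)
    (h3 : r.SameCycle d b₁) (h4 : r.SameCycle d b₂) (n1 : b₁ ≠ a₂) (n2 : b₂ ≠ a₂) :
    Lv r s B d = 1 ↔ Alternating r a₁ a₂ b₁ b₂ := by
  rw [← itv_alt (h1.symm.trans h2) (h1.symm.trans h3) (h1.symm.trans h4) n1 n2]
  rw [Lv_congr (s' := itv r a₁ a₂) (A' := fun e => dl a₁ e + dl a₂ e) (B' := dl b₁ + dl b₂) hs
    (fun e _ => itv_apply (h1.symm.trans h2) ha e) hA hB ?_, Lv_add, Lv_dl h3, Lv_dl h4]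
  rw [Finset.sum_congr rfl (fun e he => hB e (Finset.mem_filter.1 he).2), Finset.sum_add_distrib,
    sum_dl h3, sum_dl h4]
  rfl

lemma not_alt {a₁ a₂ b₁ b₂ : D} (h : Alternating r a₁ a₂ b₁ b₂) :
    ¬ Alternating r a₁ b₁ a₂ b₂ ∧ ¬ Alternating r a₁ b₂ a₂ b₁ := by
  unfold Alternating at *
  omega

/-- symmetry of the local pairing -/
lemma Lv_symm {s s' A B : D → ZMod 2} {d : D}
    (hs : ∀ e, r.SameCycle d e → s (r e) = s e + A e)
    (hs' : ∀ e, r.SameCycle d e → s' (r e) = s' e + B e)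
    (hd : ∀ e, r.SameCycle d e → A e * B e = 0) : Lv r s B d = Lv r s' A d := by
  have h1 : ∑ e ∈ Finset.univ.filter (r.SameCycle d), s (r e) * s' (r e) =
      ∑ e ∈ Finset.univ.filter (r.SameCycle d), s e * s' e := by
    refine Finset.sum_bij (fun e _ => r e) ?_ ?_ ?_ ?_
    · intro e he
      simpa using he
    · intro a _ b _ h; exact r.injective h
    · intro b hb
      refine ⟨r⁻¹ b, ?_, perm_inv_self r b⟩
      simpa using hb
    · intros; rfl
  have h2 : ∀ e ∈ Finset.univ.filter (r.SameCycle d), s (r e) * s' (r e) =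
      s e * s' e + (B e * s e + A e * s' e) := by
    intro e he
    have he := (Finset.mem_filter.1 he).2
    rw [hs e he, hs' e he]
    have := hd e he
    linear_combination this
  rw [Finset.sum_congr rfl h2, Finset.sum_add_distrib, Finset.sum_add_distrib] at h1
  have h3 : Lv r s B d + Lv r s' A d = 0 := by
    simpa [Lv] using h1
  exact (z2_add_eq_zero.1 h3).symm

end steps

end VO


set_option linter.unusedSectionVars false
set_option linter.unusedSimpArgs false

namespace VO

section trails

variable {G : StarGraph}

instance neZeroLen (T : ClosedTrail G) : NeZero T.len := ⟨T.len_pos.ne'⟩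

/-- characteristic function of the edges of a trail -/
def tchi (T : ClosedTrail G) (d : G.D) : ZMod 2 :=
  ∑ i, (dl (T.dart i) d + dl (G.edgeInv (T.dart i)) d)

lemma tchi_eq (T : ClosedTrail G) (d : G.D) :
    tchi T d = ∑ i, (dl (G.edgeInv (T.dart (i - 1))) d + dl (T.dart i) d) := by
  unfold tchi
  rw [Finset.sum_add_distrib, Finset.sum_add_distrib, add_comm]
  congr 1
  exact (Equiv.sum_comp (Equiv.subRight (1 : ZMod T.len))
    (fun i => dl (G.edgeInv (T.dart i)) d)).symm

lemma dl_inv (x d : G.D) : dl x (G.edgeInv d) = dl (G.edgeInv x) d := by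
  unfold dl
  have : G.edgeInv d = x ↔ d = G.edgeInv x :=
    ⟨fun h => by rw [← h, G.edgeInv_invol], fun h => by rw [h, G.edgeInv_invol]⟩
  simp only [this]

lemma sum_dl_mul (x : G.D) (B : G.D → ZMod 2) : ∑ d, dl x d * B d = B x := by
  unfold dl
  simp

lemma pass_same (T : ClosedTrail G) (i : ZMod T.len) :
    G.rot.SameCycle (G.edgeInv (T.dart (i - 1))) (T.dart i) := by
  have := T.next_sameVertex (i - 1)
  rwa [sub_add_cancel] at this

lemma pass_ne (T : ClosedTrail G) (i : ZMod T.len) :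
    G.edgeInv (T.dart (i - 1)) ≠ T.dart i := by
  intro h
  have h1 := T.edges_injective i (i - 1) (Or.inr h.symm)
  rw [← h1] at h
  exact G.edgeInv_ne _ h

lemma tchi_zc (T : ClosedTrail G) : Zc G.edgeInv G.rot (tchi T) := by
  constructor
  · intro d
    unfold tchi
    refine Finset.sum_congr rfl fun i _ => ?_
    rw [dl_inv, dl_inv, G.edgeInv_invol, add_comm]
  · intro B hB
    simp only [tchi_eq, Finset.sum_mul]
    rw [Finset.sum_comm]
    refine Finset.sum_eq_zero fun i _ => ?_
    simp only [add_mul, Finset.sum_add_distrib, sum_dl_mul]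
    rw [inv_sameCycle hB (pass_same T i)]
    exact CharTwo.add_self_eq_zero _

open Classical in
lemma tchi_val (T : ClosedTrail G) (d : G.D) :
    tchi T d = if ∃ i, d = T.dart i ∨ d = G.edgeInv (T.dart i) then 1 else 0 := by
  unfold tchi dl
  split_ifs with h
  · obtain ⟨i, hi⟩ := h
    rw [Finset.sum_eq_single_of_mem i (Finset.mem_univ _)]
    · have hn := G.edgeInv_ne (T.dart i)
      rcases hi with rfl | rfl
      · rw [if_pos rfl, if_neg (Ne.symm hn)]; rfl
      · rw [if_pos rfl, if_neg hn]; rfl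
    · intro j _ hj
      have hn : ¬ (T.dart i = T.dart j ∨ T.dart i = G.edgeInv (T.dart j)) :=
        fun h => hj (T.edges_injective _ _ h).symm
      push Not at hn
      rcases hi with rfl | rfl
      · rw [if_neg hn.1, if_neg hn.2]; rfl
      · rw [if_neg, if_neg]
        · rfl
        · intro h; exact hn.1 (G.edgeInv.injective h)
        · intro h; exact hn.2 (by rw [← h, G.edgeInv_invol])
  · push Not at h
    refine Finset.sum_eq_zero fun i _ => ?_
    rw [if_neg (h i).1, if_neg (h i).2]; rfl

lemma tchi_dart (T : ClosedTrail G) (i : ZMod T.len) : tchi T (T.dart i) = 1 := by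
  rw [tchi_val, if_pos ⟨i, Or.inl rfl⟩]

lemma tchi_inv (T : ClosedTrail G) (i : ZMod T.len) : tchi T (G.edgeInv (T.dart i)) = 1 := by
  rw [tchi_val, if_pos ⟨i, Or.inr rfl⟩]

lemma tchi_disj {A B : ClosedTrail G} (h : A.EdgeDisjoint B) (d : G.D) :
    tchi A d * tchi B d = 0 := by
  rw [tchi_val, tchi_val]
  split_ifs with h1 h2
  · obtain ⟨i, hi⟩ := h1
    obtain ⟨j, hj⟩ := h2
    exfalso
    have hh := h i j
    rcases hi with hi | hi <;> rcases hj with hj | hj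
    · exact hh.1 (hi ▸ hj)
    · exact hh.2 (hi ▸ hj)
    · exact hh.2 (by rw [← hj, hi, G.edgeInv_invol])
    · exact hh.1 (G.edgeInv.injective (hi ▸ hj))
  all_goals rfl

lemma disj_of_tchi {A B : ClosedTrail G} (h : ∀ d, tchi A d * tchi B d = 0) : A.EdgeDisjoint B := by
  intro i j
  constructor
  · intro hh
    have := h (A.dart i)
    rw [tchi_dart, hh, tchi_dart] at this
    exact absurd this (by decide)
  · intro hh
    have := h (A.dart i)
    rw [tchi_dart, hh, tchi_inv] at this
    exact absurd this (by decide)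

lemma crossing_iff {A B : ClosedTrail G} (h : A.EdgeDisjoint B) (p : ZMod A.len × ZMod B.len) :
    A.IsCrossing B p ↔
      itv G.rot (G.edgeInv (A.dart (p.1 - 1))) (A.dart p.1) (G.edgeInv (B.dart (p.2 - 1))) +
      itv G.rot (G.edgeInv (A.dart (p.1 - 1))) (A.dart p.1) (B.dart p.2) = 1 := by
  have pa := pass_same A p.1
  have pb := pass_same B p.2
  unfold ClosedTrail.IsCrossing
  by_cases hs : G.SameVertex (A.dart p.1) (B.dart p.2)
  · have hs' : G.rot.SameCycle (A.dart p.1) (B.dart p.2) := hs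
    rw [itv_alt pa ((pa.trans hs').trans pb.symm) (pa.trans hs')]
    · simp only [hs, true_and]
    · exact fun hh => (h p.1 (p.2 - 1)).2 hh.symm
    · exact fun hh => (h p.1 p.2).1 hh.symm
  · have h1 : ¬ G.rot.SameCycle (G.edgeInv (A.dart (p.1 - 1))) (B.dart p.2) :=
      fun hh => hs (pa.symm.trans hh)
    rw [itv_zero h1, itv_zero (fun hh => h1 (hh.trans pb))]
    simp [hs]

theorem crossing_parity {A B : ClosedTrail G} (h : A.EdgeDisjoint B) (s : G.D → ZMod 2)
    (hs : ∀ d, s (G.rot d) = s d + tchi A d) :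
    ∑ d, tchi B d * s d = (Nat.card {p : ZMod A.len × ZMod B.len // A.IsCrossing B p} : ZMod 2) := by
  classical
  let sA : G.D → ZMod 2 := fun d => ∑ i, itv G.rot (G.edgeInv (A.dart (i - 1))) (A.dart i) d
  have hsA : ∀ d, sA (G.rot d) = sA d + tchi A d := by
    intro d
    simp only [sA, tchi_eq]
    rw [← Finset.sum_add_distrib]
    exact Finset.sum_congr rfl fun i _ => itv_apply (pass_same A i) (pass_ne A i) d
  have h1 : ∑ d, tchi B d * s d = ∑ d, tchi B d * sA d := by
    have := (tchi_zc B).2 (fun d => s d + sA d) (fun d => by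
      simp only [hs, hsA]
      generalize s d = a
      generalize sA d = b
      generalize tchi A d = c
      revert a b c; decide)
    simp only [mul_add, Finset.sum_add_distrib] at this
    exact (z2_add_eq_zero.1 this).symm
  rw [h1]
  simp only [tchi_eq, Finset.sum_mul]
  rw [Finset.sum_comm]
  simp only [add_mul, Finset.sum_add_distrib, sum_dl_mul]
  rw [← Finset.sum_add_distrib, Nat.card_eq_fintype_card, Fintype.card_subtype,
    Finset.card_filter, Nat.cast_sum, Fintype.sum_prod_type_right]
  refine Finset.sum_congr rfl fun j _ => ?_
  simp only [sA]
  rw [← Finset.sum_add_distrib]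
  refine Finset.sum_congr rfl fun i _ => ?_
  have hc := crossing_iff h (i, j)
  by_cases hx : A.IsCrossing B (i, j)
  · rw [if_pos hx, hc.1 hx, Nat.cast_one]
  · rw [if_neg hx, Nat.cast_zero]
    by_contra hne
    exact hx (hc.2 (z2_ne hne))

/-- Planar *-graphs have no obstruct. -/
theorem no_obstruct_of_planar (hp : G.StarPlanar) : ¬ HasVassilievObstruct G := by
  classical
  rintro ⟨A, B, hd, hcard⟩
  obtain ⟨ρ, hcomp, heul⟩ := hp
  have hρ : ∀ B : G.D → ZMod 2, (∀ d, B (ρ d) = B d) ↔ ∀ d, B (G.rot d) = B d := by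
    intro B
    constructor
    · intro hB d
      rcases hcomp d with h | h
      · rw [← h d (Equiv.Perm.SameCycle.refl _ _), hB]
      · have := h (G.rot d) (Equiv.Perm.sameCycle_apply_right.2 (Equiv.Perm.SameCycle.refl _ _))
        rw [perm_self_inv] at this
        rw [← hB (G.rot d), this]
    · intro hB d
      rcases hcomp d with h | h
      · rw [h d (Equiv.Perm.SameCycle.refl _ _), hB]
      · rw [h d (Equiv.Perm.SameCycle.refl _ _), inv_symm hB]
  obtain ⟨c, hc, hcA⟩ := (euler G.edgeInv_invol G.edgeInv_ne hρ).1 heul (tchi A) (tchi_zc A)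
  have hc2 : ∀ d, c (ρ d) = c d + tchi A d := by
    intro d
    have := hc (G.edgeInv d)
    rw [G.edgeInv_invol] at this
    rw [this, ← hcA]
    generalize c d = a
    generalize c (G.edgeInv d) = b
    revert a b; decide
  -- the vertices where the orientation is kept
  let x : G.D → ZMod 2 := fun d => if ∀ e, G.SameVertex d e → ρ e = G.rot e then 0 else 1
  have hx : ∀ d, x (G.rot d) = x d := by
    intro d
    simp only [x, StarGraph.SameVertex, Equiv.Perm.sameCycle_apply_left]
    congr
  have hs : ∀ d, (c + x * tchi A) (G.rot d) = (c + x * tchi A) d + tchi A d := by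
    intro d
    simp only [Pi.add_apply, Pi.mul_apply, hx]
    by_cases h : ∀ e, G.SameVertex d e → ρ e = G.rot e
    · have hx0 : x d = 0 := if_pos h
      rw [hx0, ← h d (Equiv.Perm.SameCycle.refl _ _), hc2]
      ring
    · have hx1 : x d = 1 := if_neg h
      have h2 := (hcomp d).resolve_left h (G.rot d)
        (Equiv.Perm.sameCycle_apply_right.2 (Equiv.Perm.SameCycle.refl _ _))
      rw [perm_self_inv] at h2
      have h3 := hc2 (G.rot d)
      rw [h2] at h3
      rw [hx1, h3]
      generalize c (G.rot d) = a
      generalize tchi A d = b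
      generalize tchi A (G.rot d) = f
      revert a b f; decide
  have hpar := crossing_parity hd _ hs
  rw [hcard, Nat.cast_one] at hpar
  have hz : ∑ d, tchi B d * (c + x * tchi A) d = 0 := by
    refine sum_invol G.edgeInv G.edgeInv_invol G.edgeInv_ne _ fun d => ?_
    have h1 := tchi_disj hd d
    have h2 := hcA d
    simp only [Pi.add_apply, Pi.mul_apply]
    rw [(tchi_zc B).1, (tchi_zc A).1]
    linear_combination (1 + x d + x (G.edgeInv d)) * h1 + tchi B d * h2
  rw [hz] at hpar
  exact absurd hpar (by decide)

end trails

end VO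


set_option linter.unusedSectionVars false
set_option linter.unusedSimpArgs false

namespace VO

section exist

variable {G : StarGraph}

lemma exists_next {A : G.D → ZMod 2} (hA : Zc G.edgeInv G.rot A) {d : G.D} (hd : A d = 1) :
    ∃ e, A e = 1 ∧ e ≠ G.edgeInv d ∧ G.rot.SameCycle (G.edgeInv d) e := by
  classical
  by_contra hcon
  push Not at hcon
  have h := ev_sum_vertex hA.2 (G.edgeInv d)
  rw [Finset.sum_eq_single_of_mem (G.edgeInv d)
    (by simp [Equiv.Perm.SameCycle.refl]), hA.1, hd] at h
  · exact absurd h (by decide)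
  · intro e he hne
    by_contra h0
    exact hcon e (z2_ne h0) hne (Finset.mem_filter.1 he).2

/-- A nonzero even subgraph contains a simple closed trail. -/
theorem exists_trail {A : G.D → ZMod 2} (hA : Zc G.edgeInv G.rot A) {d₀ : G.D} (hd : A d₀ = 1) :
    ∃ T : ClosedTrail G, (∀ i, A (T.dart i) = 1) ∧
      ∀ i j, G.rot.SameCycle (T.dart i) (T.dart j) → i = j := by
  classical
  choose! nx h1 h2 h3 using fun d (hd : A d = 1) => exists_next hA hd
  let f : ℕ → G.D := fun n => nx^[n] d₀
  have fs : ∀ n, f (n + 1) = nx (f n) := fun n => Function.iterate_succ_apply' nx n d₀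
  have fA : ∀ n, A (f n) = 1 := by
    intro n
    induction n with
    | zero => exact hd
    | succ n ih => rw [fs]; exact h1 _ ih
  have fne : ∀ n, f (n + 1) ≠ G.edgeInv (f n) := fun n => by rw [fs]; exact h2 _ (fA n)
  have fsame : ∀ n, G.rot.SameCycle (G.edgeInv (f n)) (f (n + 1)) := fun n => by
    rw [fs]; exact h3 _ (fA n)
  have hex : ∃ j, ∃ i, i < j ∧ G.rot.SameCycle (f i) (f j) := by
    obtain ⟨a, b, hab, heq⟩ := Finite.exists_ne_map_eq_of_infinite f
    rcases lt_or_gt_of_ne hab with h | h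
    · exact ⟨b, a, h, by rw [heq]⟩
    · exact ⟨a, b, h, by rw [heq]⟩
  obtain ⟨i, hij, hsame⟩ := Nat.find_spec hex
  have hmin := fun m (hm : m < Nat.find hex) => Nat.find_min hex hm
  generalize Nat.find hex = j at *
  have hinj : ∀ a b, a < j → b < j → G.rot.SameCycle (f a) (f b) → a = b := by
    intro a b ha hb hab
    rcases lt_trichotomy a b with h | h | h
    · exact absurd ⟨a, h, hab⟩ (hmin b hb)
    · exact h
    · exact absurd ⟨b, h, hab.symm⟩ (hmin a ha)
  have : NeZero (j - i) := ⟨by omega⟩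
  have hlt : ∀ z : ZMod (j - i), i + z.val < j := fun z => by
    have := ZMod.val_lt z
    omega
  have hinv : ∀ a b, a < b → b < j → f a ≠ G.edgeInv (f b) := by
    intro a b hab hb h
    have e1 : G.edgeInv (f a) = f b := by rw [h, G.edgeInv_invol]
    have e2 := fsame a
    rw [e1] at e2
    have e3 := hinj b (a + 1) hb (by omega) e2
    exact fne a (by rw [← e3, e1])
  refine ⟨⟨j - i, by omega, fun z => f (i + z.val), fun z => ?_, fun z w hzw => ?_⟩,
    fun z => fA _, fun z w h => ?_⟩
  · by_cases hz : z.val + 1 < j - i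
    · have : (z + 1).val = z.val + 1 := by
        rw [ZMod.val_add_of_lt]
        · rw [ZMod.val_one'' (by omega)]
        · rw [ZMod.val_one'' (by omega)]; exact hz
      change G.rot.SameCycle _ _
      rw [this]
      exact fsame (i + z.val)
    · have hz' : z.val + 1 = j - i := by have := ZMod.val_lt z; omega
      have : z + 1 = 0 := by
        have h5 : ((z.val + 1 : ℕ) : ZMod (j - i)) = 0 := by rw [hz']; exact ZMod.natCast_self _
        rw [Nat.cast_add, ZMod.natCast_zmod_val, Nat.cast_one] at h5
        exact h5
      change G.rot.SameCycle _ _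
      rw [this, ZMod.val_zero, add_zero]
      have h6 := fsame (i + z.val)
      have h7 : i + z.val + 1 = j := by omega
      rw [h7] at h6
      exact h6.trans hsame.symm
  · apply ZMod.val_injective
    rcases hzw with h | h
    · have := hinj _ _ (hlt z) (hlt w) (by rw [h])
      omega
    · by_contra hne
      rcases lt_or_gt_of_ne hne with hl | hl
      · exact hinv (i + z.val) (i + w.val) (by omega) (hlt w) h
      · exact hinv (i + w.val) (i + z.val) (by omega) (hlt z) (by rw [h, G.edgeInv_invol])
  · apply ZMod.val_injective
    have := hinj _ _ (hlt z) (hlt w) h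
    omega

/-- the local shape of a simple closed trail -/
lemma trail_local {T : ClosedTrail G} (hT : ∀ i j, G.rot.SameCycle (T.dart i) (T.dart j) → i = j)
    {d : G.D} {i : ZMod T.len} (hi : G.rot.SameCycle d (T.dart i)) (e : G.D)
    (he : G.rot.SameCycle d e) :
    tchi T e = dl (G.edgeInv (T.dart (i - 1))) e + dl (T.dart i) e := by
  rw [tchi_eq, Finset.sum_eq_single_of_mem i (Finset.mem_univ _)]
  intro j _ hj
  have hn : ¬ G.rot.SameCycle d (T.dart j) := fun h => hj (hT _ _ (h.symm.trans hi))
  unfold dl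
  rw [if_neg, if_neg]
  · rfl
  · rintro rfl; exact hn he
  · rintro rfl; exact hn (he.trans (pass_same T j))

lemma trail_local_zero {T : ClosedTrail G}
    {d : G.D} (hi : ∀ i, ¬ G.rot.SameCycle d (T.dart i)) (e : G.D)
    (he : G.rot.SameCycle d e) : tchi T e = 0 := by
  rw [tchi_eq]
  refine Finset.sum_eq_zero fun j _ => ?_
  unfold dl
  rw [if_neg, if_neg]
  · rfl
  · rintro rfl; exact hi j he
  · rintro rfl; exact hi j (he.trans (pass_same T j))

end exist

section loc

variable {D : Type*} [Fintype D] [DecidableEq D] {ι r : Equiv.Perm D} [DecidableRel r.SameCycle]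

/-- `A` is a pair of darts at the vertex of `d` -/
def Pr (r : Equiv.Perm D) (A : D → ZMod 2) (d x y : D) : Prop :=
  x ≠ y ∧ r.SameCycle d x ∧ r.SameCycle d y ∧ ∀ e, r.SameCycle d e → A e = dl x e + dl y e

lemma Pr.swap {A : D → ZMod 2} {d x y : D} (h : Pr r A d x y) : Pr r A d y x :=
  ⟨h.1.symm, h.2.2.1, h.2.1, fun e he => by rw [h.2.2.2 e he, add_comm]⟩

lemma dl_self (x : D) : dl x x = 1 := if_pos rfl
lemma dl_ne {x y : D} (h : y ≠ x) : dl x y = 0 := if_neg h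

lemma Pr.one {A : D → ZMod 2} {d x y : D} (h : Pr r A d x y) : A x = 1 := by
  rw [h.2.2.2 x h.2.1, dl_self, dl_ne h.1, add_zero]

lemma sub_pair {A A' : D → ZMod 2} {d x y : D} (h : Pr r A d x y) (hs : ∀ e, A' e * A e = A' e)
    (e : D) (he : r.SameCycle d e) : A' e = A' x * dl x e + A' y * dl y e := by
  by_cases h1 : e = x
  · subst h1; rw [dl_self, dl_ne h.1, mul_one, mul_zero, add_zero]
  by_cases h2 : e = y
  · subst h2; rw [dl_self, dl_ne h1, mul_one, mul_zero, zero_add]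
  rw [← hs, h.2.2.2 e he, dl_ne h1, dl_ne h2]
  ring

lemma sub_sum {A A' : D → ZMod 2} {d x y : D} (h : Pr r A d x y) (hs : ∀ e, A' e * A e = A' e) :
    ∑ e ∈ Finset.univ.filter (r.SameCycle d), A' e = A' x + A' y := by
  rw [Finset.sum_congr rfl (fun e he => sub_pair h hs e (Finset.mem_filter.1 he).2),
    Finset.sum_add_distrib, ← Finset.mul_sum, ← Finset.mul_sum, sum_dl h.2.1, sum_dl h.2.2.1,
    mul_one, mul_one]

lemma even_sub {A A' : D → ZMod 2} {d : D}
    (h : (∀ e, r.SameCycle d e → A e = 0) ∨ ∃ x y, Pr r A d x y) (hs : ∀ e, A' e * A e = A' e)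
    (h0 : ∑ e ∈ Finset.univ.filter (r.SameCycle d), A' e = 0) :
    (∀ e, r.SameCycle d e → A' e = 0) ∨ (∀ e, r.SameCycle d e → A' e = A e) := by
  rcases h with h | ⟨x, y, h⟩
  · left
    intro e he
    rw [← hs, h e he, mul_zero]
  · rw [sub_sum h hs] at h0
    have hxy := z2_add_eq_zero.1 h0
    rcases z2 (A' x) with hx | hx
    · left
      intro e he
      rw [sub_pair h hs e he, hxy, hx]; ring
    · right
      intro e he
      rw [sub_pair h hs e he, hxy, hx, h.2.2.2 e he]; ring

lemma odd_sub {A A' : D → ZMod 2} {d : D}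
    (h : ∃ x y, Pr r A d x y) (hs : ∀ e, A' e * A e = A' e)
    (h0 : ∑ e ∈ Finset.univ.filter (r.SameCycle d), A' e = 1) :
    ∃ x y, Pr r A d x y ∧ ∀ e, r.SameCycle d e → A' e = dl x e := by
  obtain ⟨x, y, h⟩ := h
  rw [sub_sum h hs] at h0
  rcases z2 (A' x) with hx | hx
  · have hy : A' y = 1 := by rw [hx, zero_add] at h0; exact h0
    refine ⟨y, x, h.swap, fun e he => ?_⟩
    rw [sub_pair h hs e he, hx, hy]; ring
  · have hy : A' y = 0 := by
      rw [hx] at h0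
      generalize A' y = b at *
      revert b; decide
    refine ⟨x, y, h, fun e he => ?_⟩
    rw [sub_pair h hs e he, hx, hy]; ring

/-- At a crossing the two reconnections have no crossing. -/
lemma reconnect {S : (D → ZMod 2) → (D → ZMod 2)} {A B A' B' : D → ZMod 2} {d : D}
    (hS : ∀ A, Ev r A → ∀ d, S A (r d) = S A d + A d)
    (hA : ∃ x y, Pr r A d x y) (hB : ∃ x y, Pr r B d x y)
    (hsA : ∀ e, A' e * A e = A' e) (hsB : ∀ e, B' e * B e = B' e)
    (hAB : ∀ e, A e * B e = 0)
    (hA' : ∑ e ∈ Finset.univ.filter (r.SameCycle d), A' e = 1)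
    (hB' : ∑ e ∈ Finset.univ.filter (r.SameCycle d), B' e = 1)
    (hEA : Ev r A) (hE1 : Ev r (A' + B')) (hE2 : Ev r (A' + (B + B')))
    (hL : Lv r (S A) B d = 1) :
    Lv r (S (A' + B')) ((A + A') + (B + B')) d = 0 ∧
    Lv r (S (A' + (B + B'))) ((A + A') + B') d = 0 := by
  obtain ⟨a, a2, hA, ha⟩ := odd_sub hA hsA hA'
  obtain ⟨b, b2, hB, hb⟩ := odd_sub hB hsB hB'
  have hne : ∀ x y, A x = 1 → B y = 1 → x ≠ y := by
    rintro x _ h1 h2 rfl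
    have := hAB x
    rw [h1, h2] at this
    exact absurd this (by decide)
  have o1 := hA.one
  have o2 := hA.swap.one
  have o3 := hB.one
  have o4 := hB.swap.one
  have key : ∀ u v : ZMod 2, u + v + u = v := by decide
  have hal := (Lv_pair (fun e _ => hS A hEA e) hA.2.2.2 hB.2.2.2 hA.1 hA.2.1 hA.2.2.1 hB.2.1
    hB.2.2.1 (hne _ _ o2 o3).symm (hne _ _ o2 o4).symm).1 hL
  have hn := not_alt hal
  constructor
  · have := (Lv_pair (s := S (A' + B')) (B := (A + A') + (B + B')) (a₁ := a) (a₂ := b)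
      (b₁ := a2) (b₂ := b2) (d := d) (fun e _ => hS _ hE1 e)
      (fun e he => by rw [Pi.add_apply, ha e he, hb e he])
      (fun e he => by
        simp only [Pi.add_apply]
        rw [ha e he, hb e he, hA.2.2.2 e he, hB.2.2.2 e he, key, key])
      (hne _ _ o1 o3) hA.2.1 hB.2.1 hA.2.2.1 hB.2.2.1 (hne _ _ o2 o3) hB.1.symm).not.2 hn.1
    exact (z2 _).resolve_right this
  · have := (Lv_pair (s := S (A' + (B + B'))) (B := (A + A') + B') (a₁ := a) (a₂ := b2)
      (b₁ := a2) (b₂ := b) (d := d) (fun e _ => hS _ hE2 e)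
      (fun e he => by
        simp only [Pi.add_apply]
        rw [ha e he, hb e he, hB.2.2.2 e he, key])
      (fun e he => by
        simp only [Pi.add_apply]
        rw [ha e he, hb e he, hA.2.2.2 e he, key])
      (hne _ _ o1 o4) hA.2.1 hB.2.2.1 hA.2.2.1 hB.2.1 (hne _ _ o2 o4) hB.1).not.2 hn.2
    exact (z2 _).resolve_right this

lemma Lv_zero_right {s B : D → ZMod 2} {d : D} (h : ∀ e, r.SameCycle d e → B e = 0) :
    Lv r s B d = 0 := by
  unfold Lv
  refine Finset.sum_eq_zero fun e he => ?_
  rw [h e (Finset.mem_filter.1 he).2, zero_mul]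

/-- Away from the two reconnection points. -/
lemma away {S : (D → ZMod 2) → (D → ZMod 2)} {A B A' B' : D → ZMod 2} {d : D}
    (hS : ∀ A, Ev r A → ∀ d, S A (r d) = S A d + A d)
    (hA : (∀ e, r.SameCycle d e → A e = 0) ∨ ∃ x y, Pr r A d x y)
    (hB : (∀ e, r.SameCycle d e → B e = 0) ∨ ∃ x y, Pr r B d x y)
    (hsA : ∀ e, A' e * A e = A' e) (hsB : ∀ e, B' e * B e = B' e)
    (hAB : ∀ e, A e * B e = 0)
    (hA' : ∑ e ∈ Finset.univ.filter (r.SameCycle d), A' e = 0)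
    (hB' : ∑ e ∈ Finset.univ.filter (r.SameCycle d), B' e = 0)
    (hEA : Ev r A) (hEB : Ev r B) (hE1 : Ev r (A' + B')) (hE2 : Ev r (A' + (B + B')))
    (hF1 : Ev r ((A + A') + (B + B'))) (hF2 : Ev r ((A + A') + B')) :
    (Lv r (S (A' + B')) ((A + A') + (B + B')) d = 0 ∧
      Lv r (S (A' + (B + B'))) ((A + A') + B') d = Lv r (S A) B d) ∨
    (Lv r (S (A' + B')) ((A + A') + (B + B')) d = Lv r (S A) B d ∧
      Lv r (S (A' + (B + B'))) ((A + A') + B') d = 0) := by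
  have hsym : Lv r (S A) B d = Lv r (S B) A d :=
    Lv_symm (fun e _ => hS A hEA e) (fun e _ => hS B hEB e) (fun e _ => hAB e)
  have key : ∀ u : ZMod 2, u + u = 0 := by decide
  have hz : ∀ P Q : D → ZMod 2, Ev r P → Ev r Q → (∀ e, r.SameCycle d e → P e = 0) →
      Lv r (S P) Q d = 0 := by
    intro P Q hP hQ h
    rw [Lv_congr (s' := 0) (A' := 0) (B' := Q) (fun e _ => hS P hP e)
      (fun e _ => by simp) (fun e he => h e he) (fun _ _ => rfl) (ev_sum_vertex hQ d)]
    unfold Lv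
    simp
  have hc : ∀ P Q P' Q' : D → ZMod 2, Ev r P → Ev r Q → Ev r P' →
      (∀ e, r.SameCycle d e → P e = P' e) → (∀ e, r.SameCycle d e → Q e = Q' e) →
      Lv r (S P) Q d = Lv r (S P') Q' d := by
    intro P Q P' Q' hP hQ hP' h1 h2
    exact Lv_congr (fun e _ => hS P hP e) (fun e _ => hS P' hP' e) h1 h2 (ev_sum_vertex hQ d)
  rcases even_sub hA hsA hA' with ha | ha <;> rcases even_sub hB hsB hB' with hb | hb
  · left
    refine ⟨hz _ _ hE1 hF1 fun e he => ?_, ?_⟩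
    · simp only [Pi.add_apply]; rw [ha e he, hb e he, add_zero]
    · rw [hsym]
      refine hc _ _ _ _ hE2 hF2 hEB (fun e he => ?_) (fun e he => ?_)
      · simp only [Pi.add_apply]; rw [ha e he, hb e he, add_zero, zero_add]
      · simp only [Pi.add_apply]; rw [ha e he, hb e he, add_zero, add_zero]
  · right
    refine ⟨?_, hz _ _ hE2 hF2 fun e he => ?_⟩
    · rw [hsym]
      refine hc _ _ _ _ hE1 hF1 hEB (fun e he => ?_) (fun e he => ?_)
      · simp only [Pi.add_apply]; rw [ha e he, hb e he, zero_add]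
      · simp only [Pi.add_apply]; rw [ha e he, hb e he, key, add_zero, add_zero]
    · simp only [Pi.add_apply]; rw [ha e he, hb e he, key, add_zero]
  · right
    refine ⟨?_, Lv_zero_right fun e he => ?_⟩
    · refine hc _ _ _ _ hE1 hF1 hEA (fun e he => ?_) (fun e he => ?_)
      · simp only [Pi.add_apply]; rw [ha e he, hb e he, add_zero]
      · simp only [Pi.add_apply]; rw [ha e he, hb e he, key, add_zero, zero_add]
    · simp only [Pi.add_apply]; rw [ha e he, hb e he, key, add_zero]
  · left
    refine ⟨Lv_zero_right fun e he => ?_, ?_⟩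
    · simp only [Pi.add_apply]; rw [ha e he, hb e he, key, key, add_zero]
    · refine hc _ _ _ _ hE2 hF2 hEA (fun e he => ?_) (fun e he => ?_)
      · simp only [Pi.add_apply]; rw [ha e he, hb e he, key, add_zero]
      · simp only [Pi.add_apply]; rw [ha e he, hb e he, key, zero_add]

end loc

end VO


set_option linter.unusedSectionVars false
set_option linter.unusedSimpArgs false

namespace VO

section arcs

variable {D : Type*} [Fintype D] [DecidableEq D] {ι r : Equiv.Perm D} [DecidableRel r.SameCycle]

/-- minimal even subgraphs -/
def Mn (ι r : Equiv.Perm D) (A : D → ZMod 2) : Prop :=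
  ∀ A₁, Zc ι r A₁ → (∀ e, A₁ e * A e = A₁ e) → A₁ = 0 ∨ A₁ = A

/-- A minimal even subgraph contains an arc between any two of its vertices. -/
lemma exists_arc (hι : ∀ d, ι (ι d) = d) (hn : ∀ d, ι d ≠ d) {A : D → ZMod 2} (hA : Zc ι r A)
    (hmin : Mn ι r A) {v w : D} (hv : A v = 1) (hw : A w = 1) :
    ∃ A' : D → ZMod 2, (∀ d, A' (ι d) = A' d) ∧ (∀ e, A' e * A e = A' e) ∧
      ∀ d, ∑ e ∈ Finset.univ.filter (r.SameCycle d), A' e =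
        (if r.SameCycle v d then 1 else 0) + (if r.SameCycle w d then 1 else 0) := by
  let U : Submodule (ZMod 2) (D → ZMod 2) :=
    { carrier := {C | (∀ d, C (ι d) = C d) ∧ ∀ e, C e * A e = C e}
      add_mem' := by
        rintro a b ⟨h1, h2⟩ ⟨h3, h4⟩
        refine ⟨fun d => ?_, fun d => ?_⟩
        · simp only [Pi.add_apply]; rw [h1, h3]
        · simp only [Pi.add_apply]; rw [add_mul, h2, h4]
      zero_mem' := ⟨fun _ => rfl, fun _ => by simp⟩
      smul_mem' := by
        rintro c a ⟨h1, h2⟩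
        refine ⟨fun d => ?_, fun d => ?_⟩
        · simp only [Pi.smul_apply]; rw [h1]
        · simp only [Pi.smul_apply]; rw [smul_mul_assoc, h2] }
  let bd : (D → ZMod 2) →ₗ[ZMod 2] (D → ZMod 2) :=
    { toFun := fun C d => ∑ e ∈ Finset.univ.filter (r.SameCycle d), C e
      map_add' := fun a b => funext fun d => by
        simp only [Pi.add_apply, Finset.sum_add_distrib]
      map_smul' := fun c a => funext fun d => by
        simp only [Pi.smul_apply, Finset.smul_sum, RingHom.id_apply] }
  have hmem := mem_of_dual (U.map bd)
    (fun d => (if r.SameCycle v d then 1 else 0) + (if r.SameCycle w d then 1 else 0)) (by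
    intro B hB
    let f : D → ZMod 2 := fun e => ∑ d, if r.SameCycle e d then B d else 0
    have hf : ∀ e, f (r e) = f e := by
      intro e
      simp only [f, Equiv.Perm.sameCycle_apply_left]
    have hBf : ∀ C ∈ U, ∑ e, f e * C e = 0 := by
      intro C hC
      have := hB (bd C) ⟨C, hC, rfl⟩
      rw [← this]
      simp only [f, bd, LinearMap.coe_mk, AddHom.coe_mk, Finset.sum_filter, Finset.sum_mul,
        Finset.mul_sum]
      rw [Finset.sum_comm]
      refine Finset.sum_congr rfl fun d _ => Finset.sum_congr rfl fun e _ => ?_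
      by_cases h : r.SameCycle d e
      · rw [if_pos h, if_pos h.symm]
      · rw [if_neg h, if_neg (fun h' => h h'.symm), zero_mul, mul_zero]
    have hfι : ∀ x, A x = 1 → f (ι x) = f x := by
      intro x hx
      have hmul : ∀ y, ∑ d, f d * dl y d = f y := fun y => by
        unfold dl; simp
      have hdl : ∀ y d, dl y (ι d) = dl (ι y) d := by
        intro y d
        unfold dl
        have : ι d = y ↔ d = ι y := ⟨fun h => by rw [← h, hι], fun h => by rw [h, hι]⟩
        simp only [this]
      have := hBf (dl x + dl (ι x)) ⟨fun d => by
          simp only [Pi.add_apply]; rw [hdl, hdl, hι, add_comm], fun e => by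
          simp only [Pi.add_apply]
          by_cases h1 : e = x
          · rw [h1, hx, mul_one]
          by_cases h2 : e = ι x
          · rw [h2, hA.1, hx, mul_one]
          rw [dl_ne h1, dl_ne h2, add_zero, zero_mul]⟩
      simp only [Pi.add_apply, mul_add, Finset.sum_add_distrib, hmul] at this
      exact z2_add_eq_zero.1 this
    have hZ : Zc ι r (fun d => A d * f d) := by
      refine ⟨fun d => ?_, fun C hC => ?_⟩
      · simp only
        rw [hA.1]
        rcases z2 (A d) with h | h
        · rw [h, zero_mul, zero_mul]
        · rw [hfι d h]
      · have := hA.2 (fun d => f d * C d) (fun d => by simp only [hf, hC])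
        simpa only [mul_assoc] using this
    have hfvw : f v = f w := by
      have hsq : ∀ a b : ZMod 2, a * b * a = a * b := by decide
      rcases hmin _ hZ (fun e => hsq _ _) with h | h
      · have e1 := congrFun h v
        have e2 := congrFun h w
        simp only [hv, hw, one_mul] at e1 e2
        rw [e1, e2]; rfl
      · have e1 := congrFun h v
        have e2 := congrFun h w
        simp only [hv, hw, one_mul] at e1 e2
        rw [e1, e2]
    simp only [mul_add, Finset.sum_add_distrib, mul_ite, mul_one, mul_zero]
    change f v + f w = 0
    rw [hfvw]
    exact CharTwo.add_self_eq_zero _)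
  obtain ⟨A', hA', h⟩ := hmem
  exact ⟨A', hA'.1, hA'.2, fun d => congrFun h d⟩

/-- size -/
def sz (A : D → ZMod 2) : ℕ := ∑ d, (A d).val

lemma sz_le {A A₁ : D → ZMod 2} (h : ∀ e, A₁ e * A e = A₁ e) (hne : A₁ ≠ A) : sz A₁ < sz A := by
  obtain ⟨d, hd⟩ := Function.ne_iff.1 hne
  have key : ∀ a b : ZMod 2, a * b = a → a.val ≤ b.val := by decide
  have key2 : ∀ a b : ZMod 2, a * b = a → a ≠ b → a.val < b.val := by decide
  exact Finset.sum_lt_sum (fun e _ => key _ _ (h e)) ⟨d, Finset.mem_univ _, key2 _ _ (h d) hd⟩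

end arcs

section main

variable {G : StarGraph}

open Classical in
/-- number of darts at crossing vertices -/
noncomputable def nc (S : (G.D → ZMod 2) → (G.D → ZMod 2)) (A B : G.D → ZMod 2) : ℕ :=
  (Finset.univ.filter fun d => Lv G.rot (S A) B d = 1).card

/-- complexity of a pair -/
noncomputable def cx (S : (G.D → ZMod 2) → (G.D → ZMod 2)) (A B : G.D → ZMod 2) : ℕ :=
  (sz A + sz B) * (Fintype.card G.D + 1) + nc S A B

lemma cx_lt {S : (G.D → ZMod 2) → (G.D → ZMod 2)} {A B A₁ B₁ : G.D → ZMod 2}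
    (h : sz A₁ + sz B₁ < sz A + sz B) : cx S A₁ B₁ < cx S A B := by
  unfold cx
  have h1 : nc S A₁ B₁ ≤ Fintype.card G.D := Finset.card_le_univ _
  have h2 : (sz A₁ + sz B₁ + 1) * (Fintype.card G.D + 1) ≤ (sz A + sz B) * (Fintype.card G.D + 1) :=
    Nat.mul_le_mul_right _ h
  rw [add_mul (sz A₁ + sz B₁)] at h2
  omega

theorem descent (hno : ¬ HasVassilievObstruct G)
    (S : (G.D → ZMod 2) →ₗ[ZMod 2] (G.D → ZMod 2))
    (hS : ∀ A, Ev G.rot A → ∀ d, S A (G.rot d) = S A d + A d) :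
    ∀ n A B, Zc G.edgeInv G.rot A → Zc G.edgeInv G.rot B → (∀ d, A d * B d = 0) →
      cx S A B = n → ∑ d, B d * S A d = 0 := by
  classical
  intro n
  induction n using Nat.strong_induction_on with
  | _ n ih =>
  intro A B hA hB hAB hn
  subst hn
  by_contra hne
  have hone := z2_ne hne
  have key : ∀ a : ZMod 2, a + a = 0 := by decide
  -- minimality
  have hmA : Mn G.edgeInv G.rot A := by
    intro A₁ hA₁ hs
    by_contra hc
    push Not at hc
    have hs2 : ∀ e, (A + A₁) e * A e = (A + A₁) e := fun e => by
      simp only [Pi.add_apply]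
      rw [add_mul, hs]
      have : ∀ a : ZMod 2, a * a = a := by decide
      rw [this]
    have hd : ∀ C : G.D → ZMod 2, (∀ e, C e * A e = C e) → ∀ d, C d * B d = 0 := fun C h d => by
      rw [← h, mul_assoc, hAB, mul_zero]
    have i1 := ih _ (cx_lt (by have := sz_le hs hc.2; omega)) A₁ B hA₁ hB (hd _ hs) rfl
    have hne2 : A + A₁ ≠ A := fun h => hc.1 (by simpa using h)
    have i2 := ih _ (cx_lt (by have := sz_le hs2 hne2; omega)) (A + A₁) B (hA.add hA₁) hB
      (hd _ hs2) rfl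
    rw [map_add] at i2
    simp only [Pi.add_apply, mul_add, Finset.sum_add_distrib] at i2
    rw [i1, add_zero] at i2
    exact hne i2
  have hmB : Mn G.edgeInv G.rot B := by
    intro B₁ hB₁ hs
    by_contra hc
    push Not at hc
    have hs2 : ∀ e, (B + B₁) e * B e = (B + B₁) e := fun e => by
      simp only [Pi.add_apply]
      rw [add_mul, hs]
      have : ∀ a : ZMod 2, a * a = a := by decide
      rw [this]
    have hd : ∀ C : G.D → ZMod 2, (∀ e, C e * B e = C e) → ∀ d, A d * C d = 0 := fun C h d => by
      rw [← h, mul_comm (C d), ← mul_assoc, hAB, zero_mul]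
    have i1 := ih _ (cx_lt (by have := sz_le hs hc.2; omega)) A B₁ hA hB₁ (hd _ hs) rfl
    have hne2 : B + B₁ ≠ B := fun h => hc.1 (by simpa using h)
    have i2 := ih _ (cx_lt (by have := sz_le hs2 hne2; omega)) A (B + B₁) hA (hB.add hB₁)
      (hd _ hs2) rfl
    simp only [Pi.add_apply, add_mul, Finset.sum_add_distrib] at i2
    rw [i1, add_zero] at i2
    exact hne i2
  -- trails
  have htr : ∀ C : G.D → ZMod 2, Zc G.edgeInv G.rot C → Mn G.edgeInv G.rot C → C ≠ 0 →
      ∃ T : ClosedTrail G, tchi T = C ∧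
        ∀ i j, G.rot.SameCycle (T.dart i) (T.dart j) → i = j := by
    intro C hC hm h0
    obtain ⟨d, hd⟩ := Function.ne_iff.1 h0
    obtain ⟨T, h1, h2⟩ := exists_trail hC (z2_ne hd)
    refine ⟨T, ?_, h2⟩
    refine (hm _ (tchi_zc T) fun e => ?_).resolve_left fun h => ?_
    · rw [tchi_val]
      split_ifs with he
      · obtain ⟨i, rfl | rfl⟩ := he
        · rw [h1, mul_one]
        · rw [hC.1, h1, mul_one]
      · rw [zero_mul]
    · have := tchi_dart T 0
      rw [h] at this
      exact absurd this (show ¬ ((0 : ZMod 2) = 1) by decide)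
  obtain ⟨TA, rfl, hTA⟩ := htr A hA hmA (by
    rintro rfl
    rw [map_zero] at hne
    simp at hne)
  obtain ⟨TB, rfl, hTB⟩ := htr B hB hmB (by
    rintro rfl
    simp at hne)
  have hdis := disj_of_tchi hAB
  have hpar := crossing_parity hdis (S (tchi TA)) (hS _ hA.2)
  rw [hone] at hpar
  have hc1 : Nat.card {p : ZMod TA.len × ZMod TB.len // TA.IsCrossing TB p} ≠ 1 :=
    fun h => hno ⟨TA, TB, hdis, h⟩
  have hc0 : Nat.card {p : ZMod TA.len × ZMod TB.len // TA.IsCrossing TB p} ≠ 0 := fun h => by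
    rw [h] at hpar
    exact absurd hpar (by decide)
  have hc2 : 1 < Nat.card {p : ZMod TA.len × ZMod TB.len // TA.IsCrossing TB p} := by omega
  obtain ⟨⟨p, hp⟩, ⟨q, hq⟩, hpq⟩ := (Finite.one_lt_card_iff_nontrivial.1 hc2).exists_pair_ne
  have hpq' : p ≠ q := fun h => hpq (Subtype.ext h)
  have hsp : G.rot.SameCycle (TA.dart p.1) (TB.dart p.2) := hp.1
  have hsq : G.rot.SameCycle (TA.dart q.1) (TB.dart q.2) := hq.1
  have hv : ¬ G.rot.SameCycle (TA.dart p.1) (TA.dart q.1) := by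
    intro h
    have e1 := hTA _ _ h
    have e2 := hTB _ _ ((hsp.symm.trans h).trans hsq)
    exact hpq' (Prod.ext e1 e2)
  -- local shapes
  have hPr : ∀ (T : ClosedTrail G), (∀ i j, G.rot.SameCycle (T.dart i) (T.dart j) → i = j) →
      ∀ d i, G.rot.SameCycle d (T.dart i) →
      Pr G.rot (tchi T) d (G.edgeInv (T.dart (i - 1))) (T.dart i) := by
    intro T hT d i hi
    exact ⟨pass_ne T i, hi.trans (pass_same T i).symm, hi, trail_local hT hi⟩
  have hsh : ∀ (T : ClosedTrail G), (∀ i j, G.rot.SameCycle (T.dart i) (T.dart j) → i = j) →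
      ∀ d, (∀ e, G.rot.SameCycle d e → tchi T e = 0) ∨ ∃ x y, Pr G.rot (tchi T) d x y := by
    intro T hT d
    by_cases h : ∃ i, G.rot.SameCycle d (T.dart i)
    · obtain ⟨i, hi⟩ := h
      exact Or.inr ⟨_, _, hPr T hT d i hi⟩
    · push Not at h
      exact Or.inl (trail_local_zero h)
  have hcr : ∀ z : ZMod TA.len × ZMod TB.len, TA.IsCrossing TB z → ∀ d,
      G.rot.SameCycle (TA.dart z.1) d → (∃ x y, Pr G.rot (tchi TA) d x y) ∧
      (∃ x y, Pr G.rot (tchi TB) d x y) ∧ Lv G.rot (S (tchi TA)) (tchi TB) d = 1 := by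
    intro z hz d hd
    have hz1 : G.rot.SameCycle (TA.dart z.1) (TB.dart z.2) := hz.1
    have p1 := hPr TA hTA d z.1 hd.symm
    have p2 := hPr TB hTB d z.2 (hd.symm.trans hz1)
    refine ⟨⟨_, _, p1⟩, ⟨_, _, p2⟩, ?_⟩
    refine (Lv_pair (fun e _ => hS _ hA.2 e) p1.2.2.2 p2.2.2.2 p1.1 p1.2.1 p1.2.2.1 p2.2.1 p2.2.2.1
      ?_ ?_).2 hz.2
    · exact fun h => (hdis z.1 (z.2 - 1)).2 h.symm
    · exact fun h => (hdis z.1 z.2).1 h.symm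
  obtain ⟨A', hA'ι, hA's, hA'b⟩ := exists_arc G.edgeInv_invol G.edgeInv_ne hA hmA
    (tchi_dart TA p.1) (tchi_dart TA q.1)
  obtain ⟨B', hB'ι, hB's, hB'b⟩ := exists_arc G.edgeInv_invol G.edgeInv_ne hB hmB
    (tchi_dart TB p.2) (tchi_dart TB q.2)
  have hB'b : ∀ d, ∑ e ∈ Finset.univ.filter (G.rot.SameCycle d), B' e =
      (if G.rot.SameCycle (TA.dart p.1) d then 1 else 0) +
      (if G.rot.SameCycle (TA.dart q.1) d then 1 else 0) := by
    intro d
    rw [hB'b]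
    have e1 : G.rot.SameCycle (TB.dart p.2) d ↔ G.rot.SameCycle (TA.dart p.1) d :=
      ⟨fun h => hsp.trans h, fun h => hsp.symm.trans h⟩
    have e2 : G.rot.SameCycle (TB.dart q.2) d ↔ G.rot.SameCycle (TA.dart q.1) d :=
      ⟨fun h => hsq.trans h, fun h => hsq.symm.trans h⟩
    simp only [e1, e2]
  generalize hAg : tchi TA = A at *
  generalize hBg : tchi TB = B at *
  have hZ1 : Zc G.edgeInv G.rot (A' + B') := by
    refine ⟨fun d => ?_, ev_of_vertex fun d => ?_⟩
    · simp only [Pi.add_apply]; rw [hA'ι, hB'ι]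
    · simp only [Pi.add_apply, Finset.sum_add_distrib]
      rw [hA'b, hB'b]; exact key _
  have hZ2 : Zc G.edgeInv G.rot (A' + (B + B')) := by
    have : A' + (B + B') = (A' + B') + B := by ring
    rw [this]; exact hZ1.add hB
  have hZ3 : Zc G.edgeInv G.rot ((A + A') + (B + B')) := by
    have : (A + A') + (B + B') = (A' + B') + (A + B) := by ring
    rw [this]; exact hZ1.add (hA.add hB)
  have hZ4 : Zc G.edgeInv G.rot ((A + A') + B') := by
    have : (A + A') + B' = (A' + B') + A := by ring
    rw [this]; exact hZ1.add hA
  have hd1 : ∀ d, (A' + B') d * ((A + A') + (B + B')) d = 0 := fun d => by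
    have k : ∀ a b a' b' : ZMod 2, a' * a = a' → b' * b = b' → a * b = 0 →
      (a' + b') * ((a + a') + (b + b')) = 0 := by decide
    exact k _ _ _ _ (hA's d) (hB's d) (hAB d)
  have hd2 : ∀ d, (A' + (B + B')) d * ((A + A') + B') d = 0 := fun d => by
    have k : ∀ a b a' b' : ZMod 2, a' * a = a' → b' * b = b' → a * b = 0 →
      (a' + (b + b')) * ((a + a') + b') = 0 := by decide
    exact k _ _ _ _ (hA's d) (hB's d) (hAB d)
  have hs1 : sz (A' + B') + sz ((A + A') + (B + B')) = sz A + sz B := by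
    unfold sz
    rw [← Finset.sum_add_distrib, ← Finset.sum_add_distrib]
    refine Finset.sum_congr rfl fun d _ => ?_
    have k : ∀ a b a' b' : ZMod 2, a' * a = a' → b' * b = b' → a * b = 0 →
      (a' + b').val + ((a + a') + (b + b')).val = a.val + b.val := by decide
    exact k _ _ _ _ (hA's d) (hB's d) (hAB d)
  have hs2 : sz (A' + (B + B')) + sz ((A + A') + B') = sz A + sz B := by
    unfold sz
    rw [← Finset.sum_add_distrib, ← Finset.sum_add_distrib]
    refine Finset.sum_congr rfl fun d _ => ?_
    have k : ∀ a b a' b' : ZMod 2, a' * a = a' → b' * b = b' → a * b = 0 →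
      (a' + (b + b')).val + ((a + a') + b').val = a.val + b.val := by decide
    exact k _ _ _ _ (hA's d) (hB's d) (hAB d)
  -- at the two reconnection vertices
  have hat : ∀ d, (G.rot.SameCycle (TA.dart p.1) d ∨ G.rot.SameCycle (TA.dart q.1) d) →
      Lv G.rot (S A) B d = 1 ∧ Lv G.rot (S (A' + B')) ((A + A') + (B + B')) d = 0 ∧
      Lv G.rot (S (A' + (B + B'))) ((A + A') + B') d = 0 := by
    intro d hd
    have hb : (if G.rot.SameCycle (TA.dart p.1) d then 1 else 0) +
        (if G.rot.SameCycle (TA.dart q.1) d then 1 else 0) = (1 : ZMod 2) := by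
      rcases hd with h | h
      · rw [if_pos h, if_neg (fun h' => hv (h.trans h'.symm)), add_zero]
      · rw [if_pos h, if_neg (fun h' => hv (h'.trans h.symm)), zero_add]
    have hcc : (∃ x y, Pr G.rot A d x y) ∧ (∃ x y, Pr G.rot B d x y) ∧
        Lv G.rot (S A) B d = 1 := by
      rcases hd with h | h
      · exact hcr p hp d h
      · exact hcr q hq d h
    obtain ⟨c1, c2, c3⟩ := hcc
    exact ⟨c3, reconnect hS c1 c2 hA's hB's hAB ((hA'b d).trans hb) ((hB'b d).trans hb)
      hA.2 hZ1.2 hZ2.2 c3⟩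
  have hshA := hsh TA hTA
  have hshB := hsh TB hTB
  rw [hAg] at hshA
  rw [hBg] at hshB
  have haw : ∀ d, ¬ (G.rot.SameCycle (TA.dart p.1) d ∨ G.rot.SameCycle (TA.dart q.1) d) →
      (Lv G.rot (S (A' + B')) ((A + A') + (B + B')) d = 0 ∧
        Lv G.rot (S (A' + (B + B'))) ((A + A') + B') d = Lv G.rot (S A) B d) ∨
      (Lv G.rot (S (A' + B')) ((A + A') + (B + B')) d = Lv G.rot (S A) B d ∧
        Lv G.rot (S (A' + (B + B'))) ((A + A') + B') d = 0) := by
    intro d hd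
    push Not at hd
    have hb : (if G.rot.SameCycle (TA.dart p.1) d then 1 else 0) +
        (if G.rot.SameCycle (TA.dart q.1) d then 1 else 0) = (0 : ZMod 2) := by
      rw [if_neg hd.1, if_neg hd.2, add_zero]
    exact away hS (hshA d) (hshB d) hA's hB's hAB ((hA'b d).trans hb) ((hB'b d).trans hb)
      hA.2 hB.2 hZ1.2 hZ2.2 hZ3.2 hZ4.2
  have hp0 := hat (TA.dart p.1) (Or.inl (Equiv.Perm.SameCycle.refl _ _))
  have h01 : (0 : ZMod 2) ≠ 1 := by decide
  have hn1 : nc S (A' + B') ((A + A') + (B + B')) < nc S A B := by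
    refine Finset.card_lt_card (Finset.ssubset_iff_of_subset (fun d hd => ?_) |>.2
      ⟨TA.dart p.1, ?_, ?_⟩)
    · rw [Finset.mem_filter] at hd ⊢
      refine ⟨Finset.mem_univ _, ?_⟩
      by_cases h : G.rot.SameCycle (TA.dart p.1) d ∨ G.rot.SameCycle (TA.dart q.1) d
      · exact (hat d h).1
      · rcases haw d h with h' | h'
        · rw [h'.1] at hd; exact absurd hd.2 h01
        · rw [← h'.1]; exact hd.2
    · rw [Finset.mem_filter]; exact ⟨Finset.mem_univ _, hp0.1⟩
    · rw [Finset.mem_filter, hp0.2.1]; exact fun h => h01 h.2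
  have hn2 : nc S (A' + (B + B')) ((A + A') + B') < nc S A B := by
    refine Finset.card_lt_card (Finset.ssubset_iff_of_subset (fun d hd => ?_) |>.2
      ⟨TA.dart p.1, ?_, ?_⟩)
    · rw [Finset.mem_filter] at hd ⊢
      refine ⟨Finset.mem_univ _, ?_⟩
      by_cases h : G.rot.SameCycle (TA.dart p.1) d ∨ G.rot.SameCycle (TA.dart q.1) d
      · exact (hat d h).1
      · rcases haw d h with h' | h'
        · rw [← h'.2]; exact hd.2
        · rw [h'.2] at hd; exact absurd hd.2 h01
    · rw [Finset.mem_filter]; exact ⟨Finset.mem_univ _, hp0.1⟩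
    · rw [Finset.mem_filter, hp0.2.2]; exact fun h => h01 h.2
  have r1 := ih _ (by unfold cx; rw [hs1]; omega) _ _ hZ1 hZ3 hd1 rfl
  have r2 := ih _ (by unfold cx; rw [hs2]; omega) _ _ hZ2 hZ4 hd2 rfl
  -- the sum
  have hF : Ev G.rot (fun e => ((A + A') + (B + B')) e * S (A' + B') e +
      ((A + A') + B') e * S (A' + (B + B')) e + B e * S A e +
      (dl (TA.dart p.1) e + dl (TA.dart q.1) e)) := by
    refine ev_of_vertex fun d => ?_
    simp only [Finset.sum_add_distrib]
    change Lv G.rot (S (A' + B')) ((A + A') + (B + B')) d +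
      Lv G.rot (S (A' + (B + B'))) ((A + A') + B') d + Lv G.rot (S A) B d + _ = 0
    have hdl : ∀ x : G.D, ∑ e ∈ Finset.univ.filter (G.rot.SameCycle d), dl x e =
        if G.rot.SameCycle x d then 1 else 0 := by
      intro x
      split_ifs with h
      · exact sum_dl h.symm
      · refine Finset.sum_eq_zero fun e he => dl_ne ?_
        rintro rfl
        exact h (Finset.mem_filter.1 he).2.symm
    rw [hdl, hdl]
    by_cases h : G.rot.SameCycle (TA.dart p.1) d ∨ G.rot.SameCycle (TA.dart q.1) d
    · obtain ⟨c1, c2, c3⟩ := hat d h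
      rw [c1, c2, c3]
      rcases h with h | h
      · rw [if_pos h, if_neg (fun h' => hv (h.trans h'.symm))]; rfl
      · rw [if_pos h, if_neg (fun h' => hv (h'.trans h.symm))]; rfl
    · have h' := h
      push Not at h'
      rw [if_neg h'.1, if_neg h'.2]
      rcases haw d h with ⟨c1, c2⟩ | ⟨c1, c2⟩
      · rw [c1, c2, zero_add, key, add_zero, add_zero]
      · rw [c1, c2, add_zero, key, add_zero, add_zero]
  have hT := hF (fun _ => 1) (fun _ => rfl)
  simp only [mul_one, Finset.sum_add_distrib] at hT
  have hd1' : ∀ x : G.D, ∑ e, dl x e = 1 := fun x => by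
    unfold dl; simp
  rw [r1, r2, hone, hd1', hd1'] at hT
  exact absurd hT (by decide)

theorem planar_of_no_obstruct (hdeg : ∀ d : G.D, G.degree d = 4 ∨ G.degree d = 6)
    (hno : ¬ HasVassilievObstruct G) : G.StarPlanar := by
  classical
  obtain ⟨S, hS⟩ := exists_S G.rot
  obtain ⟨o, ho⟩ := exists_o G.edgeInv G.edgeInv_invol G.edgeInv_ne
  have hdeg' : ∀ d, (Finset.univ.filter (G.rot.SameCycle d)).card = 4 ∨
      (Finset.univ.filter (G.rot.SameCycle d)).card = 6 := by
    intro d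
    have : G.degree d = (Finset.univ.filter (G.rot.SameCycle d)).card := by
      unfold StarGraph.degree StarGraph.SameVertex
      rw [Nat.card_eq_fintype_card, Fintype.card_subtype]
    rw [← this]
    exact hdeg d
  obtain ⟨y, hy, h⟩ := reduction G.edgeInv_invol G.edgeInv_ne hdeg' S hS o ho
    (fun A B hA hB hd => descent hno S hS _ A B hA hB hd rfl)
  obtain ⟨ρ, hρ⟩ := exists_rho hy
  have hyc : ∀ d e, G.SameVertex d e → y e = y d := fun d e he => inv_sameCycle hy he
  refine ⟨ρ, fun d => ?_, ?_⟩
  · by_cases h0 : y d = 0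
    · left
      intro e he
      rw [hρ, if_pos (by rw [hyc d e he, h0])]
    · right
      intro e he
      rw [hρ, if_neg (by rw [hyc d e he]; exact h0)]
  · refine (euler G.edgeInv_invol G.edgeInv_ne ?_).2
      (exists_face G.edgeInv_invol G.edgeInv_ne hS ho hy h hρ)
    intro B
    constructor
    · intro hB d
      by_cases h0 : y d = 0
      · have := hB d
        rwa [hρ, if_pos h0] at this
      · have := hB (G.rot d)
        rw [hρ, if_neg (by rw [hy]; exact h0), perm_self_inv] at this
        exact this.symm
    · intro hB d
      rw [hρ]
      split_ifs
      · exact hB d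
      · exact inv_symm hB d

end main

end VO

/-- A *-graph in which every vertex has degree 4 or 6 admits a *-embedding into
the plane if and only if it does not contain a Vassiliev obstruct. -/
theorem starPlanar_iff_no_vassilievObstruct (G : StarGraph)
    (hdeg : ∀ d : G.D, G.degree d = 4 ∨ G.degree d = 6) :
    G.StarPlanar ↔ ¬ HasVassilievObstruct G := by
  exact ⟨VO.no_obstruct_of_planar, VO.planar_of_no_obstruct hdeg⟩
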